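/- arXiv:2511.15226 — 2 statements merged into one kernel-verified Lean document; each statement's English description precedes it below -/
import Mathlib

section
/- Every signed connected simple subcubic graph (G, σ) other than Γ̂₁ (K₄ with a negative perfect matching) satisfies F(G, σ) ≤ (3v(G) + 2)/8. -/
open scoped Classical

/-- The Boolean indicating whether an edge crosses the vertex set `X`. -/
noncomputable def sgnCross {V : Type*} (X : Set V) : Sym2 V → Bool :=
  Sym2.lift ⟨fun a b => xor (decide (a ∈ X)) (decide (b ∈ X)),
    fun a b => Bool.xor_comm _ _⟩

/-- The signature obtained from `σ` by switching at the edge-cut `[X, Xᶜ]`: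
the signs of all edges crossing `X` are flipped.  (`true` = negative.) -/
noncomputable def sgnSwitch {V : Type*} (σ : Sym2 V → Bool) (X : Set V) : Sym2 V → Bool :=
  fun e => xor (σ e) (sgnCross X e)

/-- The number of negative edges of the signed graph `(G, σ)`. -/
noncomputable def negNum {V : Type*} (G : SimpleGraph V) (σ : Sym2 V → Bool) : ℕ :=
  {e | e ∈ G.edgeSet ∧ σ e = true}.ncard

/-- The frustration index of `(G, σ)`: the minimum number of negative edges over
all switching-equivalent signatures. -/
noncomputable def frust {V : Type*} (G : SimpleGraph V) (σ : Sym2 V → Bool) : ℕ :=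
  ⨅ X : Set V, negNum G (sgnSwitch σ X)

/-- The number of edges of `G` in the edge-cut `[X, Xᶜ]`. -/
noncomputable def cutSize {V : Type*} (G : SimpleGraph V) (X : Set V) : ℕ :=
  {e | e ∈ G.edgeSet ∧ sgnCross X e = true}.ncard

/-- A graph is 2-edge-connected if every edge-cut has at least 2 edges. -/
def TwoEdgeConn {V : Type*} (G : SimpleGraph V) : Prop :=
  ∀ X : Set V, X.Nonempty → Xᶜ.Nonempty → 2 ≤ cutSize G X

/-- Switching-isomorphism of signed graphs: a graph isomorphism carrying the first
signature, up to a switching, to the second. -/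
def SIso {V W : Type*} (G : SimpleGraph V) (σ : Sym2 V → Bool)
    (H : SimpleGraph W) (τ : Sym2 W → Bool) : Prop :=
  ∃ (φ : G ≃g H) (X : Set V), ∀ e ∈ G.edgeSet,
    sgnSwitch σ X e = τ (Sym2.map (fun v => φ v) e)

/-- `K₄`. -/
def gamma1G : SimpleGraph (Fin 4) := ⊤

/-- The negative perfect matching of `K₄`. -/
noncomputable def gamma1S : Sym2 (Fin 4) → Bool :=
  fun e => decide (e = s(0, 1) ∨ e = s(2, 3))

/-- `Γ₂`: `K₄` with the edge `{1,2}` subdivided by the vertex `4`. -/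
def gamma2G : SimpleGraph (Fin 5) :=
  SimpleGraph.fromEdgeSet {s(0,1), s(0,2), s(0,3), s(1,3), s(2,3), s(1,4), s(2,4)}

noncomputable def gamma2S : Sym2 (Fin 5) → Bool :=
  fun e => decide (e = s(0, 3) ∨ e = s(1, 4))

/-- `Γ₃`. -/
def gamma3G : SimpleGraph (Fin 8) :=
  SimpleGraph.fromEdgeSet {s(1,2), s(2,3), s(3,4), s(4,5), s(1,6), s(5,6),
    s(0,2), s(0,6), s(0,1), s(7,3), s(7,5), s(7,4)}

noncomputable def gamma3S : Sym2 (Fin 8) → Bool :=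
  fun e => decide (e = s(5, 6) ∨ e = s(0, 1) ∨ e = s(7, 4))

/-- `Γ₄`. -/
def gamma4G : SimpleGraph (Fin 8) :=
  SimpleGraph.fromEdgeSet {s(1,2), s(2,3), s(4,5), s(5,1), s(3,6), s(4,6),
    s(1,0), s(0,7), s(7,6), s(0,2), s(3,4), s(5,7)}

noncomputable def gamma4S : Sym2 (Fin 8) → Bool :=
  fun e => decide (e = s(0, 2) ∨ e = s(3, 4) ∨ e = s(5, 7))

/-- `Γ₅`: the cube. -/
def gamma5G : SimpleGraph (Fin 8) :=
  SimpleGraph.fromEdgeSet {s(0,1), s(1,2), s(2,3), s(3,0), s(4,5), s(5,6),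
    s(6,7), s(7,4), s(0,4), s(1,5), s(2,6), s(3,7)}

noncomputable def gamma5S : Sym2 (Fin 8) → Bool :=
  fun e => decide (e = s(3, 0) ∨ e = s(6, 7) ∨ e = s(1, 5))

namespace SubcubicFrust
open Finset

variable {V : Type*}

/-- The sum of `f` over the ordered pairs in `A × B`. -/
def pairSum (f : V → V → ℕ) (A B : Finset V) : ℕ := ∑ a ∈ A, ∑ b ∈ B, f a b

theorem pairSum_union_right (f : V → V → ℕ) (A : Finset V) {B C : Finset V}
    (h : Disjoint B C) : pairSum f A (B ∪ C) = pairSum f A B + pairSum f A C := by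
  simp only [pairSum, sum_union h, sum_add_distrib]

theorem pairSum_union_left (f : V → V → ℕ) {A B : Finset V} (C : Finset V)
    (h : Disjoint A B) : pairSum f (A ∪ B) C = pairSum f A C + pairSum f B C := by
  simp only [pairSum, sum_union h]

theorem pairSum_comm {f : V → V → ℕ} (hf : ∀ u v, f u v = f v u) (A B : Finset V) :
    pairSum f A B = pairSum f B A := by
  unfold pairSum
  rw [sum_comm]
  exact sum_congr rfl fun _ _ => sum_congr rfl fun _ _ => hf _ _

theorem pairSum_split (f : V → V → ℕ) {A W : Finset V} (B : Finset V) (h : A ⊆ W) :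
    pairSum f B W = pairSum f B A + pairSum f B (W \ A) := by
  rw [← pairSum_union_right f B disjoint_sdiff, union_sdiff_of_subset h]

theorem pairSum_split_left (f : V → V → ℕ) {A W : Finset V} (B : Finset V) (h : A ⊆ W) :
    pairSum f W B = pairSum f A B + pairSum f (W \ A) B := by
  rw [← pairSum_union_left f B disjoint_sdiff, union_sdiff_of_subset h]

theorem pairSum_self_split {f : V → V → ℕ} (hf : ∀ u v, f u v = f v u) {A W : Finset V}
    (h : A ⊆ W) :
    pairSum f W W = pairSum f A A + pairSum f (W \ A) (W \ A) + 2 * pairSum f A (W \ A) := by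
  rw [pairSum_split_left f W h, pairSum_split f A h, pairSum_split f (W \ A) h,
    pairSum_comm hf (W \ A) A]
  ring

theorem pairSum_insert {f : V → V → ℕ} (hf : ∀ u v, f u v = f v u) (h0 : ∀ u, f u u = 0)
    {v : V} {H : Finset V} (hv : v ∉ H) :
    pairSum f (insert v H) (insert v H) = pairSum f H H + 2 * ∑ h ∈ H, f v h := by
  unfold pairSum
  simp only [sum_insert hv, sum_add_distrib, h0, hf _ v]
  ring

theorem pairSum_congr {f g : V → V → ℕ} {A B : Finset V}
    (h : ∀ a ∈ A, ∀ b ∈ B, f a b = g a b) : pairSum f A B = pairSum g A B :=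
  sum_congr rfl fun a ha => sum_congr rfl fun b hb => h a ha b hb

variable (G : SimpleGraph V) (σ : Sym2 V → Bool)

/-- The adjacency indicator. -/
noncomputable def adjInd (u v : V) : ℕ := if G.Adj u v then 1 else 0

/-- The indicator of a negative edge after switching by `x`. -/
noncomputable def negInd (x : V → Bool) (u v : V) : ℕ :=
  if G.Adj u v then (σ s(u, v) ^^ (x u ^^ x v)).toNat else 0

theorem adjInd_comm (u v : V) : adjInd G u v = adjInd G v u := by
  simp [adjInd, G.adj_comm]

theorem negInd_comm (x : V → Bool) (u v : V) : negInd G σ x u v = negInd G σ x v u := by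
  simp [negInd, G.adj_comm, Sym2.eq_swap, Bool.xor_comm]

theorem adjInd_self (u : V) : adjInd G u u = 0 := by simp [adjInd]

theorem negInd_self (x : V → Bool) (u : V) : negInd G σ x u u = 0 := by simp [negInd]

theorem sum_adjInd (W : Finset V) (v : V) : ∑ u ∈ W, adjInd G v u = #{u ∈ W | G.Adj v u} := by
  simp only [adjInd, card_filter]

/-- At most a quarter of the edges inside `W` (plus one) are negative after some switching. -/
def Good (W : Finset V) : Prop :=
  ∃ x : V → Bool, 4 * pairSum (negInd G σ x) W W ≤ pairSum (adjInd G) W W + 2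

/-- Every cut of the subgraph induced on `W` has at least `k` edges. -/
def EdgeConn (k : ℕ) (W : Finset V) : Prop :=
  ∀ A ⊆ W, A.Nonempty → (W \ A).Nonempty → k ≤ pairSum (adjInd G) A (W \ A)

variable {G σ}

theorem pairSum_adjInd_eq_zero {A B : Finset V} :
    pairSum (adjInd G) A B = 0 ↔ ∀ a ∈ A, ∀ b ∈ B, ¬ G.Adj a b := by
  simp [pairSum, adjInd]

theorem good_empty : Good G σ ∅ := ⟨fun _ => false, by simp [pairSum]⟩

theorem good_singleton (v : V) : Good G σ {v} :=
  ⟨fun _ => false, by simp [pairSum, negInd_self]⟩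

theorem edgeConn_one_of_cut_lt {k : ℕ} {W H : Finset V} (hW : EdgeConn G k W) (hH : H ⊆ W)
    (hcut : pairSum (adjInd G) H (W \ H) < 2 * k) : EdgeConn G 1 H := by
  intro A hA hne hne'
  by_contra hlt
  have h0 : pairSum (adjInd G) A (H \ A) = 0 := by omega
  have h0' : pairSum (adjInd G) (H \ A) A = 0 := by rwa [pairSum_comm (adjInd_comm G)]
  have cut_eq : ∀ B ⊆ H, pairSum (adjInd G) B (W \ B) =
      pairSum (adjInd G) B (H \ B) + pairSum (adjInd G) B (W \ H) := by
    intro B hB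
    rw [← pairSum_union_right]
    · congr 1
      ext z
      have := @hB z
      have := @hH z
      simp only [mem_sdiff, mem_union]
      tauto
    · exact disjoint_left.2 fun z h1 h2 => (mem_sdiff.1 h2).2 (mem_sdiff.1 h1).1
  have e1 := hW A (hA.trans hH) hne (hne'.mono (sdiff_subset_sdiff hH le_rfl))
  have e2 := hW (H \ A) (sdiff_subset.trans hH) hne' (hne.mono fun z hz =>
    mem_sdiff.2 ⟨hH (hA hz), fun h => (mem_sdiff.1 h).2 hz⟩)
  rw [cut_eq _ hA] at e1
  rw [cut_eq _ sdiff_subset, Finset.sdiff_sdiff_eq_self hA] at e2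
  have e3 := pairSum_split_left (adjInd G) (W \ H) hA
  omega

theorem negInd_add_negInd_flip {x y : V → Bool} {a b : V} (ha : y a = x a) (hb : y b = !x b) :
    negInd G σ x a b + negInd G σ y a b = adjInd G a b := by
  unfold negInd adjInd
  split_ifs
  · rw [ha, hb]; cases σ s(a, b) <;> cases x a <;> cases x b <;> rfl
  · rfl

theorem Good.of_bridge {W A : Finset V} (hA : A ⊆ W) (gA : Good G σ A) (gB : Good G σ (W \ A))
    (hcut : pairSum (adjInd G) A (W \ A) = 1) : Good G σ W := by
  obtain ⟨xA, hxA⟩ := gA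
  obtain ⟨xB, hxB⟩ := gB
  set x : V → Bool := fun z => if z ∈ A then xA z else xB z with hx
  set y : V → Bool := fun z => if z ∈ A then xA z else !xB z with hy
  have key : pairSum (negInd G σ x) A (W \ A) + pairSum (negInd G σ y) A (W \ A) = 1 := by
    rw [← hcut]
    simp only [pairSum, ← sum_add_distrib]
    refine sum_congr rfl fun a ha => sum_congr rfl fun b hb => negInd_add_negInd_flip ?_ ?_
    · simp [hx, hy, ha]
    · simp [hx, hy, (mem_sdiff.1 hb).2]
  have hM := pairSum_self_split (adjInd_comm G) hA
  have xA' : pairSum (negInd G σ x) A A = pairSum (negInd G σ xA) A A :=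
    pairSum_congr fun a ha b hb => by simp [negInd, hx, ha, hb]
  have yA' : pairSum (negInd G σ y) A A = pairSum (negInd G σ xA) A A :=
    pairSum_congr fun a ha b hb => by simp [negInd, hy, ha, hb]
  have xB' : pairSum (negInd G σ x) (W \ A) (W \ A) = pairSum (negInd G σ xB) (W \ A) (W \ A) :=
    pairSum_congr fun a ha b hb => by
      simp [negInd, hx, (mem_sdiff.1 ha).2, (mem_sdiff.1 hb).2]
  have yB' : pairSum (negInd G σ y) (W \ A) (W \ A) = pairSum (negInd G σ xB) (W \ A) (W \ A) :=
    pairSum_congr fun a ha b hb => by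
      simp [negInd, hy, (mem_sdiff.1 ha).2, (mem_sdiff.1 hb).2]
  rcases Nat.eq_zero_or_pos (pairSum (negInd G σ x) A (W \ A)) with h0 | h0
  · refine ⟨x, ?_⟩
    rw [pairSum_self_split (negInd_comm G σ x) hA]
    omega
  · refine ⟨y, ?_⟩
    rw [pairSum_self_split (negInd_comm G σ y) hA]
    omega

/-- Adding to `H` a vertex whose neighbours in `H` are the elements of `L`. -/
theorem pairSum_negInd_insert_le (x : V → Bool) {v : V} {H L : Finset V} (hv : v ∉ H)
    (hL : ∀ h ∈ H, G.Adj v h → h ∈ L) :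
    pairSum (negInd G σ x) (insert v H) (insert v H) ≤ pairSum (negInd G σ x) H H +
      2 * ∑ h ∈ L, (σ s(v, h) ^^ (x v ^^ x h)).toNat := by
  rw [pairSum_insert (negInd_comm G σ x) (negInd_self G σ x) hv]
  have : ∑ h ∈ H, negInd G σ x v h ≤ ∑ h ∈ L, (σ s(v, h) ^^ (x v ^^ x h)).toNat := by
    have : ∑ h ∈ H, negInd G σ x v h
        = ∑ h ∈ H with G.Adj v h, (σ s(v, h) ^^ (x v ^^ x h)).toNat := by
      simp [negInd, sum_filter]
    rw [this]
    exact sum_le_sum_of_subset fun h hh => hL h (mem_filter.1 hh).1 (mem_filter.1 hh).2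
  omega

theorem pairSum_adjInd_insert_ge {v : V} {H L : Finset V} (hv : v ∉ H)
    (hL : L ⊆ H) (hadj : ∀ h ∈ L, G.Adj v h) :
    pairSum (adjInd G) H H + 2 * #L ≤ pairSum (adjInd G) (insert v H) (insert v H) := by
  rw [pairSum_insert (adjInd_comm G) (adjInd_self G) hv, sum_adjInd]
  have : #L ≤ #{u ∈ H | G.Adj v u} :=
    card_le_card fun h hh => mem_filter.2 ⟨hL hh, hadj h hh⟩
  omega

/-! ### Switchings minimising the number of negative edges -/

theorem cut_le_of_min {x : V → Bool} {W X : Finset V} (hX : X ⊆ W)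
    (hmin : ∀ y, pairSum (negInd G σ x) W W ≤ pairSum (negInd G σ y) W W) :
    2 * pairSum (negInd G σ x) X (W \ X) ≤ pairSum (adjInd G) X (W \ X) := by
  set y : V → Bool := fun z => if z ∈ X then !x z else x z with hy
  have h1 : pairSum (negInd G σ y) X X = pairSum (negInd G σ x) X X :=
    pairSum_congr fun a ha b hb => by simp [negInd, hy, ha, hb]
  have h2 : pairSum (negInd G σ y) (W \ X) (W \ X) = pairSum (negInd G σ x) (W \ X) (W \ X) :=
    pairSum_congr fun a ha b hb => by
      simp [negInd, hy, (mem_sdiff.1 ha).2, (mem_sdiff.1 hb).2]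
  have h3 : pairSum (negInd G σ x) X (W \ X) + pairSum (negInd G σ y) X (W \ X) =
      pairSum (adjInd G) X (W \ X) := by
    simp only [pairSum, ← sum_add_distrib]
    refine sum_congr rfl fun a ha => sum_congr rfl fun b hb => ?_
    rw [negInd_comm, negInd_comm _ _ y, adjInd_comm]
    refine negInd_add_negInd_flip ?_ ?_
    · simp [hy, (mem_sdiff.1 hb).2]
    · simp [hy, ha]
  have := hmin y
  rw [pairSum_self_split (negInd_comm G σ x) hX, pairSum_self_split (negInd_comm G σ y) hX] at this
  omega

variable (G σ) in
/-- `a`, `b`, `c` span a triangle with an odd number of negative edges. -/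
def NegTriangle (a b c : V) : Prop :=
  G.Adj a b ∧ G.Adj b c ∧ G.Adj a c ∧ (σ s(a, b) ^^ (σ s(b, c) ^^ σ s(a, c))) = true

theorem negInd_le_adjInd (x : V → Bool) (u v : V) : negInd G σ x u v ≤ adjInd G u v := by
  unfold negInd adjInd
  split_ifs
  · exact Bool.toNat_le _
  · rfl

theorem adjInd_le_one (u v : V) : adjInd G u v ≤ 1 := by
  unfold adjInd; split_ifs <;> simp

theorem negTriangle_of_path {x : V → Bool} {W : Finset V} {a b c : V}
    (hmin : ∀ y, pairSum (negInd G σ x) W W ≤ pairSum (negInd G σ y) W W)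
    (hdeg : ∀ v ∈ W, ∑ u ∈ W, adjInd G v u = 3)
    (ha : a ∈ W) (hb : b ∈ W) (hc : c ∈ W) (hac : a ≠ c)
    (hab : G.Adj a b) (hbc : G.Adj b c)
    (nab : negInd G σ x a b = 0) (nbc : negInd G σ x b c = 0)
    (na : ∑ u ∈ W, negInd G σ x a u = 1) (nb : ∑ u ∈ W, negInd G σ x b u = 1)
    (nc : ∑ u ∈ W, negInd G σ x c u = 1) : NegTriangle G σ a b c := by
  have hX : ({a, b, c} : Finset V) ⊆ W := by
    intro z hz
    simp only [mem_insert, mem_singleton] at hz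
    rcases hz with rfl | rfl | rfl <;> assumption
  have hab' := hab.ne
  have hbc' := hbc.ne
  have sum3 : ∀ f : V → ℕ, ∑ z ∈ ({a, b, c} : Finset V), f z = f a + f b + f c := by
    intro f
    rw [sum_insert (by simp [hab', hac]), sum_insert (by simp [hbc']), sum_singleton]
    ring
  have key := cut_le_of_min hX hmin
  have e1 := pairSum_split (negInd G σ x) {a, b, c} hX
  have e2 := pairSum_split (adjInd G) {a, b, c} hX
  have e3 : pairSum (negInd G σ x) {a, b, c} W = 3 := by
    unfold pairSum; rw [sum3, na, nb, nc]
  have e4 : pairSum (adjInd G) {a, b, c} W = 9 := by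
    unfold pairSum; rw [sum3, hdeg a ha, hdeg b hb, hdeg c hc]
  have e5 : pairSum (negInd G σ x) {a, b, c} {a, b, c} = 2 * negInd G σ x a c := by
    unfold pairSum
    rw [sum3, sum3, sum3, sum3]
    simp only [negInd_self, negInd_comm G σ x b a, negInd_comm G σ x c b,
      negInd_comm G σ x c a, nab, nbc]
    ring
  have e6 : pairSum (adjInd G) {a, b, c} {a, b, c} = 4 + 2 * adjInd G a c := by
    have h1 : adjInd G a b = 1 := by simp [adjInd, hab]
    have h2 : adjInd G b c = 1 := by simp [adjInd, hbc]
    unfold pairSum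
    rw [sum3, sum3, sum3, sum3]
    simp only [adjInd_self, adjInd_comm G b a, adjInd_comm G c b, adjInd_comm G c a, h1, h2]
    ring
  have h1 := adjInd_le_one (G := G) a c
  have h2 := negInd_le_adjInd (G := G) (σ := σ) x a c
  have h3 : negInd G σ x a c = 1 := by omega
  have h4 : G.Adj a c := by
    by_contra h
    simp [negInd, h] at h3
  refine ⟨hab, hbc, h4, ?_⟩
  simp only [negInd, hab, hbc, h4, if_true] at nab nbc h3
  revert nab nbc h3
  generalize σ s(a, b) = p, σ s(b, c) = q, σ s(a, c) = r, x a = i, x b = j, x c = k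
  revert p q r i j k
  decide

theorem good_of_cubic {W : Finset V} (hdeg : ∀ v ∈ W, #{u ∈ W | G.Adj v u} = 3)
    (htri : ∀ a ∈ W, ∀ b ∈ W, ∀ c ∈ W, ¬ NegTriangle G σ a b c) : Good G σ W := by
  obtain ⟨x, hmin⟩ : ∃ x : V → Bool,
      ∀ y, pairSum (negInd G σ x) W W ≤ pairSum (negInd G σ y) W W :=
    ⟨Function.argmin fun x => pairSum (negInd G σ x) W W,
      fun y => Function.argmin_le (fun x => pairSum (negInd G σ x) W W) y⟩
  have hdeg' : ∀ v ∈ W, ∑ u ∈ W, adjInd G v u = 3 := fun v hv => by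
    rw [sum_adjInd, hdeg v hv]
  have nd_le : ∀ v ∈ W, ∑ u ∈ W, negInd G σ x v u ≤ 1 := by
    intro v hv
    have hX : {v} ⊆ W := by simpa using hv
    have key := cut_le_of_min hX hmin
    have e1 := pairSum_split (negInd G σ x) {v} hX
    have e2 := pairSum_split (adjInd G) {v} hX
    have := hdeg' v hv
    simp only [pairSum, sum_singleton, negInd_self, adjInd_self] at *
    omega
  set S := {v ∈ W | ∑ u ∈ W, negInd G σ x v u = 1} with hS
  set N := {v ∈ W | ¬ ∑ u ∈ W, negInd G σ x v u = 1} with hN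
  have hcard : #S + #N = #W := card_filter_add_card_filter_not _
  have hsum : pairSum (negInd G σ x) W W = #S := by
    rw [hS, card_filter]
    refine sum_congr rfl fun v hv => ?_
    have := nd_le v hv
    split_ifs <;> omega
  have hM : pairSum (adjInd G) W W = 3 * #W := by
    rw [pairSum, sum_congr rfl hdeg', sum_const, smul_eq_mul, mul_comm]
  have hle : #S ≤ pairSum (adjInd G) S N := by
    rw [card_eq_sum_ones]
    refine sum_le_sum fun s hs => ?_
    obtain ⟨hsW, hs1⟩ := mem_filter.1 hs
    by_contra! hlt
    have hnone : ∀ u ∈ W, G.Adj s u → ∑ z ∈ W, negInd G σ x u z = 1 := by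
      intro u hu hsu
      by_contra hne
      have h1 : adjInd G s u ≤ ∑ b ∈ N, adjInd G s b :=
        single_le_sum (f := fun b => adjInd G s b) (fun _ _ => Nat.zero_le _)
          (mem_filter.2 ⟨hu, hne⟩)
      simp only [adjInd, hsu, if_true] at h1
      unfold adjInd at hlt
      omega
    obtain ⟨p, q, r, hpq, hpr, hqr, hL⟩ := card_eq_three.1 (hdeg s hsW)
    have hmem : ∀ z, z ∈ ({p, q, r} : Finset V) → z ∈ W ∧ G.Adj s z := fun z hz => by
      rw [← hL] at hz; exact mem_filter.1 hz
    have hp := hmem p (by simp)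
    have hq := hmem q (by simp)
    have hr := hmem r (by simp)
    have hsum3 : negInd G σ x s p + negInd G σ x s q + negInd G σ x s r = 1 := by
      rw [← hs1]
      have : ∑ u ∈ W, negInd G σ x s u = ∑ u ∈ W with G.Adj s u, negInd G σ x s u := by
        rw [sum_filter]
        exact sum_congr rfl fun u _ => by unfold negInd; split_ifs <;> rfl
      rw [this, hL, sum_insert (by simp [hpq, hpr]), sum_insert (by simp [hqr]), sum_singleton]
      ring
    have claim : ∀ a c, a ∈ W ∧ G.Adj s a → c ∈ W ∧ G.Adj s c → a ≠ c →
        0 < negInd G σ x s a + negInd G σ x s c := by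
      intro a c ha hc hac
      by_contra hlt
      have na : negInd G σ x s a = 0 := by omega
      have nc : negInd G σ x s c = 0 := by omega
      rw [negInd_comm] at na
      exact htri a ha.1 s hsW c hc.1 (negTriangle_of_path hmin hdeg' ha.1 hsW hc.1 hac
        ha.2.symm hc.2 na nc (hnone a ha.1 ha.2) hs1 (hnone c hc.1 hc.2))
    have c1 := claim p q hp hq hpq
    have c2 := claim p r hp hr hpr
    have c3 := claim q r hq hr hqr
    omega
  have hle' : pairSum (adjInd G) N S ≤ 3 * #N := by
    unfold pairSum
    rw [mul_comm, ← smul_eq_mul]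
    refine sum_le_card_nsmul _ _ _ fun v hv => ?_
    rw [← hdeg' v (mem_filter.1 hv).1]
    exact sum_le_sum_of_subset (filter_subset _ _)
  rw [pairSum_comm (adjInd_comm G)] at hle'
  refine ⟨x, ?_⟩
  omega

/-! ### Deleting vertices -/

variable (G) in
/-- The neighbours of `v` in `W` are exactly `p` and `q`. -/
def Nbrs2 (W : Finset V) (v p q : V) : Prop :=
  p ∈ W ∧ q ∈ W ∧ p ≠ q ∧ ∀ z ∈ W, G.Adj v z ↔ z = p ∨ z = q

variable (G) in
/-- The neighbours of `v` in `W` are exactly `p`, `q` and `r`. -/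
def Nbrs3 (W : Finset V) (v p q r : V) : Prop :=
  p ∈ W ∧ q ∈ W ∧ r ∈ W ∧ p ≠ q ∧ p ≠ r ∧ q ≠ r ∧ ∀ z ∈ W, G.Adj v z ↔ z = p ∨ z = q ∨ z = r

theorem exists_nbrs2 {W : Finset V} {v p : V} (h : #{u ∈ W | G.Adj v u} = 2) (hp : p ∈ W)
    (hvp : G.Adj v p) : ∃ q, Nbrs2 G W v p q := by
  obtain ⟨a, b, hab, hL⟩ := card_eq_two.1 h
  have hm : ∀ z, (z ∈ W ∧ G.Adj v z) ↔ z = a ∨ z = b := fun z => by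
    rw [← mem_filter, hL]; simp
  unfold Nbrs2
  rcases (hm p).1 ⟨hp, hvp⟩ with rfl | rfl
  · exact ⟨b, by grind⟩
  · exact ⟨a, by grind⟩

theorem exists_nbrs3_of_two {W : Finset V} {v p q : V} (h : #{u ∈ W | G.Adj v u} = 3)
    (hp : p ∈ W) (hvp : G.Adj v p) (hq : q ∈ W) (hvq : G.Adj v q) (hpq : p ≠ q) :
    ∃ r, Nbrs3 G W v p q r := by
  obtain ⟨a, b, c, hab, hac, hbc, hL⟩ := card_eq_three.1 h
  have hm : ∀ z, (z ∈ W ∧ G.Adj v z) ↔ z = a ∨ z = b ∨ z = c := fun z => by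
    rw [← mem_filter, hL]; simp
  unfold Nbrs3
  rcases (hm p).1 ⟨hp, hvp⟩ with rfl | rfl | rfl <;>
    rcases (hm q).1 ⟨hq, hvq⟩ with rfl | rfl | rfl
  · exact absurd rfl hpq
  · exact ⟨c, by grind⟩
  · exact ⟨b, by grind⟩
  · exact ⟨c, by grind⟩
  · exact absurd rfl hpq
  · exact ⟨a, by grind⟩
  · exact ⟨b, by grind⟩
  · exact ⟨a, by grind⟩
  · exact absurd rfl hpq

theorem exists_nbrs3 {W : Finset V} {v p : V} (h : #{u ∈ W | G.Adj v u} = 3)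
    (hp : p ∈ W) (hvp : G.Adj v p) : ∃ q r, Nbrs3 G W v p q r := by
  obtain ⟨q, hq, hqp⟩ : ∃ q ∈ ({u ∈ W | G.Adj v u} : Finset V), q ≠ p :=
    exists_mem_ne (by omega) p
  obtain ⟨hqW, hvq⟩ := mem_filter.1 hq
  obtain ⟨r, hr⟩ := exists_nbrs3_of_two h hp hvp hqW hvq hqp.symm
  exact ⟨q, r, hr⟩

theorem xor_left_comm_swap (s a t : Bool) : (s ^^ (a ^^ t)) = (a ^^ (s ^^ t)) := by
  revert s a t; decide

theorem pairSum_negInd_congr {x y : V → Bool} {H : Finset V} (h : ∀ z ∈ H, y z = x z) :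
    pairSum (negInd G σ y) H H = pairSum (negInd G σ x) H H :=
  pairSum_congr fun a ha b hb => by simp [negInd, h a ha, h b hb]

theorem Good.of_deg_two_three {W : Finset V} {u v w f g : V} (hu : u ∈ W) (hv : v ∈ W)
    (nv : Nbrs2 G W v u w) (nu : Nbrs3 G W u v f g) (hH : Good G σ (W \ {u, v})) :
    Good G σ W := by
  obtain ⟨x, hx⟩ := hH
  set H := W \ {u, v} with hHdef
  have huv : u ≠ v := fun h => by
    subst h; exact G.irrefl ((nv.2.2.2 u hu).2 (Or.inl rfl))
  have hW : W = insert u (insert v H) := by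
    ext z; simp only [hHdef, mem_insert, mem_sdiff, mem_singleton]; grind
  have huw : G.Adj v w := by unfold Nbrs2 at nv; grind
  have huf : G.Adj u f := by unfold Nbrs3 at nu; grind
  have hug : G.Adj u g := by unfold Nbrs3 at nu; grind
  have hAuv : G.Adj u v := by unfold Nbrs3 at nu; grind
  have hwH : w ∈ H := by
    have := huw.ne; unfold Nbrs2 at nv
    simp only [hHdef, mem_insert, mem_sdiff, mem_singleton]; grind
  have hfH : f ∈ H := by
    have := huf.ne; unfold Nbrs3 at nu
    simp only [hHdef, mem_insert, mem_sdiff, mem_singleton]; grind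
  have hgH : g ∈ H := by
    have := hug.ne; unfold Nbrs3 at nu
    simp only [hHdef, mem_insert, mem_sdiff, mem_singleton]; grind
  have hvH : v ∉ H := by simp [hHdef]
  have huH' : u ∉ H := by simp [hHdef]
  have huH : u ∉ insert v H := by simp [hHdef, huv]
  obtain ⟨i, j, hij⟩ : ∃ i j : Bool, (j ^^ (σ s(v, w) ^^ x w)).toNat +
      ((σ s(u, v) ^^ (i ^^ j)).toNat + ((i ^^ (σ s(u, f) ^^ x f)).toNat +
        (i ^^ (σ s(u, g) ^^ x g)).toNat)) ≤ 1 := by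
    generalize (σ s(v, w) ^^ x w) = p, σ s(u, v) = q, (σ s(u, f) ^^ x f) = r,
      (σ s(u, g) ^^ x g) = t
    revert p q r t
    decide
  set y : V → Bool := fun z => if z = u then i else if z = v then j else x z with hy
  have hyx : ∀ z ∈ H, y z = x z := fun z hz => by
    have h1 : z ≠ u := fun h => huH' (h ▸ hz)
    have h2 : z ≠ v := fun h => hvH (h ▸ hz)
    simp [hy, h1, h2]
  have yu : y u = i := by simp [hy]
  have yv : y v = j := by simp [hy, huv.symm]
  refine ⟨y, ?_⟩
  have n0 := pairSum_negInd_congr (G := G) (σ := σ) hyx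
  have n1 := pairSum_negInd_insert_le (G := G) (σ := σ) y (L := {w}) hvH (by
    unfold Nbrs2 at nv; simp only [mem_singleton]; grind)
  have n2 := pairSum_negInd_insert_le (G := G) (σ := σ) y (L := {v, f, g}) huH (by
    unfold Nbrs3 at nu; simp only [mem_insert, mem_singleton]; grind)
  have m1 := pairSum_adjInd_insert_ge (G := G) (L := {w}) hvH (by grind) (by grind)
  have m2 := pairSum_adjInd_insert_ge (G := G) (L := {v, f, g}) huH (by grind) (by grind)
  rw [← hW] at n2 m2
  rw [sum_singleton, hyx w hwH, yv, xor_left_comm_swap] at n1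
  have d1 : v ∉ ({f, g} : Finset V) := by unfold Nbrs3 at nu; grind
  have d2 : f ∉ ({g} : Finset V) := by unfold Nbrs3 at nu; grind
  rw [sum_insert d1, sum_insert d2, sum_singleton, hyx f hfH, hyx g hgH, yu, yv,
    xor_left_comm_swap _ i (x f), xor_left_comm_swap _ i (x g)] at n2
  rw [card_insert_of_notMem d1, card_insert_of_notMem d2, card_singleton] at m2
  rw [card_singleton] at m1
  omega

theorem Good.of_deg_two_path {W : Finset V} {u v w p q : V} (hu : u ∈ W) (hv : v ∈ W)
    (hw : w ∈ W) (nv : Nbrs2 G W v u w) (nu : Nbrs2 G W u v p) (nw : Nbrs2 G W w v q)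
    (hpw : p ≠ w) (hH : Good G σ (W \ {u, v, w})) : Good G σ W := by
  obtain ⟨x, hx⟩ := hH
  set H := W \ {u, v, w} with hHdef
  have huv : G.Adj u v := by unfold Nbrs2 at nu; grind
  have hup : G.Adj u p := by unfold Nbrs2 at nu; grind
  have hwv : G.Adj w v := by unfold Nbrs2 at nw; grind
  have hwq : G.Adj w q := by unfold Nbrs2 at nw; grind
  have huv' := huv.ne
  have hup' := hup.ne
  have hwv' := hwv.ne
  have hwq' := hwq.ne
  have huw' : u ≠ w := by unfold Nbrs2 at nv; grind
  have hqu : q ≠ u := by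
    rintro rfl
    have := (nu.2.2.2 w hw).1 hwq.symm
    grind
  have hW : W = insert w (insert v (insert u H)) := by
    ext z; simp only [hHdef, mem_insert, mem_sdiff, mem_singleton]; grind
  have hpH : p ∈ H := by
    unfold Nbrs2 at nu
    simp only [hHdef, mem_insert, mem_sdiff, mem_singleton]; grind
  have hqH : q ∈ H := by
    unfold Nbrs2 at nw
    simp only [hHdef, mem_insert, mem_sdiff, mem_singleton]; grind
  have huH : u ∉ H := by simp [hHdef]
  have hvH' : v ∉ H := by simp [hHdef]
  have hwH' : w ∉ H := by simp [hHdef]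
  have hvH : v ∉ insert u H := by simp [hHdef, huv'.symm]
  have hwH : w ∉ insert v (insert u H) := by simp [hHdef, huw'.symm, hwv']
  obtain ⟨i, j, k, hijk⟩ : ∃ i j k : Bool, (i ^^ (σ s(u, p) ^^ x p)).toNat +
      ((σ s(v, u) ^^ (j ^^ i)).toNat + ((σ s(w, v) ^^ (k ^^ j)).toNat +
        (k ^^ (σ s(w, q) ^^ x q)).toNat)) ≤ 1 := by
    generalize (σ s(u, p) ^^ x p) = a, σ s(v, u) = b, σ s(w, v) = c, (σ s(w, q) ^^ x q) = d
    revert a b c d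
    decide
  set y : V → Bool := fun z => if z = u then i else if z = v then j else
    if z = w then k else x z with hy
  have hyx : ∀ z ∈ H, y z = x z := fun z hz => by
    have h1 : z ≠ u := fun h => huH (h ▸ hz)
    have h2 : z ≠ v := fun h => hvH' (h ▸ hz)
    have h3 : z ≠ w := fun h => hwH' (h ▸ hz)
    simp [hy, h1, h2, h3]
  have yu : y u = i := by simp [hy]
  have yv : y v = j := by simp [hy, huv'.symm]
  have yw : y w = k := by simp [hy, huw'.symm, hwv']
  refine ⟨y, ?_⟩
  have n0 := pairSum_negInd_congr (G := G) (σ := σ) hyx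
  have n1 := pairSum_negInd_insert_le (G := G) (σ := σ) y (L := {p}) huH (by
    unfold Nbrs2 at nu; simp only [mem_singleton]; grind)
  have n2 := pairSum_negInd_insert_le (G := G) (σ := σ) y (L := {u}) hvH (by
    unfold Nbrs2 at nv; simp only [mem_singleton, mem_insert]; grind)
  have n3 := pairSum_negInd_insert_le (G := G) (σ := σ) y (L := {v, q}) hwH (by
    unfold Nbrs2 at nw; simp only [mem_insert, mem_singleton]; grind)
  have m1 := pairSum_adjInd_insert_ge (G := G) (L := {p}) huH (by grind) (by grind)
  have m2 := pairSum_adjInd_insert_ge (G := G) (L := {u}) hvH (by grind)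
    (by simpa using huv.symm)
  have m3 := pairSum_adjInd_insert_ge (G := G) (L := {v, q}) hwH (by grind) (by grind)
  rw [← hW] at n3 m3
  rw [sum_singleton, hyx p hpH, yu, xor_left_comm_swap] at n1
  rw [sum_singleton, yu, yv] at n2
  have d1 : v ∉ ({q} : Finset V) := by unfold Nbrs2 at nw; grind
  rw [sum_insert d1, sum_singleton, hyx q hqH, yv, yw, xor_left_comm_swap _ k (x q)] at n3
  rw [card_insert_of_notMem d1, card_singleton] at m3
  rw [card_singleton] at m1 m2
  omega

theorem good_triangle {u v w : V} (huv : G.Adj u v) (hvw : G.Adj v w) (huw : G.Adj u w) :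
    Good G σ {u, v, w} := by
  have huv' := huv.ne
  have huw' := huw.ne
  have hvw' := hvw.ne
  have hvH : v ∉ ({w} : Finset V) := by simpa using hvw'
  have huH : u ∉ ({v, w} : Finset V) := by simp [huv', huw']
  obtain ⟨i, j, k, hijk⟩ : ∃ i j k : Bool, (σ s(v, w) ^^ (j ^^ k)).toNat +
      ((σ s(u, v) ^^ (i ^^ j)).toNat + (σ s(u, w) ^^ (i ^^ k)).toNat) ≤ 1 := by
    generalize σ s(v, w) = a, σ s(u, v) = b, σ s(u, w) = c
    revert a b c
    decide
  set y : V → Bool := fun z => if z = u then i else if z = v then j else k with hy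
  have yu : y u = i := by simp [hy]
  have yv : y v = j := by simp [hy, huv'.symm]
  have yw : y w = k := by simp [hy, huw'.symm, hvw'.symm]
  refine ⟨y, ?_⟩
  have n0 : pairSum (negInd G σ y) {w} {w} = 0 := by simp [pairSum, negInd_self]
  have n1 := pairSum_negInd_insert_le (G := G) (σ := σ) y (L := {w}) hvH (by grind)
  have n2 := pairSum_negInd_insert_le (G := G) (σ := σ) y (L := {v, w}) huH (by grind)
  have m1 := pairSum_adjInd_insert_ge (G := G) (L := {w}) hvH (by grind) (by grind)
  have m2 := pairSum_adjInd_insert_ge (G := G) (L := {v, w}) huH (by grind) (by grind)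
  rw [sum_singleton, yv, yw] at n1
  rw [sum_insert hvH, sum_singleton, yu, yv, yw] at n2
  rw [card_insert_of_notMem hvH, card_singleton] at m2
  rw [card_singleton] at m1
  omega

theorem exists_switching_negTriangle : ∀ p q r β γ s t e : Bool, (s ^^ (t ^^ e)) = true →
    ∃ i j k l : Bool, (i ^^ p).toNat + (i ^^ q).toNat + ((r ^^ (j ^^ i)).toNat +
      ((s ^^ (k ^^ j)).toNat + (k ^^ β).toNat + ((e ^^ (l ^^ j)).toNat +
        ((t ^^ (l ^^ k)).toNat + (l ^^ γ).toNat)))) ≤ 2 := by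
  decide

theorem Good.of_negTriangle {W : Finset V} {a b c a' b' c' : V} (ha : a ∈ W) (hb : b ∈ W)
    (hc : c ∈ W) (ht : NegTriangle G σ a b c) (hdeg : ∀ v ∈ W, #{u ∈ W | G.Adj v u} = 3)
    (na : Nbrs3 G W a b c a') (nb : Nbrs3 G W b a c b') (nc : Nbrs3 G W c a b c')
    (hab' : a' ≠ b') (hac' : a' ≠ c') (hH : Good G σ (W \ {a, b, c, a'})) : Good G σ W := by
  obtain ⟨x, hx⟩ := hH
  obtain ⟨hab, hbc, hac, hs⟩ := ht
  have ha' : a' ∈ W := na.2.2.1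
  have haa' : G.Adj a a' := by unfold Nbrs3 at na; grind
  have hbb' : G.Adj b b' := by unfold Nbrs3 at nb; grind
  have hcc' : G.Adj c c' := by unfold Nbrs3 at nc; grind
  obtain ⟨f, g, na'⟩ := exists_nbrs3 (hdeg a' ha') ha haa'.symm
  have haf : G.Adj a' f := by unfold Nbrs3 at na'; grind
  have hag : G.Adj a' g := by unfold Nbrs3 at na'; grind
  set H := W \ {a, b, c, a'} with hHdef
  have ne1 := hab.ne
  have ne2 := hbc.ne
  have ne3 := hac.ne
  have ne4 := haa'.ne
  have ne5 := hbb'.ne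
  have ne6 := hcc'.ne
  have ne7 := haf.ne
  have ne8 := hag.ne
  have nba' : ¬ G.Adj b a' := by unfold Nbrs3 at na nb; grind
  have nca' : ¬ G.Adj c a' := by unfold Nbrs3 at na nc; grind
  have nba'' : ¬ G.Adj a' b := fun h => nba' h.symm
  have nca'' : ¬ G.Adj a' c := fun h => nca' h.symm
  have ne9 : b ≠ a' := by unfold Nbrs3 at na; grind
  have ne10 : c ≠ a' := by unfold Nbrs3 at na; grind
  have hW : W = insert c (insert b (insert a (insert a' H))) := by
    ext z; simp only [hHdef, mem_insert, mem_sdiff, mem_singleton]; grind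
  have hfH : f ∈ H := by
    unfold Nbrs3 at na'
    simp only [hHdef, mem_insert, mem_sdiff, mem_singleton]; grind
  have hgH : g ∈ H := by
    unfold Nbrs3 at na'
    simp only [hHdef, mem_insert, mem_sdiff, mem_singleton]; grind
  have hbH : b' ∈ H := by
    unfold Nbrs3 at nb
    simp only [hHdef, mem_insert, mem_sdiff, mem_singleton]; grind
  have hcH : c' ∈ H := by
    unfold Nbrs3 at nc
    simp only [hHdef, mem_insert, mem_sdiff, mem_singleton]; grind
  have hi0 : a' ∉ H := by simp [hHdef]
  have hj0 : a ∉ H := by simp [hHdef]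
  have hk0 : b ∉ H := by simp [hHdef]
  have hl0 : c ∉ H := by simp [hHdef]
  have hj : a ∉ insert a' H := by simp [hHdef, ne4]
  have hk : b ∉ insert a (insert a' H) := by simp [hHdef, ne1.symm, ne9]
  have hl : c ∉ insert b (insert a (insert a' H)) := by
    simp [hHdef, ne2.symm, ne3.symm, ne10]
  obtain ⟨i, j, k, l, hijkl⟩ := exists_switching_negTriangle (σ s(a', f) ^^ x f)
    (σ s(a', g) ^^ x g) (σ s(a, a')) (σ s(b, b') ^^ x b') (σ s(c, c') ^^ x c')
    (σ s(a, b)) (σ s(b, c)) (σ s(a, c)) hs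
  set y : V → Bool := fun z => if z = a' then i else if z = a then j else
    if z = b then k else if z = c then l else x z with hy
  have hyx : ∀ z ∈ H, y z = x z := fun z hz => by
    have h1 : z ≠ a' := fun h => hi0 (h ▸ hz)
    have h2 : z ≠ a := fun h => hj0 (h ▸ hz)
    have h3 : z ≠ b := fun h => hk0 (h ▸ hz)
    have h4 : z ≠ c := fun h => hl0 (h ▸ hz)
    simp [hy, h1, h2, h3, h4]
  have yi : y a' = i := by simp [hy]
  have yj : y a = j := by simp [hy, ne4]
  have yk : y b = k := by simp [hy, ne9, ne1.symm]
  have yl : y c = l := by simp [hy, ne10, ne3.symm, ne2.symm]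
  refine ⟨y, ?_⟩
  have n0 := pairSum_negInd_congr (G := G) (σ := σ) hyx
  have n1 := pairSum_negInd_insert_le (G := G) (σ := σ) y (L := {f, g}) hi0 (by
    unfold Nbrs3 at na'; simp only [mem_insert, mem_singleton]; grind)
  have n2 := pairSum_negInd_insert_le (G := G) (σ := σ) y (L := {a'}) hj (by
    unfold Nbrs3 at na; simp only [mem_singleton, mem_insert]; grind)
  have n3 := pairSum_negInd_insert_le (G := G) (σ := σ) y (L := {a, b'}) hk (by
    unfold Nbrs3 at nb; simp only [mem_insert, mem_singleton]; grind)
  have n4 := pairSum_negInd_insert_le (G := G) (σ := σ) y (L := {a, b, c'}) hl (by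
    unfold Nbrs3 at nc; simp only [mem_insert, mem_singleton]; grind)
  have m1 := pairSum_adjInd_insert_ge (G := G) (L := {f, g}) hi0
    (by simp [insert_subset_iff, hfH, hgH]) (by simpa using ⟨haf, hag⟩)
  have m2 := pairSum_adjInd_insert_ge (G := G) (L := {a'}) hj (by simp) (by simpa using haa')
  have m3 := pairSum_adjInd_insert_ge (G := G) (L := {a, b'}) hk
    (by simp [insert_subset_iff, hbH])
    (by simpa using ⟨hab.symm, hbb'⟩)
  have m4 := pairSum_adjInd_insert_ge (G := G) (L := {a, b, c'}) hl
    (by simp [insert_subset_iff, hcH])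
    (by simpa using ⟨hac.symm, hbc.symm, hcc'⟩)
  rw [← hW] at n4 m4
  have d1 : f ∉ ({g} : Finset V) := by unfold Nbrs3 at na'; grind
  have d3 : a ∉ ({b'} : Finset V) := by unfold Nbrs3 at nb; grind
  have d4 : a ∉ ({b, c'} : Finset V) := by unfold Nbrs3 at nc; grind
  have d5 : b ∉ ({c'} : Finset V) := by unfold Nbrs3 at nc; grind
  rw [sum_insert d1, sum_singleton, hyx f hfH, hyx g hgH, yi, xor_left_comm_swap,
    xor_left_comm_swap _ i (x g)] at n1
  rw [sum_singleton, yi, yj] at n2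
  rw [sum_insert d3, sum_singleton, hyx b' hbH, yj, yk, xor_left_comm_swap _ k (x b'),
    Sym2.eq_swap (a := b) (b := a)] at n3
  rw [sum_insert d4, sum_insert d5, sum_singleton, hyx c' hcH, yj, yk, yl,
    xor_left_comm_swap _ l (x c'), Sym2.eq_swap (a := c) (b := a),
    Sym2.eq_swap (a := c) (b := b)] at n4
  rw [card_insert_of_notMem d1, card_singleton] at m1
  rw [card_singleton] at m2
  rw [card_insert_of_notMem d3, card_singleton] at m3
  rw [card_insert_of_notMem d4, card_insert_of_notMem d5, card_singleton] at m4
  omega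

/-! ### Connectivity after deleting vertices -/

theorem pairSum_adjInd_le_one {A B : Finset V} {p q : V}
    (h : ∀ u ∈ A, ∀ z ∈ B, G.Adj u z → u = p ∧ z = q) : pairSum (adjInd G) A B ≤ 1 := by
  have : pairSum (adjInd G) A B = #{e ∈ A ×ˢ B | G.Adj e.1 e.2} := by
    rw [pairSum, ← sum_product', card_filter]
    rfl
  rw [this, card_le_one]
  simp only [mem_filter, mem_product]
  rintro ⟨u, z⟩ ⟨⟨hu, hz⟩, huz⟩ ⟨u', z'⟩ ⟨⟨hu', hz'⟩, huz'⟩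
  obtain ⟨rfl, rfl⟩ := h u hu z hz huz
  obtain ⟨rfl, rfl⟩ := h u' hu' z' hz' huz'
  rfl

theorem EdgeConn.not_bridge {W A : Finset V} (hW : EdgeConn G 2 W) (hA : A ⊆ W) {p q : V}
    (hp : p ∈ A) (hq : q ∈ W) (hqA : q ∉ A)
    (h : ∀ u ∈ A, ∀ z ∈ W, z ∉ A → G.Adj u z → u = p ∧ z = q) : False := by
  have h1 := hW A hA ⟨p, hp⟩ ⟨q, mem_sdiff.2 ⟨hq, hqA⟩⟩
  have h2 := pairSum_adjInd_le_one (G := G) (A := A) (B := W \ A) fun u hu z hz =>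
    h u hu z (mem_sdiff.1 hz).1 (mem_sdiff.1 hz).2
  omega

/-- If all edges leaving `A` go to `a'`, which has one neighbour `a` besides two further ones,
then there is a bridge. -/
theorem EdgeConn.false_of_cutvertex {W A : Finset V} (hW : EdgeConn G 2 W) (hA : A ⊆ W)
    (hne : A.Nonempty) {a a' f g : V} (ha : a ∈ W) (ha' : a' ∈ W) (haA : a ∉ A) (haA' : a' ∉ A)
    (na' : Nbrs3 G W a' a f g)
    (h : ∀ u ∈ A, ∀ z ∈ W, z ∉ A → G.Adj u z → z = a') : False := by
  have hadj := fun z hz => (na'.2.2.2.2.2.2 z hz)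
  have haa' : G.Adj a' a := (hadj a ha).2 (Or.inl rfl)
  have cut : 2 ≤ pairSum (adjInd G) A (W \ A) :=
    hW A hA hne ⟨a, mem_sdiff.2 ⟨ha, haA⟩⟩
  have hf : f ∈ A := by
    by_contra hf
    have := pairSum_adjInd_le_one (G := G) (A := A) (B := W \ A) (p := g) (q := a')
      fun u hu z hz huz => by
        have hz' := h u hu z (mem_sdiff.1 hz).1 (mem_sdiff.1 hz).2 huz
        subst hz'
        have := (hadj u (hA hu)).1 huz.symm
        grind
    omega
  have hg : g ∈ A := by
    by_contra hg
    have := pairSum_adjInd_le_one (G := G) (A := A) (B := W \ A) (p := f) (q := a')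
      fun u hu z hz huz => by
        have hz' := h u hu z (mem_sdiff.1 hz).1 (mem_sdiff.1 hz).2 huz
        subst hz'
        have := (hadj u (hA hu)).1 huz.symm
        grind
    omega
  have := haa'.ne
  refine hW.not_bridge (A := insert a' A) (p := a') (q := a) (by grind) (by simp) ha
    (by grind) fun u hu z hz hzA huz => ?_
  rcases mem_insert.1 hu with rfl | hu
  · have := (hadj z hz).1 huz
    grind
  · have := h u hu z hz (by grind) huz
    grind

theorem exists_separation {W : Finset V} (hW : EdgeConn G 2 W) {a b c a' b' c' : V}
    (ha : a ∈ W) (hdeg : ∀ v ∈ W, #{u ∈ W | G.Adj v u} = 3)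
    (na : Nbrs3 G W a b c a') (nb : Nbrs3 G W b a c b') (nc : Nbrs3 G W c a b c')
    (hH : ¬ EdgeConn G 1 (W \ {a, b, c, a'})) :
    ∃ A ⊆ W \ {a, b, c, a'}, b' ∈ A ∧ c' ∉ A ∧
      ∀ u ∈ A, ∀ z ∈ W \ {a, b, c, a'}, z ∉ A → ¬ G.Adj u z := by
  have ha' : a' ∈ W := na.2.2.1
  have haa' : G.Adj a a' := by unfold Nbrs3 at na; grind
  obtain ⟨f, g, na'⟩ := exists_nbrs3 (hdeg a' ha') ha haa'.symm
  set H := W \ {a, b, c, a'} with hHdef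
  have hHW : H ⊆ W := sdiff_subset
  have mem_H : ∀ z, z ∈ H ↔ z ∈ W ∧ z ≠ a ∧ z ≠ b ∧ z ≠ c ∧ z ≠ a' := fun z => by
    simp [hHdef]
  have claim : ∀ A ⊆ H, A.Nonempty → b' ∉ A → c' ∉ A →
      (∀ u ∈ A, ∀ z ∈ H, z ∉ A → ¬ G.Adj u z) → False := by
    intro A hA hne hb' hc' hno
    refine hW.false_of_cutvertex (hA.trans hHW) hne ha ha' (by grind) (by grind) na'
      fun u hu z hz hzA huz => ?_
    by_contra hza'
    have h1 := hno u hu z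
    have huH := (mem_H u).1 (hA hu)
    have h2 := G.adj_comm u z
    unfold Nbrs3 at na nb nc
    have h3 := na.2.2.2.2.2.2 u huH.1
    have h4 := nb.2.2.2.2.2.2 u huH.1
    have h5 := nc.2.2.2.2.2.2 u huH.1
    have h6 := mem_H z
    grind
  unfold EdgeConn at hH
  push Not at hH
  obtain ⟨A, hA, hne, hne', hcut⟩ := hH
  have hno : ∀ u ∈ A, ∀ z ∈ H, z ∉ A → ¬ G.Adj u z := fun u hu z hz hzA =>
    pairSum_adjInd_eq_zero.1 (by omega : pairSum (adjInd G) A (H \ A) = 0) u hu z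
      (mem_sdiff.2 ⟨hz, hzA⟩)
  have hno' : ∀ u ∈ H \ A, ∀ z ∈ H, z ∉ H \ A → ¬ G.Adj u z := fun u hu z hz hzA huz =>
    hno z (by grind) u (by grind) (by grind) huz.symm
  have c1 := claim A hA hne
  have c2 := claim (H \ A) sdiff_subset hne'
  by_cases hb : b' ∈ A
  · by_cases hc : c' ∈ A
    · exact (c2 (by grind) (by grind) hno').elim
    · exact ⟨A, hA, hb, hc, hno⟩
  · by_cases hbH : b' ∈ H
    · refine ⟨H \ A, sdiff_subset, by grind, fun hc => ?_, hno'⟩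
      exact c1 hb (by grind) hno
    · by_cases hc : c' ∈ A
      · exact (c2 (by grind) (by grind) hno').elim
      · exact (c1 hb hc hno).elim

theorem edgeConn_or_edgeConn {W : Finset V} (hW : EdgeConn G 2 W) {a b c a' b' c' : V}
    (ha : a ∈ W) (hb : b ∈ W) (hc : c ∈ W) (hdeg : ∀ v ∈ W, #{u ∈ W | G.Adj v u} = 3)
    (na : Nbrs3 G W a b c a') (nb : Nbrs3 G W b a c b') (nc : Nbrs3 G W c a b c')
    (hac' : a' ≠ c') (hbc' : b' ≠ c') :
    EdgeConn G 1 (W \ {a, b, c, a'}) ∨ EdgeConn G 1 (W \ {b, a, c, b'}) := by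
  have nc' : Nbrs3 G W c b a c' := by unfold Nbrs3 at nc ⊢; grind
  by_contra! hcon
  obtain ⟨A₁, hA₁, hb₁, hc₁, h₁⟩ := exists_separation hW ha hdeg na nb nc hcon.1
  obtain ⟨A₂, hA₂, hb₂, hc₂, h₂⟩ := exists_separation hW hb hdeg nb na nc' hcon.2
  have hc'W : c' ∈ W := nc.2.2.1
  have hcc' : G.Adj c c' := by unfold Nbrs3 at nc; grind
  have hcne := hcc'.ne
  have mem_C : ∀ z, z ∈ (W \ {a, b, c, a', b'}) \ (A₁ ∪ A₂) ↔
      z ∈ W ∧ z ≠ a ∧ z ≠ b ∧ z ≠ c ∧ z ≠ a' ∧ z ≠ b' ∧ z ∉ A₁ ∧ z ∉ A₂ := fun z => by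
    simp only [mem_sdiff, mem_insert, mem_singleton, mem_union]; tauto
  have mem₁ : ∀ z, z ∈ W \ {a, b, c, a'} ↔ z ∈ W ∧ z ≠ a ∧ z ≠ b ∧ z ≠ c ∧ z ≠ a' := fun z => by
    simp
  have mem₂ : ∀ z, z ∈ W \ {b, a, c, b'} ↔ z ∈ W ∧ z ≠ b ∧ z ≠ a ∧ z ≠ c ∧ z ≠ b' := fun z => by
    simp
  refine hW.not_bridge (A := (W \ {a, b, c, a', b'}) \ (A₁ ∪ A₂)) (p := c') (q := c)
    (fun z hz => ((mem_C z).1 hz).1) ?_ hc (fun h => ((mem_C c).1 h).2.2.2.1 rfl) ?_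
  · rw [mem_C]; unfold Nbrs3 at nc; grind
  · intro u hu z hz hzC huz
    rw [mem_C] at hu hzC
    have e1 := h₁ z
    have e2 := h₂ z
    have e3 := na.2.2.2.2.2.2 u hu.1
    have e4 := nb.2.2.2.2.2.2 u hu.1
    have e5 := nc.2.2.2.2.2.2 u hu.1
    have e6 := (mem₁ u).2 ⟨hu.1, hu.2.1, hu.2.2.1, hu.2.2.2.1, hu.2.2.2.2.1⟩
    have e7 := (mem₂ u).2 ⟨hu.1, hu.2.2.1, hu.2.1, hu.2.2.2.1, hu.2.2.2.2.2.1⟩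
    have e8 := huz.symm
    have e9 : z ∉ A₁ := fun h => e1 h u e6 hu.2.2.2.2.2.2.1 e8
    have e10 : z ∉ A₂ := fun h => e2 h u e7 hu.2.2.2.2.2.2.2 e8
    grind

theorem NegTriangle.swap_left {a b c : V} (h : NegTriangle G σ a b c) : NegTriangle G σ b a c := by
  obtain ⟨hab, hbc, hac, hs⟩ := h
  refine ⟨hab.symm, hac, hbc, ?_⟩
  rw [Sym2.eq_swap (a := b), ← hs, Bool.xor_comm (σ s(a, c))]

theorem NegTriangle.swap_right {a b c : V} (h : NegTriangle G σ a b c) :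
    NegTriangle G σ a c b := by
  obtain ⟨hab, hbc, hac, hs⟩ := h
  refine ⟨hac, hbc.symm, hab, ?_⟩
  rw [Sym2.eq_swap (a := c), ← hs, Bool.xor_left_comm, Bool.xor_comm (σ s(a, c)),
    Bool.xor_left_comm]

theorem Nbrs3.swap {W : Finset V} {v p q r : V} (h : Nbrs3 G W v p q r) :
    Nbrs3 G W v q p r := by
  unfold Nbrs3 at h ⊢; grind

theorem Good.of_negTriangle_of_eq {W : Finset V} (hW : EdgeConn G 2 W)
    (hdeg : ∀ v ∈ W, #{u ∈ W | G.Adj v u} = 3)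
    (ih : ∀ H ⊂ W, EdgeConn G 1 H → Good G σ H) {a b c a' b' : V}
    (ha : a ∈ W) (hb : b ∈ W) (hc : c ∈ W) (ht : NegTriangle G σ a b c)
    (na : Nbrs3 G W a b c a') (nb : Nbrs3 G W b a c b') (nc : Nbrs3 G W c a b b')
    (hab' : a' ≠ b') : Good G σ W := by
  refine Good.of_negTriangle ha hb hc ht hdeg na nb nc hab' hab'
    (ih _ (sdiff_ssubset (by simp [insert_subset_iff, ha, hb, hc, na.2.2.1]) (by simp)) ?_)
  by_contra hcon
  obtain ⟨A, -, h1, h2, -⟩ := exists_separation hW ha hdeg na nb nc hcon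
  exact h2 h1

theorem Good.of_negTriangle_of_cubic {W : Finset V} (hW : EdgeConn G 2 W)
    (hdeg : ∀ v ∈ W, #{u ∈ W | G.Adj v u} = 3)
    (hK : ∀ a b c d, G.Adj a b → G.Adj a c → G.Adj a d → G.Adj b c → G.Adj b d → ¬ G.Adj c d)
    (ih : ∀ H ⊂ W, EdgeConn G 1 H → Good G σ H) {a b c : V}
    (ha : a ∈ W) (hb : b ∈ W) (hc : c ∈ W) (ht : NegTriangle G σ a b c) : Good G σ W := by
  have hab := ht.1
  have hbc := ht.2.1
  have hac := ht.2.2.1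
  obtain ⟨a', na⟩ := exists_nbrs3_of_two (hdeg a ha) hb hab hc hac hbc.ne
  obtain ⟨b', nb⟩ := exists_nbrs3_of_two (hdeg b hb) ha hab.symm hc hbc hac.ne
  obtain ⟨c', nc⟩ := exists_nbrs3_of_two (hdeg c hc) ha hac.symm hb hbc.symm hab.ne
  have haa' : G.Adj a a' := (na.2.2.2.2.2.2 a' na.2.2.1).2 (by simp)
  have hbb' : G.Adj b b' := (nb.2.2.2.2.2.2 b' nb.2.2.1).2 (by simp)
  have hcc' : G.Adj c c' := (nc.2.2.2.2.2.2 c' nc.2.2.1).2 (by simp)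
  by_cases hab' : a' = b'
  · subst hab'
    by_cases hac' : a' = c'
    · subst hac'
      exact (hK a b c a' hab hac haa' hbc hbb' hcc').elim
    · exact Good.of_negTriangle_of_eq hW hdeg ih hc ha hb ht.swap_right.swap_left nc na.swap
        nb.swap (Ne.symm hac')
  · by_cases hac' : a' = c'
    · subst hac'
      exact Good.of_negTriangle_of_eq hW hdeg ih hb ha hc ht.swap_left nb na nc.swap
        (Ne.symm hab')
    · by_cases hbc' : b' = c'
      · subst hbc'
        exact Good.of_negTriangle_of_eq hW hdeg ih ha hb hc ht na nb nc hab'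
      · rcases edgeConn_or_edgeConn hW ha hb hc hdeg na nb nc hac' hbc' with h | h
        · exact Good.of_negTriangle ha hb hc ht hdeg na nb nc hab' hac' (ih _ (sdiff_ssubset
            (by simp [insert_subset_iff, ha, hb, hc, na.2.2.1]) (by simp)) h)
        · exact Good.of_negTriangle hb ha hc ht.swap_left hdeg nb na nc.swap (Ne.symm hab') hbc'
            (ih _ (sdiff_ssubset
              (by simp [insert_subset_iff, ha, hb, hc, nb.2.2.1]) (by simp)) h)

theorem cut_sdiff_add {W D : Finset V} (hD : D ⊆ W) :
    pairSum (adjInd G) (W \ D) (W \ (W \ D)) + pairSum (adjInd G) D D =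
      ∑ d ∈ D, #{u ∈ W | G.Adj d u} := by
  rw [Finset.sdiff_sdiff_eq_self hD, pairSum_comm (adjInd_comm G), add_comm,
    ← pairSum_split (adjInd G) D hD]
  simp only [pairSum, sum_adjInd]

theorem good_of_edgeConn_two {W : Finset V} (hW : EdgeConn G 2 W) (hne : 1 < #W)
    (hdeg : ∀ v ∈ W, #{u ∈ W | G.Adj v u} ≤ 3)
    (hK : ∀ a b c d, G.Adj a b → G.Adj a c → G.Adj a d → G.Adj b c → G.Adj b d → ¬ G.Adj c d)
    (ih : ∀ H ⊂ W, EdgeConn G 1 H → Good G σ H) : Good G σ W := by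
  have hdeg2 : ∀ v ∈ W, 2 ≤ #{u ∈ W | G.Adj v u} := fun v hv => by
    have hD : {v} ⊆ W := by simpa using hv
    have h1 := cut_sdiff_add (G := G) hD
    have h2 := hW {v} hD (by simp) (by
      rw [sdiff_nonempty]; intro h; have := card_le_card h; rw [card_singleton] at this; omega)
    rw [Finset.sdiff_sdiff_eq_self hD, pairSum_comm (adjInd_comm G)] at h1
    simp only [sum_singleton] at h1
    omega
  by_cases hall : ∀ v ∈ W, #{u ∈ W | G.Adj v u} = 3
  · by_cases htri : ∀ a ∈ W, ∀ b ∈ W, ∀ c ∈ W, ¬ NegTriangle G σ a b c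
    · exact good_of_cubic hall htri
    · push Not at htri
      obtain ⟨a, ha, b, hb, c, hc, ht⟩ := htri
      exact Good.of_negTriangle_of_cubic hW hall hK ih ha hb hc ht
  push Not at hall
  obtain ⟨v, hv, hv3⟩ := hall
  have hv2 : #{u ∈ W | G.Adj v u} = 2 := by
    have := hdeg v hv; have := hdeg2 v hv; omega
  have hthree : ∀ u w, Nbrs2 G W v u w → #{z ∈ W | G.Adj u z} = 3 → Good G σ W := by
    intro u w nv hu3
    have hu : u ∈ W := nv.1
    have hvu : G.Adj v u := (nv.2.2.2 u hu).2 (by simp)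
    obtain ⟨f, g, nu⟩ := exists_nbrs3 hu3 hv hvu.symm
    have hD : {u, v} ⊆ W := by simp [insert_subset_iff, hu, hv]
    refine Good.of_deg_two_three hu hv nv nu (ih _ (sdiff_ssubset hD (by simp)) ?_)
    refine edgeConn_one_of_cut_lt hW sdiff_subset ?_
    have h1 := cut_sdiff_add (G := G) hD
    have h2 : 2 ≤ pairSum (adjInd G) {u, v} {u, v} := by
      have := pairSum_adjInd_insert_ge (G := G) (v := u) (H := {v}) (L := {v})
        (by simpa using hvu.ne') Subset.rfl (by simpa using hvu.symm)
      rw [card_singleton] at this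
      omega
    rw [sum_pair hvu.ne'] at h1
    omega
  obtain ⟨u, hu⟩ : ({u ∈ W | G.Adj v u} : Finset V).Nonempty := card_pos.1 (by omega)
  obtain ⟨hu, hvu⟩ := mem_filter.1 hu
  obtain ⟨w, nv⟩ := exists_nbrs2 hv2 hu hvu
  have nv' : Nbrs2 G W v w u := by unfold Nbrs2 at nv ⊢; grind
  have hw : w ∈ W := nv.2.1
  have hvw : G.Adj v w := (nv.2.2.2 w hw).2 (by simp)
  by_cases hu3 : #{z ∈ W | G.Adj u z} = 3
  · exact hthree u w nv hu3
  by_cases hw3 : #{z ∈ W | G.Adj w z} = 3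
  · exact hthree w u nv' hw3
  have hu2 : #{z ∈ W | G.Adj u z} = 2 := by
    have := hdeg u hu; have := hdeg2 u hu; omega
  have hw2 : #{z ∈ W | G.Adj w z} = 2 := by
    have := hdeg w hw; have := hdeg2 w hw; omega
  obtain ⟨p, nu⟩ := exists_nbrs2 hu2 hv hvu.symm
  obtain ⟨q, nw⟩ := exists_nbrs2 hw2 hv hvw.symm
  have huw : u ≠ w := nv.2.2.1
  have hD : {u, v, w} ⊆ W := by simp [insert_subset_iff, hu, hv, hw]
  have h1 := cut_sdiff_add (G := G) hD
  have huH : u ∉ ({v, w} : Finset V) := by simp [huw, hvu.ne']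
  have h0 := pairSum_adjInd_insert_ge (G := G) (v := v) (H := {w}) (L := {w})
    (by simpa using hvw.ne) Subset.rfl (by simpa using hvw)
  rw [card_singleton] at h0
  rw [sum_insert huH, sum_pair hvw.ne, hu2, hv2, hw2] at h1
  by_cases hadj : G.Adj u w
  · have h2 : 6 ≤ pairSum (adjInd G) {u, v, w} {u, v, w} := by
      have := pairSum_adjInd_insert_ge (G := G) (L := {v, w}) huH Subset.rfl
        (by simpa using ⟨hvu.symm, hadj⟩)
      rw [card_pair hvw.ne] at this
      omega
    have hWD : W = {u, v, w} := by
      by_contra hcon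
      have h3 := hW {u, v, w} hD (by simp) (sdiff_nonempty.2 fun h => hcon (h.antisymm hD))
      rw [Finset.sdiff_sdiff_eq_self hD, pairSum_comm (adjInd_comm G)] at h1
      omega
    rw [hWD]
    exact good_triangle hvu.symm hvw hadj
  · have hpw : p ≠ w := fun h => hadj (h ▸ (nu.2.2.2 p nu.2.1).2 (by simp))
    refine Good.of_deg_two_path hu hv hw nv nu nw hpw (ih _ (sdiff_ssubset hD (by simp)) ?_)
    refine edgeConn_one_of_cut_lt hW sdiff_subset ?_
    have h2 : 4 ≤ pairSum (adjInd G) {u, v, w} {u, v, w} := by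
      have := pairSum_adjInd_insert_ge (G := G) (L := {v}) huH (by simp)
        (by simpa using hvu.symm)
      rw [card_singleton] at this
      omega
    omega

theorem good_of_edgeConn_one
    (hdeg : ∀ (W : Finset V) (v : V), #{u ∈ W | G.Adj v u} ≤ 3)
    (hK : ∀ a b c d, G.Adj a b → G.Adj a c → G.Adj a d → G.Adj b c → G.Adj b d → ¬ G.Adj c d)
    (W : Finset V) (hW : EdgeConn G 1 W) : Good G σ W := by
  induction W using Finset.strongInduction with
  | H W ih =>
    rcases Nat.lt_or_ge 1 #W with hcard | hcard
    · by_cases h2 : EdgeConn G 2 W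
      · exact good_of_edgeConn_two h2 hcard (fun v _ => hdeg W v) hK ih
      · unfold EdgeConn at h2
        push Not at h2
        obtain ⟨A, hA, hne, hne', hcut⟩ := h2
        have h1 := hW A hA hne hne'
        refine Good.of_bridge hA (ih A ?_ ?_) (ih (W \ A) (sdiff_ssubset hA hne) ?_) (by omega)
        · exact hA.ssubset_of_ne fun h => by simp [h] at hne'
        · exact edgeConn_one_of_cut_lt hW hA (by omega)
        · refine edgeConn_one_of_cut_lt hW sdiff_subset ?_
          rw [Finset.sdiff_sdiff_eq_self hA, pairSum_comm (adjInd_comm G)]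
          omega
    · rcases Nat.le_one_iff_eq_zero_or_eq_one.1 hcard with h | h
      · rw [card_eq_zero.1 h]
        exact good_empty
      · obtain ⟨v, rfl⟩ := card_eq_one.1 h
        exact good_singleton v

theorem edgeConn_univ [Fintype V] (hG : G.Connected) : EdgeConn G 1 univ := by
  rintro A - ⟨a, ha⟩ ⟨b, hb⟩
  by_contra hcon
  have h0 := pairSum_adjInd_eq_zero.1 (by omega : pairSum (adjInd G) A (univ \ A) = 0)
  obtain ⟨w⟩ := hG.preconnected a b
  obtain ⟨d, -, h1, h2⟩ := w.exists_boundary_dart (A : Set V) ha (by simpa using hb)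
  exact h0 d.fst h1 d.snd (by simpa using h2) d.adj

theorem two_mul_negNum [Fintype V] (x : V → Bool) :
    2 * negNum G (sgnSwitch σ {z | x z = true}) = pairSum (negInd G σ x) univ univ := by
  let K : SimpleGraph V :=
    { Adj := fun u v => G.Adj u v ∧ sgnSwitch σ {z | x z = true} s(u, v) = true
      symm := ⟨fun u v h => ⟨h.1.symm, by rw [Sym2.eq_swap]; exact h.2⟩⟩
      loopless := ⟨fun u h => G.irrefl h.1⟩ }
  have hset : {e | e ∈ G.edgeSet ∧ sgnSwitch σ {z | x z = true} e = true} = K.edgeSet := by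
    ext e
    induction e using Sym2.ind with
    | _ u v => rfl
  rw [negNum, hset, ← SimpleGraph.coe_edgeFinset, Set.ncard_coe_finset,
    ← SimpleGraph.sum_degrees_eq_twice_card_edges, pairSum]
  refine sum_congr rfl fun u _ => ?_
  rw [← SimpleGraph.card_neighborFinset_eq_degree, SimpleGraph.neighborFinset_eq_filter,
    card_filter]
  refine sum_congr rfl fun v _ => ?_
  by_cases h : G.Adj u v
  · cases hs : σ s(u, v) <;> cases hu : x u <;> cases hv : x v <;>
      simp [K, negInd, sgnSwitch, sgnCross, h, hs, hu, hv]
  · simp [K, negInd, h]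

theorem frust_le_negNum (x : V → Bool) :
    frust G σ ≤ negNum G (sgnSwitch σ {z | x z = true}) :=
  ciInf_le (OrderBot.bddBelow _) _

theorem card_filter_adj_le (hsub : ∀ v : V, (G.neighborSet v).ncard ≤ 3) [Finite V]
    (W : Finset V) (v : V) : #{u ∈ W | G.Adj v u} ≤ 3 := by
  rw [← Set.ncard_coe_finset]
  exact (Set.ncard_le_ncard (fun u hu => by simpa using (mem_filter.1 hu).2)
    (Set.toFinite _)).trans (hsub v)

theorem Good.frust_le [Fintype V] (hsub : ∀ v : V, (G.neighborSet v).ncard ≤ 3)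
    (h : Good G σ univ) : 8 * frust G σ ≤ 3 * Fintype.card V + 2 := by
  obtain ⟨x, hx⟩ := h
  have h1 := frust_le_negNum (G := G) (σ := σ) x
  have h2 := two_mul_negNum (G := G) (σ := σ) x
  have h3 : pairSum (adjInd G) univ univ ≤ 3 * Fintype.card V := by
    rw [pairSum, mul_comm]
    refine sum_le_card_nsmul _ _ 3 fun v _ => ?_
    rw [sum_adjInd]
    exact card_filter_adj_le hsub _ v
  omega

/-- Every signed `K₄` on vertices `0, 1, 2, 3` with edge signs `p = 01`, `p' = 23`, `q = 02`,
`q' = 13`, `r = 03`, `r' = 12` switches to one with at most one negative edge or with a negative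
perfect matching. -/
theorem exists_switching_complete_four : ∀ p p' q q' r r' : Bool, ∃ i j k l : Bool,
    (p ^^ (i ^^ j)).toNat + (p' ^^ (k ^^ l)).toNat + (q ^^ (i ^^ k)).toNat +
      (q' ^^ (j ^^ l)).toNat + (r ^^ (i ^^ l)).toNat + (r' ^^ (j ^^ k)).toNat ≤ 1 ∨
    ((p ^^ (i ^^ j)) = true ∧ (p' ^^ (k ^^ l)) = true ∧ (q ^^ (i ^^ k)) = false ∧
      (q' ^^ (j ^^ l)) = false ∧ (r ^^ (i ^^ l)) = false ∧ (r' ^^ (j ^^ k)) = false) := by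
  intro p p' q q' r r'
  cases p <;> cases p' <;> cases q <;> decide +revert

theorem univ_eq_of_complete_four [Fintype V] (hG : G.Connected)
    (hsub : ∀ v : V, (G.neighborSet v).ncard ≤ 3) {a b c d : V} (hab : G.Adj a b)
    (hac : G.Adj a c) (had : G.Adj a d) (hbc : G.Adj b c) (hbd : G.Adj b d) (hcd : G.Adj c d) :
    (univ : Finset V) = {a, b, c, d} := by
  have key : ∀ {p q r s : V}, G.Adj p q → G.Adj p r → G.Adj p s → q ≠ r → q ≠ s → r ≠ s →
      ∀ z, G.Adj p z → z = q ∨ z = r ∨ z = s := by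
    intro p q r s hq hr hs h1 h2 h3 z hz
    by_contra! hne
    have h4 := card_filter_adj_le hsub univ p
    have h5 : ({z, q, r, s} : Finset V) ⊆ ({u ∈ univ | G.Adj p u} : Finset V) := by
      simp [insert_subset_iff, hq, hr, hs, hz]
    have h6 := card_le_card h5
    rw [card_insert_of_notMem (by simp [hne]), card_insert_of_notMem (by simp [h1, h2]),
      card_pair h3] at h6
    omega
  by_contra hne
  have h := edgeConn_univ hG {a, b, c, d} (subset_univ _) (by simp)
    (sdiff_nonempty.2 fun h => hne (h.antisymm (subset_univ _)))
  rw [Nat.one_le_iff_ne_zero] at h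
  refine h (pairSum_adjInd_eq_zero.2 fun u hu z hz huz => ?_)
  have ka := key hab hac had hbc.ne hbd.ne hcd.ne z
  have kb := key hab.symm hbc hbd hac.ne had.ne hcd.ne z
  have kc := key hac.symm hbc.symm hcd hab.ne had.ne hbd.ne z
  have kd := key had.symm hbd.symm hcd.symm hab.ne hac.ne hbc.ne z
  rw [mem_sdiff] at hz
  simp only [mem_insert, mem_singleton] at hu
  rcases hu with rfl | rfl | rfl | rfl
  · exact hz.2 (by rcases ka huz with rfl | rfl | rfl <;> simp)
  · exact hz.2 (by rcases kb huz with rfl | rfl | rfl <;> simp)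
  · exact hz.2 (by rcases kc huz with rfl | rfl | rfl <;> simp)
  · exact hz.2 (by rcases kd huz with rfl | rfl | rfl <;> simp)

theorem sIso_gamma1 [Fintype V] {a b c d : V} (huniv : (univ : Finset V) = {a, b, c, d})
    (hab : G.Adj a b) (hac : G.Adj a c) (had : G.Adj a d) (hbc : G.Adj b c) (hbd : G.Adj b d)
    (hcd : G.Adj c d) {x : V → Bool} (h1 : (σ s(a, b) ^^ (x a ^^ x b)) = true)
    (h2 : (σ s(c, d) ^^ (x c ^^ x d)) = true) (h3 : (σ s(a, c) ^^ (x a ^^ x c)) = false)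
    (h4 : (σ s(b, d) ^^ (x b ^^ x d)) = false) (h5 : (σ s(a, d) ^^ (x a ^^ x d)) = false)
    (h6 : (σ s(b, c) ^^ (x b ^^ x c)) = false) : SIso G σ gamma1G gamma1S := by
  have hinj : Function.Injective ![a, b, c, d] := by
    have := hab.ne; have := hac.ne; have := had.ne; have := hbc.ne; have := hbd.ne
    have := hcd.ne
    intro i j hij
    fin_cases i <;> fin_cases j <;> simp_all
  have hsurj : Function.Surjective ![a, b, c, d] := fun z => by
    have hz := mem_univ z
    rw [huniv] at hz
    simp only [mem_insert, mem_singleton] at hz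
    rcases hz with rfl | rfl | rfl | rfl
    exacts [⟨0, rfl⟩, ⟨1, rfl⟩, ⟨2, rfl⟩, ⟨3, rfl⟩]
  have hadj : ∀ i j : Fin 4, G.Adj (![a, b, c, d] i) (![a, b, c, d] j) ↔ gamma1G.Adj i j := by
    intro i j
    fin_cases i <;> fin_cases j <;>
      simp [gamma1G, hab, hac, had, hbc, hbd, hcd, hab.symm, hac.symm, had.symm, hbc.symm,
        hbd.symm, hcd.symm]
  let f : Fin 4 ≃ V := Equiv.ofBijective _ ⟨hinj, hsurj⟩
  let ψ : gamma1G ≃g G := ⟨f, fun {i j} => hadj i j⟩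
  refine ⟨ψ.symm, {z | x z = true}, fun e => ?_⟩
  induction e using Sym2.ind with
  | _ u v =>
    obtain ⟨i, rfl⟩ := ψ.surjective u
    obtain ⟨j, rfl⟩ := ψ.surjective v
    intro hij
    have hij' : i ≠ j := fun h => G.irrefl (h ▸ hij)
    have hswitch : ∀ p q, sgnSwitch σ {z | x z = true} s(p, q) = (σ s(p, q) ^^ (x p ^^ x q)) := by
      intro p q
      simp [sgnSwitch, sgnCross]
    have hψ : ∀ i, ψ i = ![a, b, c, d] i := fun _ => rfl
    rw [Sym2.map_mk, hswitch]
    simp only [RelIso.symm_apply_apply]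
    simp only [hψ]
    have hsymm : ∀ {p q : V} {t : Bool}, (σ s(p, q) ^^ (x p ^^ x q)) = t →
        (σ s(q, p) ^^ (x q ^^ x p)) = t := fun {p q t} h => by
      rw [Sym2.eq_swap, Bool.xor_comm (x q)]; exact h
    fin_cases i <;> fin_cases j <;>
      first
      | exact absurd rfl hij'
      | exact h1.trans (by simp [gamma1S])
      | exact (hsymm h1).trans (by simp [gamma1S])
      | exact h2.trans (by simp [gamma1S])
      | exact (hsymm h2).trans (by simp [gamma1S])
      | exact h3.trans (by simp [gamma1S])
      | exact (hsymm h3).trans (by simp [gamma1S])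
      | exact h4.trans (by simp [gamma1S])
      | exact (hsymm h4).trans (by simp [gamma1S])
      | exact h5.trans (by simp [gamma1S])
      | exact (hsymm h5).trans (by simp [gamma1S])
      | exact h6.trans (by simp [gamma1S])
      | exact (hsymm h6).trans (by simp [gamma1S])

theorem frust_le_of_complete_four [Fintype V] (hG : G.Connected)
    (hsub : ∀ v : V, (G.neighborSet v).ncard ≤ 3) (hσ : ¬ SIso G σ gamma1G gamma1S)
    {a b c d : V} (hab : G.Adj a b) (hac : G.Adj a c) (had : G.Adj a d) (hbc : G.Adj b c)
    (hbd : G.Adj b d) (hcd : G.Adj c d) : 8 * frust G σ ≤ 3 * Fintype.card V + 2 := by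
  have huniv := univ_eq_of_complete_four hG hsub hab hac had hbc hbd hcd
  have d3 : c ∉ ({d} : Finset V) := by simp [hcd.ne]
  have d2 : b ∉ ({c, d} : Finset V) := by simp [hbc.ne, hbd.ne]
  have d1 : a ∉ ({b, c, d} : Finset V) := by simp [hab.ne, hac.ne, had.ne]
  have hcard : Fintype.card V = 4 := by
    rw [← card_univ, huniv, card_insert_of_notMem d1, card_insert_of_notMem d2, card_pair hcd.ne]
  obtain ⟨i, j, k, l, h⟩ := exists_switching_complete_four (σ s(a, b)) (σ s(c, d)) (σ s(a, c))
    (σ s(b, d)) (σ s(a, d)) (σ s(b, c))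
  set x : V → Bool := fun z => if z = a then i else if z = b then j else if z = c then k else l
    with hx
  have xa : x a = i := by simp [hx]
  have xb : x b = j := by simp [hx, hab.ne']
  have xc : x c = k := by simp [hx, hac.ne', hbc.ne']
  have xd : x d = l := by simp [hx, had.ne', hbd.ne', hcd.ne']
  rw [← xa, ← xb, ← xc, ← xd] at h
  rcases h with h | ⟨h1, h2, h3, h4, h5, h6⟩
  · have n0 : pairSum (negInd G σ x) {d} {d} = 0 := by simp [pairSum, negInd_self]
    have n1 := pairSum_negInd_insert_le (G := G) (σ := σ) x d3 (L := {d}) fun _ h _ => h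
    have n2 := pairSum_negInd_insert_le (G := G) (σ := σ) x d2 (L := {c, d}) fun _ h _ => h
    have n3 := pairSum_negInd_insert_le (G := G) (σ := σ) x d1 (L := {b, c, d}) fun _ h _ => h
    rw [sum_singleton] at n1
    rw [sum_insert d3, sum_singleton] at n2
    rw [sum_insert d2, sum_insert d3, sum_singleton, ← huniv] at n3
    have h1 := frust_le_negNum (G := G) (σ := σ) x
    have h2 := two_mul_negNum (G := G) (σ := σ) x
    omega
  · exact absurd (sIso_gamma1 huniv hab hac had hbc hbd hcd h1 h2 h3 h4 h5 h6) hσ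

end SubcubicFrust

/-- Every signed connected simple subcubic graph other than `Γ̂₁`
satisfies `F(G, σ) ≤ (3·v(G) + 2)/8`. -/
theorem frust_le_of_connected_subcubic {V : Type*} [Fintype V]
    (G : SimpleGraph V) (σ : Sym2 V → Bool)
    (hconn : G.Connected)
    (hsub : ∀ v : V, (G.neighborSet v).ncard ≤ 3)
    (h1 : ¬ SIso G σ gamma1G gamma1S) :
    8 * frust G σ ≤ 3 * Fintype.card V + 2 := by
  by_cases hK : ∀ a b c d, G.Adj a b → G.Adj a c → G.Adj a d → G.Adj b c → G.Adj b d →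
      ¬ G.Adj c d
  · exact (SubcubicFrust.good_of_edgeConn_one (SubcubicFrust.card_filter_adj_le hsub) hK _
      (SubcubicFrust.edgeConn_univ hconn)).frust_le hsub
  · push Not at hK
    obtain ⟨a, b, c, d, hab, hac, had, hbc, hbd, hcd⟩ := hK
    exact SubcubicFrust.frust_le_of_complete_four hconn hsub h1 hab hac had hbc hbd hcd
end

section
/- Let (G, σ) be a signed connected simple subcubic graph not isomorphic to Γ̂₁. Then F(G, σ) = (3v(G)+2)/8 if and only if G is cubic, contains at least one cut-edge, every leaf-block is isomorphic to Γ̂₂ (the 5-vertex subdivision of signed K₄ with frustration index 2), and every non-leaf-block is a negative triangle. -/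
open scoped Classical

/-- A block of `G`: a connected component of the graph obtained from `G` by deleting
all cut-edges (bridges). -/
def IsBlock {V : Type*} (G : SimpleGraph V) (B : Set V) : Prop :=
  ∃ v : V, B = {w | (G.deleteEdges {e | G.IsBridge e}).Reachable v w}

/-- A leaf-block: a block connected to the rest of the graph by exactly one cut-edge. -/
noncomputable def IsLeafBlock {V : Type*} (G : SimpleGraph V) (B : Set V) : Prop :=
  IsBlock G B ∧ {e : Sym2 V | G.IsBridge e ∧ ∃ v ∈ B, v ∈ e}.ncard = 1

/-- The block `B` induces a negative triangle of `(G, σ)`. -/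
noncomputable def IsNegTriangleBlock {V : Type*} (G : SimpleGraph V)
    (σ : Sym2 V → Bool) (B : Set V) : Prop :=
  B.ncard = 3 ∧ (∀ a ∈ B, ∀ b ∈ B, a ≠ b → G.Adj a b) ∧
    Odd {e : Sym2 V | e ∈ G.edgeSet ∧ σ e = true ∧ ∀ v ∈ e, v ∈ B}.ncard

namespace SignedSubcubic

variable {V : Type*}

/-- The total weight of the ordered pairs in `X × Y`. -/
def wsum (w : V → V → ℕ) (X Y : Finset V) : ℕ := ∑ x ∈ X, ∑ y ∈ Y, w x y

/-- The total weight of the unordered pairs inside `X`. -/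
def hsum (w : V → V → ℕ) (X : Finset V) : ℕ := wsum w X X / 2

/-- Symmetric weights vanishing on the diagonal. -/
structure IsEdgeWeight (w : V → V → ℕ) : Prop where
  symm : ∀ x y, w x y = w y x
  diag : ∀ x, w x x = 0

theorem wsum_union_left (w : V → V → ℕ) {X Y : Finset V} (h : Disjoint X Y) (Z : Finset V) :
    wsum w (X ∪ Y) Z = wsum w X Z + wsum w Y Z := Finset.sum_union h

theorem wsum_union_right (w : V → V → ℕ) {X Y : Finset V} (h : Disjoint X Y) (Z : Finset V) :
    wsum w Z (X ∪ Y) = wsum w Z X + wsum w Z Y := by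
  simp only [wsum, Finset.sum_union h, Finset.sum_add_distrib]

theorem IsEdgeWeight.comm {w : V → V → ℕ} (hw : IsEdgeWeight w) (X Y : Finset V) :
    wsum w X Y = wsum w Y X := by
  unfold wsum
  rw [Finset.sum_comm]
  exact Finset.sum_congr rfl fun _ _ => Finset.sum_congr rfl fun _ _ => hw.symm _ _

theorem wsum_mono (w : V → V → ℕ) {X X' Y Y' : Finset V} (hX : X ⊆ X') (hY : Y ⊆ Y') :
    wsum w X Y ≤ wsum w X' Y' :=
  (Finset.sum_le_sum fun _ _ => Finset.sum_le_sum_of_subset hY).trans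
    (Finset.sum_le_sum_of_subset (f := fun x => ∑ y ∈ Y', w x y) hX)

theorem IsEdgeWeight.two_dvd {w : V → V → ℕ} (hw : IsEdgeWeight w) (S : Finset V) :
    2 ∣ wsum w S S := by
  induction S using Finset.induction_on with
  | empty => simp [wsum]
  | insert v S hv ih =>
    have hd : Disjoint {v} S := by simpa using hv
    have h1 : wsum w {v} {v} = 0 := by simp [wsum, hw.diag]
    rw [Finset.insert_eq, wsum_union_left w hd, wsum_union_right w hd, wsum_union_right w hd,
      hw.comm S {v}, h1]
    omega

theorem IsEdgeWeight.wsum_self {w : V → V → ℕ} (hw : IsEdgeWeight w) (S : Finset V) :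
    wsum w S S = 2 * hsum w S := by
  have := hw.two_dvd S
  unfold hsum
  omega

theorem IsEdgeWeight.hsum_union {w : V → V → ℕ} (hw : IsEdgeWeight w) {X Y : Finset V}
    (h : Disjoint X Y) : hsum w (X ∪ Y) = hsum w X + hsum w Y + wsum w X Y := by
  have h1 := hw.wsum_self (X ∪ Y)
  rw [wsum_union_left w h, wsum_union_right w h, wsum_union_right w h, hw.comm Y X,
    hw.wsum_self, hw.wsum_self] at h1
  omega

theorem IsEdgeWeight.hsum_singleton {w : V → V → ℕ} (hw : IsEdgeWeight w) (v : V) :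
    hsum w {v} = 0 := by simp [hsum, wsum, hw.diag]

theorem hsum_congr {w w' : V → V → ℕ} {S : Finset V}
    (h : ∀ x ∈ S, ∀ y ∈ S, w x y = w' x y) : hsum w S = hsum w' S := by
  unfold hsum wsum
  rw [Finset.sum_congr rfl fun x hx => Finset.sum_congr rfl fun y hy => h x hx y hy]

variable (G : SimpleGraph V) (σ : Sym2 V → Bool)

/-- The indicator of adjacency. -/
noncomputable def adjW (x y : V) : ℕ := if G.Adj x y then 1 else 0

/-- The indicator of negative adjacency after switching by `c`. -/
noncomputable def negW (c : V → Bool) (x y : V) : ℕ :=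
  if G.Adj x y ∧ xor (σ s(x, y)) (xor (c x) (c y)) = true then 1 else 0

theorem isEdgeWeight_adjW : IsEdgeWeight (adjW G) where
  symm x y := by simp [adjW, G.adj_comm]
  diag x := by simp [adjW]

theorem isEdgeWeight_negW (c : V → Bool) : IsEdgeWeight (negW G σ c) where
  symm x y := by simp [negW, G.adj_comm x y, Sym2.eq_swap (a := x), Bool.xor_comm (c x)]
  diag x := by simp [negW]

/-- The number of edges between two vertex sets. -/
noncomputable def ecount (X Y : Finset V) : ℕ := wsum (adjW G) X Y

/-- The number of edges inside a vertex set. -/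
noncomputable def esize (S : Finset V) : ℕ := hsum (adjW G) S

/-- The frustration index of the subgraph induced on a vertex set. -/
noncomputable def minNeg (S : Finset V) : ℕ := ⨅ c : V → Bool, hsum (negW G σ c) S

theorem minNeg_le (c : V → Bool) (S : Finset V) : minNeg G σ S ≤ hsum (negW G σ c) S :=
  ciInf_le (OrderBot.bddBelow _) c

theorem exists_minNeg (S : Finset V) : ∃ c : V → Bool, hsum (negW G σ c) S = minNeg G σ S :=
  ciInf_mem (fun c : V → Bool => hsum (negW G σ c) S)

theorem add_le_minNeg_union {X Y : Finset V} (h : Disjoint X Y) :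
    minNeg G σ X + minNeg G σ Y ≤ minNeg G σ (X ∪ Y) := by
  obtain ⟨c, hc⟩ := exists_minNeg G σ (X ∪ Y)
  rw [(isEdgeWeight_negW G σ c).hsum_union h] at hc
  have h1 := minNeg_le G σ c X
  have h2 := minNeg_le G σ c Y
  omega

theorem minNeg_union_le {X Y : Finset V} (h : Disjoint X Y) :
    minNeg G σ (X ∪ Y) ≤ minNeg G σ X + minNeg G σ Y + ecount G X Y / 2 := by
  obtain ⟨a, ha⟩ := exists_minNeg G σ X
  obtain ⟨b, hb⟩ := exists_minNeg G σ Y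
  have hY : ∀ y ∈ Y, y ∉ X := fun y hy hx => Finset.disjoint_left.1 h hx hy
  have key : ∀ k : Bool, minNeg G σ (X ∪ Y) ≤ minNeg G σ X + minNeg G σ Y +
      wsum (negW G σ fun v => if v ∈ X then a v else xor k (b v)) X Y := by
    intro k
    refine (minNeg_le G σ (fun v => if v ∈ X then a v else xor k (b v)) _).trans ?_
    rw [(isEdgeWeight_negW G σ _).hsum_union h, ← ha, ← hb]
    refine le_of_eq ?_
    congr 2
    · exact hsum_congr fun x hx y hy => by simp [negW, hx, hy]
    · exact hsum_congr fun x hx y hy => by cases k <;> simp [negW, hY x hx, hY y hy]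
  have hsum : wsum (negW G σ fun v => if v ∈ X then a v else xor false (b v)) X Y +
      wsum (negW G σ fun v => if v ∈ X then a v else xor true (b v)) X Y = ecount G X Y := by
    unfold ecount wsum
    rw [← Finset.sum_add_distrib]
    refine Finset.sum_congr rfl fun x hx => ?_
    rw [← Finset.sum_add_distrib]
    refine Finset.sum_congr rfl fun y hy => ?_
    by_cases hxy : G.Adj x y <;> simp only [negW, adjW, hx, hY y hy, hxy] <;>
      cases σ s(x, y) <;> cases a x <;> cases b y <;> simp
  have h0 := key false
  have h1 := key true
  omega

/-- The number of edges minus four times the frustration index. -/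
noncomputable def excess (S : Finset V) : ℤ := esize G S - 4 * minNeg G σ S

theorem ecount_comm (X Y : Finset V) : ecount G X Y = ecount G Y X :=
  (isEdgeWeight_adjW G).comm X Y

theorem ecount_union_left {X Y : Finset V} (h : Disjoint X Y) (Z : Finset V) :
    ecount G (X ∪ Y) Z = ecount G X Z + ecount G Y Z := wsum_union_left _ h Z

theorem ecount_union_right {X Y : Finset V} (h : Disjoint X Y) (Z : Finset V) :
    ecount G Z (X ∪ Y) = ecount G Z X + ecount G Z Y := wsum_union_right _ h Z

theorem ecount_mono {X X' Y Y' : Finset V} (hX : X ⊆ X') (hY : Y ⊆ Y') :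
    ecount G X Y ≤ ecount G X' Y' := wsum_mono _ hX hY

theorem ecount_self (S : Finset V) : ecount G S S = 2 * esize G S :=
  (isEdgeWeight_adjW G).wsum_self S

theorem esize_union {X Y : Finset V} (h : Disjoint X Y) :
    esize G (X ∪ Y) = esize G X + esize G Y + ecount G X Y :=
  (isEdgeWeight_adjW G).hsum_union h

theorem esize_singleton (v : V) : esize G {v} = 0 := (isEdgeWeight_adjW G).hsum_singleton v

theorem minNeg_singleton (v : V) : minNeg G σ {v} = 0 := by
  have := minNeg_le G σ (fun _ => false) {v}
  rw [(isEdgeWeight_negW G σ _).hsum_singleton] at this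
  omega

theorem excess_singleton (v : V) : excess G σ {v} = 0 := by
  simp [excess, esize_singleton, minNeg_singleton]

theorem excess_union {X Y : Finset V} (h : Disjoint X Y) (h1 : ecount G X Y ≤ 1) :
    excess G σ (X ∪ Y) = excess G σ X + excess G σ Y + ecount G X Y := by
  have h2 := add_le_minNeg_union G σ h
  have h3 := minNeg_union_le G σ h
  have h4 := esize_union G h
  unfold excess
  omega

theorem ecount_singleton (v : V) (S : Finset V) :
    ecount G {v} S = (S.filter (G.Adj v)).card := by
  simp only [ecount, wsum, adjW, Finset.sum_singleton, Finset.sum_boole, Nat.cast_id]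

theorem esize_insert {v : V} {S : Finset V} (hv : v ∉ S) :
    esize G (insert v S) = esize G S + ecount G {v} S := by
  rw [Finset.insert_eq, esize_union G (by simpa using hv), esize_singleton]
  omega

theorem minNeg_insert_le {v : V} {S : Finset V} (hv : v ∉ S) :
    minNeg G σ (insert v S) ≤ minNeg G σ S + ecount G {v} S / 2 := by
  have := minNeg_union_le G σ (X := {v}) (Y := S) (by simpa using hv)
  rw [minNeg_singleton] at this
  rw [Finset.insert_eq]
  omega

theorem ecount_pos_iff {X Y : Finset V} : 1 ≤ ecount G X Y ↔ ∃ x ∈ X, ∃ y ∈ Y, G.Adj x y := by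
  rw [Nat.one_le_iff_ne_zero]
  simp [ecount, wsum, adjW]

theorem ecount_sum (X Y : Finset V) : ecount G X Y = ∑ x ∈ X, ecount G {x} Y := by
  simp [ecount, wsum]

theorem ecount_singleton_insert (v : V) {a : V} {T : Finset V} (ha : a ∉ T) :
    ecount G {v} (insert a T) = adjW G v a + ecount G {v} T := by
  simp [ecount, wsum, Finset.sum_insert ha]

theorem ecount_singleton_singleton (v a : V) : ecount G {v} {a} = adjW G v a := by
  simp [ecount, wsum]

theorem adjW_of_adj {G : SimpleGraph V} {a b : V} (h : G.Adj a b) : adjW G a b = 1 := by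
  simp [adjW, h]

theorem adjW_of_not_adj {G : SimpleGraph V} {a b : V} (h : ¬ G.Adj a b) : adjW G a b = 0 := by
  simp [adjW, h]

theorem ecount_insert_left {v : V} {X : Finset V} (hv : v ∉ X) (Y : Finset V) :
    ecount G (insert v X) Y = ecount G {v} Y + ecount G X Y := by
  rw [Finset.insert_eq, ecount_union_left G (by simpa using hv)]

theorem ecount_insert_right {v : V} {X : Finset V} (hv : v ∉ X) (Y : Finset V) :
    ecount G Y (insert v X) = ecount G {v} Y + ecount G Y X := by
  rw [ecount_comm, ecount_insert_left G hv, ecount_comm G X]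

theorem ecount_singleton_self (v : V) : ecount G {v} {v} = 0 := by
  simp [ecount, wsum, adjW]

theorem card_le_ecount {v : V} {A S : Finset V} (hA : A ⊆ S) (h : ∀ a ∈ A, G.Adj v a) :
    A.card ≤ ecount G {v} S := by
  rw [ecount_singleton]
  exact Finset.card_le_card fun a ha => Finset.mem_filter.2 ⟨hA ha, h a ha⟩

theorem exists_adj_of_card_lt {v : V} {A S : Finset V} (h : A.card < ecount G {v} S) :
    ∃ y ∈ S, G.Adj v y ∧ y ∉ A := by
  rw [ecount_singleton] at h
  obtain ⟨y, hy, hyA⟩ := Finset.exists_mem_notMem_of_card_lt_card h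
  exact ⟨y, (Finset.mem_filter.1 hy).1, (Finset.mem_filter.1 hy).2, hyA⟩

/-- The induced subgraph on `S` is nonempty and all its edge-cuts have at least `k` edges. -/
def EConn (k : ℕ) (S : Finset V) : Prop :=
  S.Nonempty ∧ ∀ X Y : Finset V, X.Nonempty → Y.Nonempty → Disjoint X Y → X ∪ Y = S →
    k ≤ ecount G X Y

/-- Every vertex of `G` has degree at most three. -/
def Subcubic : Prop := ∀ (v : V) (S : Finset V), ecount G {v} S ≤ 3

/-- The vertex set of a triangle. -/
def IsTri (S : Finset V) : Prop :=
  ∃ a b c, G.Adj a b ∧ G.Adj a c ∧ G.Adj b c ∧ S = {a, b, c}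

/-- The vertex set of a complete graph on four vertices. -/
def IsK4 (S : Finset V) : Prop :=
  ∃ a b c d, G.Adj a b ∧ G.Adj a c ∧ G.Adj a d ∧ G.Adj b c ∧ G.Adj b d ∧ G.Adj c d ∧
    S = {a, b, c, d}

/-- The vertex set of a complete graph on four vertices with one subdivided edge. -/
def IsSubK4 (S : Finset V) : Prop :=
  ∃ a b c d e, G.Adj a b ∧ G.Adj a c ∧ G.Adj a d ∧ G.Adj b d ∧ G.Adj c d ∧ G.Adj b e ∧
    G.Adj c e ∧ b ≠ c ∧ a ≠ e ∧ d ≠ e ∧ S = {a, b, c, d, e}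

/-- The dichotomy satisfied by 2-edge-connected sets. -/
def Good (S : Finset V) : Prop :=
  0 ≤ excess G σ S ∨ IsK4 G S ∨ (excess G σ S = -1 ∧ (IsTri G S ∨ IsSubK4 G S))

/-- All 2-edge-connected sets with fewer than `n` vertices satisfy `Good`. -/
def GoodBelow (n : ℕ) : Prop :=
  ∀ S : Finset V, S.card < n → EConn G 2 S → Good G σ S

variable {G} {σ}

theorem EConn.mono {k l : ℕ} (hkl : k ≤ l) {S : Finset V} (h : EConn G l S) : EConn G k S :=
  ⟨h.1, fun X Y hX hY hd hS => hkl.trans (h.2 X Y hX hY hd hS)⟩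

theorem EConn.two_le_sdiff {k : ℕ} {S : Finset V} (h : EConn G k S) {X : Finset V}
    (hXS : X ⊆ S) (hX : X.Nonempty) (hne : X ≠ S) : k ≤ ecount G X (S \ X) :=
  h.2 X (S \ X) hX (Finset.sdiff_nonempty.2 fun hh => hne (hXS.antisymm hh))
    Finset.disjoint_sdiff (Finset.union_sdiff_of_subset hXS)

theorem IsTri.card {S : Finset V} (h : IsTri G S) : S.card = 3 := by
  obtain ⟨a, b, c, hab, hac, hbc, rfl⟩ := h
  simp [hab.ne, hac.ne, hbc.ne]

theorem IsTri.esize {S : Finset V} (h : IsTri G S) : esize G S = 3 := by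
  obtain ⟨a, b, c, hab, hac, hbc, rfl⟩ := h
  rw [esize_insert, esize_insert, esize_singleton, ecount_singleton_insert,
    ecount_singleton_singleton, ecount_singleton_singleton, adjW_of_adj hab, adjW_of_adj hac,
    adjW_of_adj hbc] <;> simp [hab.ne, hac.ne, hbc.ne]

theorem IsK4.card {S : Finset V} (h : IsK4 G S) : S.card = 4 := by
  obtain ⟨a, b, c, d, hab, hac, had, hbc, hbd, hcd, rfl⟩ := h
  simp [hab.ne, hac.ne, had.ne, hbc.ne, hbd.ne, hcd.ne]

theorem IsK4.esize {S : Finset V} (h : IsK4 G S) : esize G S = 6 := by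
  obtain ⟨a, b, c, d, hab, hac, had, hbc, hbd, hcd, rfl⟩ := h
  rw [esize_insert, IsTri.esize ⟨b, c, d, hbc, hbd, hcd, rfl⟩, ecount_singleton_insert,
    ecount_singleton_insert, ecount_singleton_singleton, adjW_of_adj hab, adjW_of_adj hac,
    adjW_of_adj had] <;> simp [hab.ne, hac.ne, had.ne, hbc.ne, hbd.ne, hcd.ne]

theorem IsSubK4.card {S : Finset V} (h : IsSubK4 G S) : S.card = 5 := by
  obtain ⟨a, b, c, d, e, hab, hac, had, hbd, hcd, hbe, hce, hbc, hae, hde, rfl⟩ := h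
  simp [hab.ne, hac.ne, had.ne, hbc, hbd.ne, hcd.ne, hbe.ne, hce.ne, hae, hde]

theorem out_add_le (hd : Subcubic G) {S T : Finset V} (h : Disjoint S T) :
    ecount G S T + 2 * esize G S ≤ 3 * S.card := by
  rw [← ecount_self, add_comm, ← ecount_union_right G h, ecount_sum, mul_comm]
  exact Finset.sum_le_card_nsmul _ _ _ fun v _ => hd v _

theorem adj_four_false (hd : Subcubic G) {v a b c d : V} (ha : G.Adj v a) (hb : G.Adj v b)
    (hc : G.Adj v c) (hdd : G.Adj v d) (hab : a ≠ b) (hac : a ≠ c) (had : a ≠ d) (hbc : b ≠ c)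
    (hbd : b ≠ d) (hcd : c ≠ d) : False := by
  have h1 := card_le_ecount G (v := v) (A := {a, b, c, d}) subset_rfl (by simp [*])
  have h2 : ({a, b, c, d} : Finset V).card = 4 := by simp [*]
  have := hd v {a, b, c, d}
  omega

theorem nonadj_of_subK4 (hd : Subcubic G) {a b c d e : V} (hab : G.Adj a b) (hac : G.Adj a c)
    (had : G.Adj a d) (hbd : G.Adj b d) (hcd : G.Adj c d) (hbe : G.Adj b e) (hce : G.Adj c e)
    (hbc : b ≠ c) (hae : a ≠ e) (hde : d ≠ e) : ¬ G.Adj b c ∧ ¬ G.Adj a e ∧ ¬ G.Adj d e :=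
  ⟨fun h => adj_four_false hd hab.symm hbd hbe h had.ne hae hac.ne hde hcd.ne' hce.ne',
    fun h => adj_four_false hd hab hac had h hbc hbd.ne hbe.ne hcd.ne hce.ne hde,
    fun h => adj_four_false hd hbd.symm hcd.symm had.symm h hbc hab.ne' hbe.ne hac.ne' hce.ne hae⟩

theorem IsSubK4.esize (hd : Subcubic G) {S : Finset V} (h : IsSubK4 G S) : esize G S = 7 := by
  obtain ⟨a, b, c, d, e, hab, hac, had, hbd, hcd, hbe, hce, hbc, hae, hde, rfl⟩ := h
  obtain ⟨nbc, nae, nde⟩ := nonadj_of_subK4 hd hab hac had hbd hcd hbe hce hbc hae hde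
  rw [esize_insert, esize_insert, esize_insert, esize_insert, esize_singleton,
    ecount_singleton_insert, ecount_singleton_insert, ecount_singleton_insert,
    ecount_singleton_singleton, ecount_singleton_insert, ecount_singleton_insert,
    ecount_singleton_singleton, ecount_singleton_insert, ecount_singleton_singleton,
    ecount_singleton_singleton, adjW_of_adj hab, adjW_of_adj hac, adjW_of_adj had,
    adjW_of_adj hbd, adjW_of_adj hcd, adjW_of_adj hbe, adjW_of_adj hce, adjW_of_not_adj nbc,
    adjW_of_not_adj nae, adjW_of_not_adj nde] <;>
  simp [hab.ne, hac.ne, had.ne, hbc, hbd.ne, hcd.ne, hbe.ne, hce.ne, hae, hde]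

theorem IsK4.out_eq_zero (hd : Subcubic G) {S T : Finset V} (h : IsK4 G S) (hST : Disjoint S T) :
    ecount G S T = 0 := by
  have := out_add_le hd hST
  rw [h.esize, h.card] at this
  omega

theorem IsSubK4.eq_of_subset (hd : Subcubic G) {S T : Finset V} (h : IsSubK4 G S) (hST : S ⊆ T)
    (hT : EConn G 2 T) : S = T := by
  by_contra hne
  have h1 := out_add_le hd (Finset.disjoint_sdiff (s := S) (t := T))
  rw [h.esize hd, h.card] at h1
  have h2 := hT.two_le_sdiff hST (Finset.card_pos.1 (by rw [h.card]; omega)) hne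
  omega

theorem IsSubK4.exists_isTri {S : Finset V} (h : IsSubK4 G S) : ∃ T ⊆ S, IsTri G T := by
  obtain ⟨a, b, c, d, e, hab, hac, had, hbd, hcd, hbe, hce, hbc, hae, hde, rfl⟩ := h
  exact ⟨{a, b, d}, by intro x; simp; tauto, a, b, d, hab, had, hbd, rfl⟩

theorem EConn.split {S : Finset V} (h : EConn G 1 S) (h2 : ¬ EConn G 2 S) :
    ∃ X Y, Disjoint X Y ∧ X ∪ Y = S ∧ EConn G 1 X ∧ EConn G 1 Y ∧ ecount G X Y = 1 ∧
      X.card < S.card ∧ Y.card < S.card := by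
  unfold EConn at h2
  push Not at h2
  obtain ⟨X, Y, hX, hY, hXY, rfl, hlt⟩ := h2 h.1
  have he : ecount G X Y = 1 := by
    have := h.2 X Y hX hY hXY rfl
    omega
  have aux : ∀ X Y : Finset V, X.Nonempty → Y.Nonempty → Disjoint X Y → ecount G X Y = 1 →
      EConn G 1 (X ∪ Y) → EConn G 1 X := by
    rintro X Y hX hY hXY he h
    refine ⟨hX, fun A B hA hB hAB hABX => ?_⟩
    subst hABX
    rw [Finset.disjoint_union_left] at hXY
    have h1 := h.2 A (B ∪ Y) hA (hB.mono Finset.subset_union_left)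
      (Finset.disjoint_union_right.2 ⟨hAB, hXY.1⟩) (by rw [Finset.union_assoc])
    have h2 := h.2 B (A ∪ Y) hB (hA.mono Finset.subset_union_left)
      (Finset.disjoint_union_right.2 ⟨hAB.symm, hXY.2⟩)
      (by rw [← Finset.union_assoc, Finset.union_comm B A])
    rw [ecount_union_right G hXY.2] at h1
    rw [ecount_union_right G hXY.1, ecount_comm G B A] at h2
    rw [ecount_union_left G hAB] at he
    omega
  have hc := Finset.card_union_of_disjoint hXY
  have := hX.card_pos
  have := hY.card_pos
  exact ⟨X, Y, hXY, rfl, aux X Y hX hY hXY he h,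
    aux Y X hY hX hXY.symm (by rwa [ecount_comm]) (by rwa [Finset.union_comm]), he,
    by omega, by omega⟩

theorem EConn.subset_of_inter {S X Y Z : Finset V} (hXY : Disjoint X Y) (hS : X ∪ Y = S)
    (he : ecount G X Y ≤ 1) (hZ : EConn G 2 Z) (hZS : Z ⊆ S) {v : V} (hvZ : v ∈ Z)
    (hvX : v ∈ X) : Z ⊆ X := by
  by_contra hcon
  obtain ⟨w, hwZ, hwX⟩ := Finset.not_subset.1 hcon
  have hwY : w ∈ Y := by
    have := hZS hwZ
    rw [← hS, Finset.mem_union] at this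
    tauto
  have h1 := hZ.2 (Z ∩ X) (Z ∩ Y) ⟨v, by simp [*]⟩ ⟨w, by simp [*]⟩
    (hXY.mono Finset.inter_subset_right Finset.inter_subset_right)
    (by rw [← Finset.inter_union_distrib_left, hS, Finset.inter_eq_left.2 hZS])
  have h2 := ecount_mono G (Finset.inter_subset_right (s₁ := Z) (s₂ := X))
    (Finset.inter_subset_right (s₁ := Z) (s₂ := Y))
  omega

theorem GoodBelow.neg_one_le {n : ℕ} (hG : GoodBelow G σ n) (hd : Subcubic G) {S : Finset V}
    (hS : S.card < n) (h : EConn G 1 S) (hK : ¬ IsK4 G S) : -1 ≤ excess G σ S := by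
  induction hk : S.card using Nat.strong_induction_on generalizing S with
  | _ k ih =>
  by_cases h2 : EConn G 2 S
  · rcases hG S hS h2 with h | h | h
    · omega
    · exact absurd h hK
    · omega
  · obtain ⟨X, Y, hXY, rfl, hX, hY, he, hXc, hYc⟩ := h.split h2
    have hKX : ¬ IsK4 G X := fun hK => by
      have := hK.out_eq_zero hd hXY
      omega
    have hKY : ¬ IsK4 G Y := fun hK => by
      have := hK.out_eq_zero hd hXY.symm
      rw [ecount_comm] at this
      omega
    have h1 := ih _ (hk ▸ hXc) (by omega) hX hKX rfl
    have h2 := ih _ (hk ▸ hYc) (by omega) hY hKY rfl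
    rw [excess_union G σ hXY he.le]
    omega

/-- In a connected set of excess `-1`, every vertex lies in a block which is a triangle or a
subdivided `K₄`. -/
theorem GoodBelow.exists_block {n : ℕ} (hG : GoodBelow G σ n) (hd : Subcubic G) {S : Finset V}
    (hS : S.card < n) (h : EConn G 1 S) (hK : ¬ IsK4 G S) (ht : excess G σ S = -1) {v : V}
    (hv : v ∈ S) :
    ∃ B ⊆ S, v ∈ B ∧ EConn G 2 B ∧ excess G σ B = -1 ∧ (IsTri G B ∨ IsSubK4 G B) ∧
      ∀ Z ⊆ S, EConn G 2 Z → v ∈ Z → Z ⊆ B := by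
  induction hk : S.card using Nat.strong_induction_on generalizing S with
  | _ k ih =>
  by_cases h2 : EConn G 2 S
  · rcases hG S hS h2 with h | h | h
    · omega
    · exact absurd h hK
    · exact ⟨S, subset_rfl, hv, h2, ht, h.2, fun Z hZ _ _ => hZ⟩
  · obtain ⟨X, Y, hXY, rfl, hX, hY, he, hXc, hYc⟩ := h.split h2
    have hKX : ¬ IsK4 G X := fun hK => by
      have := hK.out_eq_zero hd hXY
      omega
    have hKY : ¬ IsK4 G Y := fun hK => by
      have := hK.out_eq_zero hd hXY.symm
      rw [ecount_comm] at this
      omega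
    have h1 := hG.neg_one_le hd (by omega) hX hKX
    have h2 := hG.neg_one_le hd (by omega) hY hKY
    rw [excess_union G σ hXY he.le] at ht
    rcases Finset.mem_union.1 hv with hvX | hvY
    · obtain ⟨B, hB, hvB, hB2, hBt, hBT, hBm⟩ :=
        ih _ (hk ▸ hXc) (by omega) hX hKX (by omega) hvX rfl
      exact ⟨B, hB.trans Finset.subset_union_left, hvB, hB2, hBt, hBT, fun Z hZ hZ2 hvZ =>
        hBm Z (hZ2.subset_of_inter hXY rfl he.le hZ hvZ hvX) hZ2 hvZ⟩
    · obtain ⟨B, hB, hvB, hB2, hBt, hBT, hBm⟩ :=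
        ih _ (hk ▸ hYc) (by omega) hY hKY (by omega) hvY rfl
      rw [ecount_comm] at he
      exact ⟨B, hB.trans Finset.subset_union_right, hvB, hB2, hBt, hBT, fun Z hZ hZ2 hvZ =>
        hBm Z (hZ2.subset_of_inter hXY.symm (Finset.union_comm _ _) he.le hZ hvZ hvY) hZ2 hvZ⟩

theorem EConn.insert_vertex {B : Finset V} (hB : EConn G 2 B) {r : V} (hr : r ∉ B)
    (h : 2 ≤ ecount G {r} B) : EConn G 2 (insert r B) := by
  have aux : ∀ X Y : Finset V, X.Nonempty → Y.Nonempty → Disjoint X Y → X ∪ Y = insert r B →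
      r ∈ X → 2 ≤ ecount G X Y := by
    intro X Y hX hY hXY hU hrX
    have hrY : r ∉ Y := Finset.disjoint_left.1 hXY hrX
    have hYB : X.erase r ∪ Y = B := by
      rw [← Finset.erase_eq_of_notMem hrY, ← Finset.erase_union_distrib, hU,
        Finset.erase_insert hr]
    have hle := ecount_mono G (Finset.erase_subset r X) (subset_refl Y)
    have hle' := ecount_mono G (Finset.singleton_subset_iff.2 hrX) (subset_refl Y)
    by_cases he : (X.erase r).Nonempty
    · have := hB.2 _ _ he hY (hXY.mono_left (Finset.erase_subset _ _)) hYB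
      omega
    · rw [Finset.not_nonempty_iff_eq_empty.1 he, Finset.empty_union] at hYB
      subst hYB
      omega
  refine ⟨⟨r, by simp⟩, fun X Y hX hY hXY hU => ?_⟩
  have : r ∈ X ∪ Y := by simp [hU]
  rcases Finset.mem_union.1 this with h | h
  · exact aux X Y hX hY hXY hU h
  · rw [ecount_comm]
    exact aux Y X hY hX hXY.symm (by rw [Finset.union_comm, hU]) h

theorem EConn.of_insert (hd : Subcubic G) {v : V} {R : Finset V} (hv : v ∉ R)
    (h : EConn G 2 (insert v R)) (hR : R.Nonempty) : EConn G 1 R := by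
  refine ⟨hR, fun X Y hX hY hXY hU => ?_⟩
  subst hU
  rw [Finset.mem_union, not_or] at hv
  have h1 := h.2 X (insert v Y) hX (Finset.insert_nonempty _ _)
    (Finset.disjoint_insert_right.2 ⟨hv.1, hXY⟩) (Finset.union_insert _ _ _)
  have h2 := h.2 (insert v X) Y (Finset.insert_nonempty _ _) hY
    (Finset.disjoint_insert_left.2 ⟨hv.2, hXY⟩) (Finset.insert_union _ _ _)
  rw [ecount_insert_right G hv.2] at h1
  rw [ecount_insert_left G hv.1] at h2
  have h3 := hd v (X ∪ Y)
  rw [ecount_union_right G hXY] at h3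
  omega

theorem EConn.of_insert_pendant {u : V} {R : Finset V} (hu : u ∉ R)
    (h : EConn G 1 (insert u R)) (hR : R.Nonempty) (hdeg : ecount G {u} R ≤ 1) : EConn G 1 R := by
  refine ⟨hR, fun X Y hX hY hXY hU => ?_⟩
  subst hU
  rw [Finset.mem_union, not_or] at hu
  have h1 := h.2 X (insert u Y) hX (Finset.insert_nonempty _ _)
    (Finset.disjoint_insert_right.2 ⟨hu.1, hXY⟩) (Finset.union_insert _ _ _)
  have h2 := h.2 (insert u X) Y (Finset.insert_nonempty _ _) hY
    (Finset.disjoint_insert_left.2 ⟨hu.2, hXY⟩) (Finset.insert_union _ _ _)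
  rw [ecount_insert_right G hu.2] at h1
  rw [ecount_insert_left G hu.1] at h2
  rw [ecount_union_right G hXY] at hdeg
  omega

theorem EConn.two_le_degree {S : Finset V} (h : EConn G 2 S) (hc : 2 ≤ S.card) {v : V}
    (hv : v ∈ S) : 2 ≤ ecount G {v} S :=
  (h.two_le_sdiff (Finset.singleton_subset_iff.2 hv) (Finset.singleton_nonempty v)
    (by rintro rfl; simp at hc)).trans (ecount_mono G subset_rfl Finset.sdiff_subset)

theorem two_le_card_of_block {B : Finset V} (hB : IsTri G B ∨ IsSubK4 G B) : 2 ≤ B.card := by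
  rcases hB with h | h <;> rw [h.card] <;> omega

theorem not_isK4_of_adj (hd : Subcubic G) {S : Finset V} {x y : V} (hx : x ∈ S) (hy : y ∉ S)
    (h : G.Adj x y) : ¬ IsK4 G S := by
  intro hK
  have h1 := hK.out_eq_zero hd (Finset.disjoint_singleton_right.2 hy)
  have h2 := (ecount_pos_iff G (X := S) (Y := {y})).2 ⟨x, hx, y, by simp, h⟩
  omega

/-- Deleting a vertex of degree three together with a neighbour of degree two. -/
theorem EConn.exists_reduction (hd : Subcubic G) {S : Finset V} (h : EConn G 2 S) {u v : V}
    (hu : u ∈ S) (hv : v ∈ S) (huv : G.Adj u v) (hdu : ecount G {u} S = 2)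
    (hdv : ecount G {v} S = 3) :
    ∃ R, S = insert v (insert u R) ∧ v ∉ R ∧ u ∉ R ∧ EConn G 1 R ∧
      excess G σ R ≤ excess G σ S ∧ ecount G {u} R = 1 ∧ ecount G {v} R = 2 := by
  have hne := huv.ne
  obtain ⟨R, hR⟩ : ∃ R, R = (S.erase v).erase u := ⟨_, rfl⟩
  have huR : u ∉ R := by simp [hR]
  have hvR : v ∉ R := by simp [hR]
  have hS : S = insert v (insert u R) := by
    rw [hR, Finset.insert_erase (by simp [hu, hne]), Finset.insert_erase hv]
  have hvuR : v ∉ insert u R := by simp [hvR, hne.symm]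
  rw [hS, ecount_insert_right G hvuR, ecount_insert_right G huR] at hdu hdv
  simp only [ecount_singleton_singleton, adjW_of_adj huv, adjW_of_adj huv.symm,
    adjW_of_not_adj (G.irrefl)] at hdu hdv
  have hRne : R.Nonempty := by
    rw [Finset.nonempty_iff_ne_empty]
    rintro rfl
    simp [ecount, wsum] at hdu
  have h1 := (hS ▸ h).of_insert hd hvuR (Finset.insert_nonempty _ _)
  have h2 := h1.of_insert_pendant huR hRne (by omega)
  refine ⟨R, hS, hvR, huR, h2, ?_, by omega, by omega⟩
  have e1 := esize_insert G hvuR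
  have e2 := esize_insert G huR
  have e3 := minNeg_insert_le G σ hvuR
  have e4 := minNeg_insert_le G σ huR
  rw [ecount_insert_right G huR, ecount_singleton_singleton, adjW_of_adj huv] at e1 e3
  unfold excess
  rw [hS]
  omega

theorem IsTri.exists_of_mem {B : Finset V} (h : IsTri G B) {z : V} (hz : z ∈ B) :
    ∃ p q, G.Adj z p ∧ G.Adj z q ∧ G.Adj p q ∧ B = {z, p, q} := by
  obtain ⟨a, b, c, hab, hac, hbc, rfl⟩ := h
  simp only [Finset.mem_insert, Finset.mem_singleton] at hz
  rcases hz with rfl | rfl | rfl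
  · exact ⟨b, c, hab, hac, hbc, rfl⟩
  · exact ⟨a, c, hab.symm, hbc, hac, Finset.insert_comm _ _ _⟩
  · exact ⟨a, b, hac.symm, hbc.symm, hab, by rw [Finset.pair_comm b, Finset.insert_comm]⟩

theorem GoodBelow.of_degree_two_three {S : Finset V} (hG : GoodBelow G σ S.card) (hd : Subcubic G)
    (h : EConn G 2 S) {u v : V} (hu : u ∈ S) (hv : v ∈ S) (huv : G.Adj u v)
    (hdu : ecount G {u} S = 2) (hdv : ecount G {v} S = 3) : Good G σ S := by
  have step : ∀ v ∈ S, G.Adj u v → ecount G {v} S = 3 → ∃ R, S = insert v (insert u R) ∧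
      v ∉ R ∧ u ∉ R ∧ EConn G 1 R ∧ excess G σ R ≤ excess G σ S ∧
      -1 ≤ excess G σ R ∧ (∃ z ∈ R, G.Adj u z) ∧ (excess G σ R = -1 → ∀ z ∈ R, ∃ B ⊆ R, z ∈ B ∧
        EConn G 2 B ∧ IsTri G B ∧ ∀ r ∈ R, r ∉ B → ecount G {r} B ≤ 1) := by
    intro v hv huv hdv
    obtain ⟨R, hS, hvR, huR, hR, ht, huR1, -⟩ :=
      h.exists_reduction (σ := σ) hd hu hv huv hdu hdv
    obtain ⟨z, hz, huz, -⟩ := exists_adj_of_card_lt G (A := ∅) (S := R) (v := u) (by simp [huR1])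
    have hK : ¬ IsK4 G R := not_isK4_of_adj hd hz huR huz.symm
    have hcard : R.card < S.card := by
      rw [hS, Finset.card_insert_of_notMem (by simp [hvR, huv.ne']),
        Finset.card_insert_of_notMem huR]
      omega
    refine ⟨R, hS, hvR, huR, hR, ht, hG.neg_one_le hd hcard hR hK, ⟨z, hz, huz⟩,
      fun htR z hz => ?_⟩
    obtain ⟨B, hBR, hzB, hB2, -, hBT, hBm⟩ := hG.exists_block hd hcard hR hK htR hz
    have hBS : B ⊆ S := hBR.trans (hS ▸ (Finset.subset_insert _ _).trans
      (Finset.subset_insert _ _))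
    refine ⟨B, hBR, hzB, hB2, hBT.resolve_right fun hsub => ?_, fun r hr hrB => ?_⟩
    · have := hsub.eq_of_subset hd hBS h
      exact huR (hBR (this ▸ hu))
    · by_contra hlt
      exact hrB (hBm _ (Finset.insert_subset hr hBR) (hB2.insert_vertex hrB (by omega))
        (Finset.mem_insert_of_mem hzB) (Finset.mem_insert_self _ _))
  obtain ⟨R, hS, hvR, huR, hR, ht, ht1, ⟨z, hz, huz⟩, hblock⟩ := step v hv huv hdv
  by_cases ht0 : 0 ≤ excess G σ S
  · exact Or.inl ht0
  have htS : excess G σ S = -1 := by omega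
  obtain ⟨B, hBR, hzB, -, hBT, hBr⟩ := hblock (by omega) z hz
  have hRS : R ⊆ S := hS ▸ (Finset.subset_insert _ _).trans (Finset.subset_insert _ _)
  obtain ⟨p, q, hzp, hzq, hpq, rfl⟩ := hBT.exists_of_mem hzB
  have hpR : p ∈ R := hBR (by simp)
  have hqR : q ∈ R := hBR (by simp)
  have hup : u ≠ p := fun h => huR (h ▸ hpR)
  have huq : u ≠ q := fun h => huR (h ▸ hqR)
  have hdz : ecount G {z} S = 3 := by
    refine le_antisymm (hd _ _) ?_
    have h1 : ({u, p, q} : Finset V).card = 3 := by simp [hup, huq, hpq.ne]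
    rw [← h1]
    refine card_le_ecount G ?_ ?_
    · intro x; simp only [Finset.mem_insert, Finset.mem_singleton]
      rintro (rfl | rfl | rfl)
      exacts [hu, hRS hpR, hRS hqR]
    · intro x; simp only [Finset.mem_insert, Finset.mem_singleton]
      rintro (rfl | rfl | rfl)
      exacts [huz.symm, hzp, hzq]
  obtain ⟨R', hS', hzR', huR', hR', ht', ht1', -, hblock'⟩ := step z (hRS hz) huz hdz
  have hpR' : p ∈ R' := by
    have := hRS hpR
    rw [hS'] at this
    simpa [hup.symm, hzp.ne'] using this
  obtain ⟨B', hB'R, hpB', -, hBT', hBr'⟩ := hblock' (by omega) p hpR'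
  obtain ⟨a, b, hpa, hpb, hab, rfl⟩ := hBT'.exists_of_mem hpB'
  have main : ∀ b, G.Adj p b → b ∈ R' → G.Adj q b → Good G σ S := by
    intro b hpb hbR' hqb
    by_cases hbv : b = v
    · subst hbv
      have hsub : IsSubK4 G {p, z, b, q, u} :=
        ⟨p, z, b, q, u, hzp.symm, hpb, hpq, hzq, hqb.symm, huz.symm, huv.symm,
          fun h => hvR (h ▸ hz), hup.symm, huq.symm, rfl⟩
      have hss : ({p, z, b, q, u} : Finset V) ⊆ S := by
        intro x; simp only [Finset.mem_insert, Finset.mem_singleton]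
        rintro (rfl | rfl | rfl | rfl | rfl)
        exacts [hRS hpR, hRS hz, hv, hRS hqR, hu]
      have := hsub.eq_of_subset hd hss h
      exact Or.inr (Or.inr ⟨htS, Or.inr (this ▸ hsub)⟩)
    · exfalso
      have hbz : b ≠ z := fun h => hzR' (h ▸ hbR')
      have hbR : b ∈ R := by
        have : b ∈ S := hS' ▸ by simp [hbR']
        rw [hS] at this
        have hbu : b ≠ u := fun h => huR' (h ▸ hbR')
        simpa [hbv, hbu] using this
      have h1 := hBr b hbR (by simp [hbz, hpb.ne', hqb.ne'])
      have h2 := card_le_ecount G (v := b) (A := {p, q}) (S := {z, p, q}) (by simp)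
        (by simp [hpb.symm, hqb.symm])
      rw [Finset.card_pair hpq.ne] at h2
      omega
  have haz : a ≠ z := fun h => hzR' (h ▸ hB'R (by simp))
  have hbz : b ≠ z := fun h => hzR' (h ▸ hB'R (by simp))
  by_cases haq : a = q
  · subst haq
    exact main b hpb (hB'R (by simp)) hab
  by_cases hbq : b = q
  · subst hbq
    exact main a hpa (hB'R (by simp)) hab.symm
  exact (adj_four_false hd hzp.symm hpq hpa hpb hzq.ne haz.symm hbz.symm (Ne.symm haq)
    (Ne.symm hbq) hab.ne).elim

theorem minNeg_isTri_le {S : Finset V} (h : IsTri G S) : minNeg G σ S ≤ 1 := by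
  obtain ⟨a, b, c, hab, hac, hbc, rfl⟩ := h
  have h1 := minNeg_insert_le G σ (v := a) (S := {b, c}) (by simp [hab.ne, hac.ne])
  have h2 := minNeg_insert_le G σ (v := b) (S := {c}) (by simp [hbc.ne])
  rw [minNeg_singleton, ecount_singleton_singleton, adjW_of_adj hbc] at h2
  rw [ecount_singleton_insert G _ (by simp [hbc.ne]), ecount_singleton_singleton,
    adjW_of_adj hab, adjW_of_adj hac] at h1
  omega

theorem GoodBelow.of_degree_two_two {S : Finset V} (hG : GoodBelow G σ S.card) (hd : Subcubic G)
    (h : EConn G 2 S) {u : V} (hu : u ∈ S) (hdu : ecount G {u} S = 2)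
    (hno : ∀ u ∈ S, ∀ v ∈ S, G.Adj u v → ecount G {u} S = 2 → ecount G {v} S = 2) :
    Good G σ S := by
  obtain ⟨v, hv, huv, -⟩ := exists_adj_of_card_lt G (A := ∅) (S := S) (v := u) (by simp [hdu])
  obtain ⟨z, hz, huz, hzv⟩ := exists_adj_of_card_lt G (A := {v}) (S := S) (v := u) (by simp [hdu])
  rw [Finset.mem_singleton] at hzv
  have hdv := hno u hu v hv huv hdu
  have hdz := hno u hu z hz huz hdu
  obtain ⟨R, hR⟩ : ∃ R, R = S \ {u, v, z} := ⟨_, rfl⟩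
  have huR : u ∉ R := by simp [hR]
  have hvR : v ∉ R := by simp [hR]
  have hzR : z ∉ R := by simp [hR]
  have hvzR : v ∉ insert z R := by simp [hvR, Ne.symm hzv]
  have huvzR : u ∉ insert v (insert z R) := by simp [huR, huv.ne, huz.ne]
  have hS : S = insert u (insert v (insert z R)) := by
    ext x
    simp only [hR, Finset.mem_insert, Finset.mem_sdiff, Finset.mem_singleton]
    constructor
    · tauto
    · rintro (rfl | rfl | rfl | h)
      exacts [hu, hv, hz, h.1]
  by_cases hzv' : G.Adj v z
  · have hT : IsTri G {u, v, z} := ⟨u, v, z, huv, huz, hzv', rfl⟩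
    have hTS : ({u, v, z} : Finset V) ⊆ S := by
      intro x; simp only [Finset.mem_insert, Finset.mem_singleton]
      rintro (rfl | rfl | rfl) <;> assumption
    have hTe : ({u, v, z} : Finset V) = S := by
      by_contra hne
      have h1 := h.two_le_sdiff hTS ⟨u, by simp⟩ hne
      have h2 := ecount_union_right G (Finset.disjoint_sdiff (s := {u, v, z}) (t := S)) {u, v, z}
      rw [Finset.union_sdiff_of_subset hTS, ecount_self, hT.esize,
        ecount_insert_left G (by simp [huv.ne, huz.ne]),
        ecount_insert_left G (by simp [Ne.symm hzv])] at h2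
      omega
    rw [hTe] at hT
    have h1 := minNeg_isTri_le (σ := σ) hT
    have h2 := hT.esize
    by_cases h0 : 0 ≤ excess G σ S
    · exact Or.inl h0
    · refine Or.inr (Or.inr ⟨?_, Or.inl hT⟩)
      unfold excess at *
      omega
  have hdv' := hdv
  rw [hS, ecount_insert_right G huvzR, ecount_insert_right G hvzR,
    ecount_insert_right G hzR] at hdu hdv hdz
  have hzv'' : ¬ G.Adj z v := fun h => hzv' h.symm
  simp only [ecount_singleton_singleton, adjW_of_adj huv, adjW_of_adj huz, adjW_of_adj huv.symm,
    adjW_of_adj huz.symm, adjW_of_not_adj (G.irrefl), adjW_of_not_adj hzv',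
    adjW_of_not_adj hzv''] at hdu hdv hdz
  obtain ⟨x, hx, hvx, -⟩ := exists_adj_of_card_lt G (A := ∅) (S := R) (v := v)
    (by simp only [Finset.card_empty]; omega)
  have h1 := (hS ▸ h).of_insert hd huvzR (Finset.insert_nonempty _ _)
  have hev : ecount G {v} (insert z R) = 1 := by
    rw [ecount_singleton_insert G _ hzR, adjW_of_not_adj hzv']
    omega
  have h2 := h1.of_insert_pendant hvzR (Finset.insert_nonempty _ _) hev.le
  have h3 := h2.of_insert_pendant hzR ⟨x, hx⟩ (by omega)
  have hK : ¬ IsK4 G R := not_isK4_of_adj hd hx hvR hvx.symm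
  have hcard : R.card < S.card := by
    rw [hS, Finset.card_insert_of_notMem huvzR, Finset.card_insert_of_notMem hvzR,
      Finset.card_insert_of_notMem hzR]
    omega
  have ht : excess G σ R ≤ excess G σ S := by
    have e1 := esize_insert G huvzR
    have e2 := esize_insert G hvzR
    have e3 := esize_insert G hzR
    have f1 := minNeg_insert_le G σ huvzR
    have f2 := minNeg_insert_le G σ hvzR
    have f3 := minNeg_insert_le G σ hzR
    rw [ecount_singleton_insert G _ hvzR, ecount_singleton_insert G _ hzR, adjW_of_adj huv,
      adjW_of_adj huz] at e1 f1
    unfold excess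
    rw [hS]
    omega
  have ht1 := hG.neg_one_le hd hcard h3 hK
  have ht2 : excess G σ R ≠ -1 := by
    intro htR
    obtain ⟨B, hBR, hxB, hB2, -, hBT, -⟩ := hG.exists_block hd hcard h3 hK htR hx
    have h4 := hB2.two_le_degree (two_le_card_of_block hBT) hxB
    have hvB : v ∉ B := fun h => hvR (hBR h)
    have hRS : R ⊆ S := hR ▸ Finset.sdiff_subset
    have h5 := hno v hv x (hRS hx) hvx hdv'
    have h6 := ecount_mono G (subset_refl {x}) (Finset.insert_subset hv (hBR.trans hRS))
    rw [ecount_singleton_insert G _ hvB, adjW_of_adj hvx.symm] at h6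
    omega
  exact Or.inl (by omega)

theorem IsK4.exists_isTri {S : Finset V} (h : IsK4 G S) : ∃ T ⊆ S, IsTri G T := by
  obtain ⟨a, b, c, d, hab, hac, had, hbc, hbd, hcd, rfl⟩ := h
  exact ⟨{b, c, d}, Finset.subset_insert _ _, b, c, d, hbc, hbd, hcd, rfl⟩

theorem GoodBelow.of_triangle_free {n : ℕ} (hG : GoodBelow G σ n) (hd : Subcubic G)
    {S : Finset V} (hS : S.card < n) (h : EConn G 1 S) (hT : ∀ T ⊆ S, ¬ IsTri G T) :
    0 ≤ excess G σ S ∧ (excess G σ S = 0 → EConn G 2 S) := by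
  have nonneg : ∀ X : Finset V, X ⊆ S → EConn G 1 X → 0 ≤ excess G σ X := by
    intro X hXS hX
    have hXc := Finset.card_le_card hXS
    have hK : ¬ IsK4 G X := fun hK => by
      obtain ⟨T, hTX, hT'⟩ := hK.exists_isTri
      exact hT T (hTX.trans hXS) hT'
    have h1 := hG.neg_one_le hd (by omega) hX hK
    by_contra hlt
    obtain ⟨v, hv⟩ := hX.1
    obtain ⟨B, hBX, -, -, -, hB | hB, -⟩ :=
      hG.exists_block hd (by omega) hX hK (by omega) hv
    · exact hT B (hBX.trans hXS) hB
    · obtain ⟨T, hTB, hT'⟩ := hB.exists_isTri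
      exact hT T (hTB.trans (hBX.trans hXS)) hT'
  refine ⟨nonneg S subset_rfl h, fun h0 => ?_⟩
  by_contra h2
  obtain ⟨X, Y, hXY, rfl, hX, hY, he, -, -⟩ := h.split h2
  have h3 := nonneg X Finset.subset_union_left hX
  have h4 := nonneg Y Finset.subset_union_right hY
  rw [excess_union G σ hXY he.le] at h0
  omega

theorem ecount_le_card (v : V) (S : Finset V) : ecount G {v} S ≤ S.card := by
  rw [ecount_singleton]
  exact Finset.card_filter_le _ _

theorem EConn.forall_degree_two {S : Finset V} (h : EConn G 1 S) {u : V} (hu : u ∈ S)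
    (hdu : ecount G {u} S = 2)
    (hno : ∀ u ∈ S, ∀ v ∈ S, G.Adj u v → ecount G {u} S = 2 → ecount G {v} S = 2) :
    ∀ v ∈ S, ecount G {v} S = 2 := by
  by_contra hcon
  push Not at hcon
  obtain ⟨v, hv, hdv⟩ := hcon
  have h1 := h.2 (S.filter fun x => ecount G {x} S = 2) (S.filter fun x => ¬ ecount G {x} S = 2)
    ⟨u, by simp [*]⟩ ⟨v, by simp [*]⟩ (Finset.disjoint_filter_filter_not _ _ _)
    (Finset.filter_union_filter_not_eq _ _)
  obtain ⟨x, hx, y, hy, hxy⟩ := (ecount_pos_iff G).1 h1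
  rw [Finset.mem_filter] at hx hy
  exact hy.2 (hno x hx.1 y hy.1 hxy hx.2)

theorem GoodBelow.even_card {n : ℕ} (hG : GoodBelow G σ n) (hd : Subcubic G)
    {S : Finset V} (hS : S.card < n) (h : EConn G 2 S) (hT : ∀ T ⊆ S, ¬ IsTri G T)
    (ht : excess G σ S = 0) {u : V} (hu : u ∈ S) (hdu : ecount G {u} S = 2) : Even S.card := by
  induction hk : S.card using Nat.strong_induction_on generalizing S u with
  | _ k ih =>
  subst hk
  have hc : 2 ≤ S.card := hdu ▸ ecount_le_card u S
  by_cases hno : ∀ u ∈ S, ∀ v ∈ S, G.Adj u v → ecount G {u} S = 2 → ecount G {v} S = 2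
  · have h1 := (h.mono one_le_two).forall_degree_two hu hdu hno
    have h2 := ecount_self G S
    rw [ecount_sum, Finset.sum_congr rfl h1, Finset.sum_const, smul_eq_mul] at h2
    unfold excess at ht
    exact ⟨2 * minNeg G σ S, by omega⟩
  · push Not at hno
    obtain ⟨u, hu, v, hv, huv, hdu, hdv⟩ := hno
    have hdv : ecount G {v} S = 3 := by
      have h1 := hd v S
      have h2 := h.two_le_degree hc hv
      omega
    obtain ⟨R, hSR, hvR, huR, hR, htR, huR1, hvR2⟩ :=
      h.exists_reduction (σ := σ) hd hu hv huv hdu hdv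
    have hcard : S.card = R.card + 2 := by
      rw [hSR, Finset.card_insert_of_notMem (by simp [hvR, huv.ne']),
        Finset.card_insert_of_notMem huR]
    have hRS : R ⊆ S := hSR ▸ (Finset.subset_insert _ _).trans (Finset.subset_insert _ _)
    have hTR : ∀ T ⊆ R, ¬ IsTri G T := fun T hTR => hT T (hTR.trans hRS)
    obtain ⟨h1, h2⟩ := hG.of_triangle_free hd (by omega) hR hTR
    have htR0 : excess G σ R = 0 := by omega
    obtain ⟨z, hz, huz, -⟩ := exists_adj_of_card_lt G (A := ∅) (S := R) (v := u) (by simp [huR1])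
    have hRc : 2 ≤ R.card := hvR2 ▸ ecount_le_card v R
    have hz2 := (h2 htR0).two_le_degree hRc hz
    have hz3 := hd z (insert u R)
    rw [ecount_singleton_insert G _ huR, adjW_of_adj huz.symm] at hz3
    have := ih R.card (by omega) (by omega) (h2 htR0) hTR htR0 hz (by omega) rfl
    rw [hcard]
    exact this.add even_two

theorem out_eq {S Q : Finset V} (hcub : ∀ v ∈ S, ecount G {v} S = 3) (hQ : Q ⊆ S) :
    ecount G Q (S \ Q) + 2 * esize G Q = 3 * Q.card := by
  rw [← ecount_self, add_comm, ← ecount_union_right G Finset.disjoint_sdiff,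
    Finset.union_sdiff_of_subset hQ, ecount_sum, Finset.sum_congr rfl fun v hv => hcub v (hQ hv)]
  simp [mul_comm]

theorem GoodBelow.four_le_out {S : Finset V} (hG : GoodBelow G σ S.card) (hd : Subcubic G)
    (h : EConn G 2 S) (hcub : ∀ v ∈ S, ecount G {v} S = 3) {Q : Finset V} (hQS : Q ⊆ S)
    (hne : Q ≠ S) (hQ : EConn G 1 Q) (ht : excess G σ Q = -1) :
    IsTri G Q ∨ 4 ≤ ecount G Q (S \ Q) := by
  induction hk : Q.card using Nat.strong_induction_on generalizing Q with
  | _ k ih =>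
  have hout : ∀ X : Finset V, X ⊆ S → X.Nonempty → X ≠ S → ¬ IsK4 G X := by
    intro X hX hX0 hXS hK
    have h1 := hK.out_eq_zero hd (Finset.disjoint_sdiff (t := S))
    have h2 := h.two_le_sdiff hX hX0 hXS
    omega
  have hlt : ∀ X : Finset V, X ⊆ S → X ≠ S → X.card < S.card := fun X hX hXS =>
    Finset.card_lt_card (hX.ssubset_of_ne hXS)
  by_cases h2 : EConn G 2 Q
  · rcases hG Q (hlt Q hQS hne) h2 with h' | h' | ⟨-, h' | h'⟩
    · omega
    · exact absurd h' (hout Q hQS hQ.1 hne)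
    · exact Or.inl h'
    · exact absurd (h'.eq_of_subset hd hQS h) hne
  · right
    obtain ⟨X, Y, hXY, rfl, hX, hY, he, hXc, hYc⟩ := hQ.split h2
    have hQc := hlt _ hQS hne
    have hXS := Finset.union_subset_left hQS
    have hYS := Finset.union_subset_right hQS
    have hXne : X ≠ S := by rintro rfl; omega
    have hYne : Y ≠ S := by rintro rfl; omega
    have h1 := hG.neg_one_le hd (hlt X hXS hXne) hX (hout X hXS hX.1 hXne)
    have h2 := hG.neg_one_le hd (hlt Y hYS hYne) hY (hout Y hYS hY.1 hYne)
    rw [excess_union G σ hXY he.le] at ht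
    have h3 := ih _ (hk ▸ hXc) hXS hXne hX (by omega) rfl
    have h4 := ih _ (hk ▸ hYc) hYS hYne hY (by omega) rfl
    have e1 := out_eq hcub hXS
    have e2 := out_eq hcub hYS
    have e3 := out_eq hcub hQS
    have e4 := esize_union G hXY
    rw [Finset.card_union_of_disjoint hXY] at e3
    have h3' : 3 ≤ ecount G X (S \ X) := by
      rcases h3 with h3 | h3
      · rw [h3.esize, h3.card] at e1
        omega
      · omega
    have h4' : 3 ≤ ecount G Y (S \ Y) := by
      rcases h4 with h4 | h4
      · rw [h4.esize, h4.card] at e2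
        omega
      · omega
    omega

theorem GoodBelow.erase_nonneg {S : Finset V} (hG : GoodBelow G σ S.card) (hd : Subcubic G)
    (h : EConn G 2 S) (hcub : ∀ v ∈ S, ecount G {v} S = 3) (hK : ¬ IsK4 G S) {v : V}
    (hv : v ∈ S) : EConn G 1 (S.erase v) ∧ 0 ≤ excess G σ (S.erase v) ∧
      excess G σ (S.erase v) ≤ excess G σ S + 1 := by
  obtain ⟨Q, hQ⟩ : ∃ Q, Q = S.erase v := ⟨_, rfl⟩
  have hvQ : v ∉ Q := by simp [hQ]
  have hS : S = insert v Q := by rw [hQ, Finset.insert_erase hv]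
  rw [← hQ]
  have hdv := hcub v hv
  rw [hS, ecount_insert_right G hvQ, ecount_singleton_self, zero_add] at hdv
  obtain ⟨x, hx, hvx, -⟩ := exists_adj_of_card_lt G (A := ∅) (S := Q) (v := v) (by simp [hdv])
  have hQ1 : EConn G 1 Q := (hS ▸ h).of_insert hd hvQ ⟨x, hx⟩
  have hQS : Q ⊆ S := hS ▸ Finset.subset_insert _ _
  have hne : Q ≠ S := fun h => hvQ (h ▸ hv)
  have h1 := hG.neg_one_le hd (Finset.card_lt_card (hQS.ssubset_of_ne hne)) hQ1
    (not_isK4_of_adj hd hx hvQ hvx.symm)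
  have e1 := esize_insert G hvQ
  have e2 := minNeg_insert_le G σ hvQ
  refine ⟨hQ1, ?_, by unfold excess; rw [hS]; omega⟩
  by_contra hlt
  rcases hG.four_le_out hd h hcub hQS hne hQ1 (by omega) with hT | h4
  · obtain ⟨a, b, c, hab, hac, hbc, rfl⟩ := hT
    have hall : ({a, b, c} : Finset V).filter (G.Adj v) = {a, b, c} :=
      Finset.eq_of_subset_of_card_le (Finset.filter_subset _ _) (by
        rw [← ecount_singleton, hdv]
        exact Finset.card_le_three)
    have hadj : ∀ y ∈ ({a, b, c} : Finset V), G.Adj v y := fun y hy => by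
      rw [← hall] at hy
      exact (Finset.mem_filter.1 hy).2
    exact hK ⟨v, a, b, c, hadj a (by simp), hadj b (by simp), hadj c (by simp), hab, hac, hbc, hS⟩
  · have : S \ Q = {v} := by
      rw [hS, Finset.insert_sdiff_of_notMem _ hvQ, Finset.sdiff_self, insert_empty_eq]
    rw [this, ecount_comm] at h4
    omega

theorem GoodBelow.of_cubic_triangle_free {S : Finset V} (hG : GoodBelow G σ S.card)
    (hd : Subcubic G) (h : EConn G 2 S) (hcub : ∀ v ∈ S, ecount G {v} S = 3)
    (hT : ∀ T ⊆ S, ¬ IsTri G T) : 0 ≤ excess G σ S := by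
  have hK : ¬ IsK4 G S := fun hK => by
    obtain ⟨T, hTS, hT'⟩ := hK.exists_isTri
    exact hT T hTS hT'
  by_contra hlt
  obtain ⟨v, hv⟩ := h.1
  obtain ⟨h1, h2, h3⟩ := hG.erase_nonneg hd h hcub hK hv
  have hTQ : ∀ T ⊆ S.erase v, ¬ IsTri G T := fun T hTQ => hT T (hTQ.trans (Finset.erase_subset _ _))
  have hc := Finset.card_erase_add_one hv
  have h4 := (hG.of_triangle_free hd (by omega) h1 hTQ).2 (by omega)
  obtain ⟨u, hu, hvu, -⟩ := exists_adj_of_card_lt G (A := ∅) (S := S) (v := v)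
    (by simp [hcub v hv])
  have hdu := hcub u hu
  rw [← Finset.insert_erase hv, ecount_singleton_insert G _ (Finset.notMem_erase v S),
    adjW_of_adj hvu.symm] at hdu
  obtain ⟨m, hm⟩ := hG.even_card hd (by omega) h4 hTQ (by omega)
    (Finset.mem_erase.2 ⟨hvu.ne', hu⟩) (by omega)
  have h5 := out_eq hcub (subset_refl S)
  rw [Finset.sdiff_self] at h5
  have h6 : ecount G S ∅ = 0 := by simp [ecount, wsum]
  omega

theorem excess_sdiff_le {S : Finset V} (hcub : ∀ v ∈ S, ecount G {v} S = 3)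
    {x y z y' : V} (hx : x ∈ S) (hy : y ∈ S) (hz : z ∈ S) (hy' : y' ∈ S) (hxy : G.Adj x y)
    (hxz : G.Adj x z) (hyz : G.Adj y z) (hyy' : G.Adj y y') (hxy' : x ≠ y') (hzy' : z ≠ y')
    (nx : ¬ G.Adj x y') (nz : ¬ G.Adj z y') :
    excess G σ (S \ {y', x, y, z}) ≤ excess G σ S ∧
      ecount G (S \ {y', x, y, z}) {y', x, y, z} = 4 := by
  obtain ⟨Q, hQ⟩ : ∃ Q, Q = S \ {y', x, y, z} := ⟨_, rfl⟩
  have hS : S = insert y' (insert x (insert y (insert z Q))) := by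
    have hPS : ({y', x, y, z} : Finset V) ⊆ S := by
      intro a
      simp only [Finset.mem_insert, Finset.mem_singleton]
      rintro (rfl | rfl | rfl | rfl) <;> assumption
    rw [← Finset.union_sdiff_of_subset hPS, ← hQ]
    simp [Finset.insert_union]
  have hnQ : y' ∉ Q ∧ x ∉ Q ∧ y ∉ Q ∧ z ∉ Q := by simp [hQ]
  rw [← hQ]
  obtain ⟨hy'Q, hxQ, hyQ, n1⟩ := hnQ
  have ey' := hcub y' hy'
  have ex := hcub x hx
  have ey := hcub y hy
  have ez := hcub z hz
  have n2 : y ∉ insert z Q := by simp [hyQ, hyz.ne]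
  have n3 : x ∉ insert y (insert z Q) := by simp [hxQ, hxy.ne, hxz.ne]
  have n4 : y' ∉ insert x (insert y (insert z Q)) := by
    simp [hy'Q, hxy'.symm, hyy'.ne', hzy'.symm]
  have nx' : ¬ G.Adj y' x := fun h => nx h.symm
  have nz' : ¬ G.Adj y' z := fun h => nz h.symm
  have self : ∀ a : V, adjW G a a = 0 := fun a => adjW_of_not_adj G.irrefl
  rw [hS] at ey' ex ey ez
  simp only [ecount_singleton_insert G _ n4, ecount_singleton_insert G _ n3,
    ecount_singleton_insert G _ n2, ecount_singleton_insert G _ n1, self,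
    adjW_of_adj hxy, adjW_of_adj hxy.symm, adjW_of_adj hxz, adjW_of_adj hxz.symm,
    adjW_of_adj hyz, adjW_of_adj hyz.symm, adjW_of_adj hyy', adjW_of_adj hyy'.symm,
    adjW_of_not_adj nx, adjW_of_not_adj nz, adjW_of_not_adj nx', adjW_of_not_adj nz']
    at ey' ex ey ez
  have s1 := esize_insert G n1
  have s2 := esize_insert G n2
  have s3 := esize_insert G n3
  have s4 := esize_insert G n4
  have f1 := minNeg_insert_le G σ n1
  have f2 := minNeg_insert_le G σ n2
  have f3 := minNeg_insert_le G σ n3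
  have f4 := minNeg_insert_le G σ n4
  simp only [ecount_singleton_insert G _ n3,
    ecount_singleton_insert G _ n2, ecount_singleton_insert G _ n1,
    adjW_of_adj hxy, adjW_of_adj hxz, adjW_of_adj hyz, adjW_of_adj hyy'.symm,
    adjW_of_not_adj nx', adjW_of_not_adj nz'] at s1 s2 s3 s4 f1 f2 f3 f4
  constructor
  · unfold excess
    rw [hS]
    omega
  · rw [ecount_insert_right G (by simp [hxy'.symm, hyy'.ne', hzy'.symm]),
      ecount_insert_right G (by simp [hxy.ne, hxz.ne]), ecount_insert_right G (by simp [hyz.ne]),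
      ecount_comm G Q]
    omega

theorem EConn.not_isK4_of_subset (hd : Subcubic G) {S A : Finset V} (h : EConn G 2 S)
    (hA : A ⊆ S) (hA0 : A.Nonempty) (hne : A ≠ S) : ¬ IsK4 G A := by
  intro hK
  have h1 := hK.out_eq_zero hd (Finset.disjoint_sdiff (t := S))
  have h2 := h.two_le_sdiff hA hA0 hne
  omega

theorem ecount_sdiff_of_component {S Q A : Finset V} (hQS : Q ⊆ S) (hAQ : A ⊆ Q)
    (h0 : ecount G A (Q \ A) = 0) : ecount G A (S \ A) = ecount G A (S \ Q) := by
  have h1 : S \ A = (S \ Q) ∪ (Q \ A) := (Finset.sdiff_union_sdiff_cancel hQS hAQ).symm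
  rw [h1, ecount_union_right G (Finset.disjoint_sdiff.symm.mono_right Finset.sdiff_subset), h0,
    add_zero]

/-- A set with four outgoing edges and negative excess is connected. -/
theorem GoodBelow.econn_of_out_eq_four {S : Finset V} (hG : GoodBelow G σ S.card) (hd : Subcubic G)
    (h : EConn G 2 S) (hcub : ∀ v ∈ S, ecount G {v} S = 3) {Q : Finset V} (hQS : Q ⊆ S)
    (hne : Q ≠ S) (hQ0 : Q.Nonempty) (hout : ecount G Q (S \ Q) = 4)
    (ht : excess G σ Q < 0) : EConn G 1 Q := by
  have two_le : ∀ A ⊆ Q, A.Nonempty → ecount G A (Q \ A) = 0 → 2 ≤ ecount G A (S \ Q) := by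
    intro A hA hA0 h0
    rw [← ecount_sdiff_of_component hQS hA h0]
    refine h.two_le_sdiff (hA.trans hQS) hA0 ?_
    rintro rfl
    exact hne (hQS.antisymm hA)
  have nonneg : ∀ A ⊆ Q, A.Nonempty → ecount G A (Q \ A) = 0 → ecount G A (S \ Q) = 2 →
      0 ≤ excess G σ A := by
    intro A hA hA0 h0 hA2
    have hAS : A ≠ S := by
      rintro rfl
      exact hne (hQS.antisymm hA)
    have hlt : A.card < S.card := Finset.card_lt_card ((hA.trans hQS).ssubset_of_ne hAS)
    have hAc : EConn G 1 A := by
      refine ⟨hA0, fun X Y hX hY hXY hXYA => ?_⟩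
      by_contra hcon
      have hQA : Disjoint A (Q \ A) := Finset.disjoint_sdiff
      have sub : ∀ X Y : Finset V, X.Nonempty → Disjoint X Y → X ∪ Y = A → ecount G X Y = 0 →
          2 ≤ ecount G X (S \ Q) := by
        intro X Y hX hXY hXYA he
        have hXA : X ⊆ A := hXYA ▸ Finset.subset_union_left
        have hYA : Y ⊆ A := hXYA ▸ Finset.subset_union_right
        refine two_le X (hXA.trans hA) hX ?_
        have h1 : Q \ X = (Q \ A) ∪ (A \ X) := (Finset.sdiff_union_sdiff_cancel hA hXA).symm
        have m1 := ecount_mono G hXA (subset_refl (Q \ A))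
        rw [h1, ecount_union_right G (hQA.symm.mono_right Finset.sdiff_subset), ← hXYA,
          Finset.union_sdiff_cancel_left hXY, hXYA]
        omega
      have h1 := sub X Y hX hXY hXYA (by omega)
      have h2 := sub Y X hY hXY.symm (by rw [Finset.union_comm, hXYA]) (by rw [ecount_comm]; omega)
      rw [← hXYA, ecount_union_left G hXY] at hA2
      omega
    have h3 := hG.neg_one_le hd hlt hAc (h.not_isK4_of_subset hd (hA.trans hQS) hA0 hAS)
    by_contra hcon
    have h4 := ecount_sdiff_of_component hQS hA h0
    rcases hG.four_le_out hd h hcub (hA.trans hQS) hAS hAc (by omega) with h5 | h5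
    · have h6 := out_eq hcub (hA.trans hQS)
      rw [h5.esize, h5.card] at h6
      omega
    · omega
  refine ⟨hQ0, fun X Y hX hY hXY hXYQ => ?_⟩
  by_contra hcon
  have hXQ : X ⊆ Q := hXYQ ▸ Finset.subset_union_left
  have hYQ : Y ⊆ Q := hXYQ ▸ Finset.subset_union_right
  have c1 : ecount G X (Q \ X) = 0 := by
    rw [← hXYQ, Finset.union_sdiff_cancel_left hXY]; omega
  have c2 : ecount G Y (Q \ Y) = 0 := by
    rw [← hXYQ, Finset.union_sdiff_cancel_right hXY, ecount_comm]; omega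
  have h1 := two_le X hXQ hX c1
  have h2 := two_le Y hYQ hY c2
  have h3 := ecount_union_left G hXY (S \ Q)
  rw [hXYQ] at h3
  have h4 := nonneg X hXQ hX c1 (by omega)
  have h5 := nonneg Y hYQ hY c2 (by omega)
  rw [← hXYQ, excess_union G σ hXY (by omega)] at ht
  omega

theorem exists_isTri_avoiding {S : Finset V} (hG : GoodBelow G σ S.card) (hd : Subcubic G)
    (h : EConn G 2 S) (hcub : ∀ v ∈ S, ecount G {v} S = 3) (ht : excess G σ S = -1)
    {x y z y' : V} (hx : x ∈ S) (hy : y ∈ S) (hz : z ∈ S) (hy' : y' ∈ S) (hxy : G.Adj x y)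
    (hxz : G.Adj x z) (hyz : G.Adj y z) (hyy' : G.Adj y y') (hxy' : x ≠ y') (hzy' : z ≠ y')
    (nx : ¬ G.Adj x y') (nz : ¬ G.Adj z y') {w : V} (hw : w ∈ S)
    (hwP : w ∉ ({y', x, y, z} : Finset V)) :
    ∃ p q, G.Adj w p ∧ G.Adj w q ∧ G.Adj p q ∧ p ∉ ({y', x, y, z} : Finset V) ∧
      q ∉ ({y', x, y, z} : Finset V) := by
  obtain ⟨hle, hout⟩ := excess_sdiff_le (σ := σ) hcub hx hy hz hy' hxy hxz hyz hyy' hxy' hzy' nx nz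
  have hPS : ({y', x, y, z} : Finset V) ⊆ S := by
    intro a
    simp only [Finset.mem_insert, Finset.mem_singleton]
    rintro (rfl | rfl | rfl | rfl) <;> assumption
  have hxP : x ∈ ({y', x, y, z} : Finset V) := by simp
  generalize ({y', x, y, z} : Finset V) = P at *
  obtain ⟨Q, hQ⟩ : ∃ Q, Q = S \ P := ⟨_, rfl⟩
  have hwQ : w ∈ Q := by simp [hQ, hw, hwP]
  have hQS : Q ⊆ S := hQ ▸ Finset.sdiff_subset
  have hPQ : Disjoint Q P := hQ ▸ Finset.sdiff_disjoint
  have hproper : ∀ A ⊆ Q, A ≠ S := by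
    rintro A hA rfl
    exact Finset.disjoint_left.1 hPQ (hA hx) hxP
  have hlt : Q.card < S.card := Finset.card_lt_card (hQS.ssubset_of_ne (hproper Q subset_rfl))
  rw [← hQ] at hle hout
  have hQc := hG.econn_of_out_eq_four hd h hcub hQS (hproper Q subset_rfl) ⟨w, hwQ⟩
    (by rw [hQ, Finset.sdiff_sdiff_eq_self hPS, ← hQ, hout]) (by omega)
  have hQK := h.not_isK4_of_subset hd hQS ⟨w, hwQ⟩ (hproper Q subset_rfl)
  have hQ1 := hG.neg_one_le hd hlt hQc hQK
  obtain ⟨B, hBQ, hwB, -, -, hB | hB, -⟩ :=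
    hG.exists_block hd hlt hQc hQK (by omega) hwQ
  · obtain ⟨p, q, hwp, hwq, hpq, rfl⟩ := hB.exists_of_mem hwB
    have hp : p ∈ Q := hBQ (by simp)
    have hq : q ∈ Q := hBQ (by simp)
    exact ⟨p, q, hwp, hwq, hpq, Finset.disjoint_left.1 hPQ hp, Finset.disjoint_left.1 hPQ hq⟩
  · exact absurd (hB.eq_of_subset hd (hBQ.trans hQS) h) (hproper B hBQ)

theorem eq_of_diamond {S : Finset V} (hG : GoodBelow G σ S.card) (hd : Subcubic G)
    (h : EConn G 2 S) (hcub : ∀ v ∈ S, ecount G {v} S = 3) (hK : ¬ IsK4 G S)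
    (ht : excess G σ S = -1) {x z y w : V} (hx : x ∈ S) (hz : z ∈ S) (hy : y ∈ S) (hw : w ∈ S)
    (hxz : G.Adj x z) (hxy : G.Adj x y) (hzy : G.Adj z y) (hxw : G.Adj x w) (hzw : G.Adj z w) :
    y = w := by
  by_contra hyw
  by_cases hadj : G.Adj y w
  · have hK' : IsK4 G {x, z, y, w} := ⟨x, z, y, w, hxz, hxy, hxw, hzy, hzw, hadj, rfl⟩
    have hsub : ({x, z, y, w} : Finset V) ⊆ S := by
      intro a
      simp only [Finset.mem_insert, Finset.mem_singleton]
      rintro (rfl | rfl | rfl | rfl) <;> assumption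
    have hne : ({x, z, y, w} : Finset V) ≠ S := fun e => hK (e ▸ hK')
    have h1 := h.two_le_sdiff hsub (by simp) hne
    rw [hK'.out_eq_zero hd Finset.disjoint_sdiff] at h1
    omega
  obtain ⟨y', hy', hyy', hny'⟩ := exists_adj_of_card_lt G (A := {x, z}) (S := S) (v := y)
    (by rw [hcub y hy, Finset.card_pair hxz.ne]; omega)
  simp only [Finset.mem_insert, Finset.mem_singleton, not_or] at hny'
  have hwy' : w ≠ y' := by
    rintro rfl
    exact hadj hyy'
  obtain ⟨p, q, hwp, hwq, hpq, hp, hq⟩ := exists_isTri_avoiding hG hd h hcub ht hx hy hz hy' hxy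
    hxz hzy.symm hyy' (Ne.symm hny'.1) (Ne.symm hny'.2)
    (fun e => adj_four_false hd hxz hxy hxw e hzy.ne hzw.ne (Ne.symm hny'.2) hyw hyy'.ne hwy')
    (fun e => adj_four_false hd hxz.symm hzy hzw e hxy.ne hxw.ne (Ne.symm hny'.1) hyw hyy'.ne hwy')
    hw (by simp [hwy', hxw.ne', hzw.ne', Ne.symm hyw])
  simp only [Finset.mem_insert, Finset.mem_singleton, not_or] at hp hq
  exact adj_four_false hd hxw.symm hzw.symm hwp hwq hxz.ne (Ne.symm hp.2.1) (Ne.symm hq.2.1)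
    (Ne.symm hp.2.2.2) (Ne.symm hq.2.2.2) hpq.ne

theorem not_isTri_of_cubic {S : Finset V} (hG : GoodBelow G σ S.card) (hd : Subcubic G)
    (h : EConn G 2 S) (hcub : ∀ v ∈ S, ecount G {v} S = 3) (hK : ¬ IsK4 G S)
    (ht : excess G σ S = -1) {T : Finset V} (hTS : T ⊆ S) : ¬ IsTri G T := by
  rintro ⟨x, y, z, hxy, hxz, hyz, rfl⟩
  have hx : x ∈ S := hTS (by simp)
  have hy : y ∈ S := hTS (by simp)
  have hz : z ∈ S := hTS (by simp)
  have mem : ∀ v ∈ S, ∀ w, G.Adj v w → w ∈ S := by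
    intro v hv w hvw
    by_contra hw
    have h1 := hd v (insert w S)
    rw [ecount_singleton_insert G _ hw, adjW_of_adj hvw, hcub v hv] at h1
    omega
  have nd : ∀ {x z y w : V}, x ∈ S → G.Adj x z → G.Adj x y → G.Adj z y → G.Adj x w →
      G.Adj z w → y = w := fun hx hxz hxy hzy hxw hzw =>
    eq_of_diamond hG hd h hcub hK ht hx (mem _ hx _ hxz) (mem _ hx _ hxy) (mem _ hx _ hxw)
      hxz hxy hzy hxw hzw
  obtain ⟨y', hy', hyy', hny'⟩ := exists_adj_of_card_lt G (A := {x, z}) (S := S) (v := y)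
    (by rw [hcub y hy, Finset.card_pair hxz.ne]; omega)
  obtain ⟨z', hz', hzz', hnz'⟩ := exists_adj_of_card_lt G (A := {x, y}) (S := S) (v := z)
    (by rw [hcub z hz, Finset.card_pair hxy.ne]; omega)
  simp only [Finset.mem_insert, Finset.mem_singleton, not_or] at hny' hnz'
  have m1 := @exists_isTri_avoiding _ _ _ S hG hd h hcub ht x y z y' hx hy hz hy' hxy hxz hyz hyy'
    (Ne.symm hny'.1) (Ne.symm hny'.2) (fun e => hny'.2 (nd hx hxy hxz hyz e hyy').symm)
    (fun e => hny'.1 (nd hy hyz hxy.symm hxz.symm hyy' e).symm)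
  have m2 := @exists_isTri_avoiding _ _ _ S hG hd h hcub ht x z y z' hx hz hy hz' hxz hxy hyz.symm
    hzz' (Ne.symm hnz'.1) (Ne.symm hnz'.2) (fun e => hnz'.2 (nd hx hxz hxy hyz.symm e hzz').symm)
    (fun e => hnz'.1 (nd hy hyz hxy.symm hxz.symm e hzz').symm)
  have hyz' : y' ≠ z' := by
    rintro rfl
    exact hny'.1 (nd hy hyz hxy.symm hxz.symm hyy' hzz').symm
  obtain ⟨r, s, hyr, hys, hrs, hr, hs⟩ := m2 hy' (by simp [hyz', hny', hyy'.ne'])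
  simp only [Finset.mem_insert, Finset.mem_singleton, not_or] at hr hs
  have hrS := mem _ hy' _ hyr
  obtain ⟨a, b, hra, hrb, hab, ha, hb⟩ := m1 hrS (by simp [hr, hyr.ne'])
  simp only [Finset.mem_insert, Finset.mem_singleton, not_or] at ha hb
  by_cases hsa : s = a
  · subst hsa
    exact hb.1 (nd hrS hrs hrb hab hyr.symm hys.symm)
  by_cases hsb : s = b
  · subst hsb
    exact ha.1 (nd hrS hrs hra hab.symm hyr.symm hys.symm)
  exact adj_four_false hd hyr.symm hrs hra hrb hys.ne (Ne.symm ha.1) (Ne.symm hb.1) hsa hsb hab.ne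

theorem good_of_goodBelow {S : Finset V} (hG : GoodBelow G σ S.card) (hd : Subcubic G)
    (h : EConn G 2 S) : Good G σ S := by
  have hpos := Finset.card_pos.2 h.1
  by_cases hc : 2 ≤ S.card
  · by_cases h2 : ∃ u ∈ S, ecount G {u} S = 2
    · obtain ⟨u, hu, hdu⟩ := h2
      by_cases hno : ∀ u ∈ S, ∀ v ∈ S, G.Adj u v → ecount G {u} S = 2 → ecount G {v} S = 2
      · exact hG.of_degree_two_two hd h hu hdu hno
      · push Not at hno
        obtain ⟨u, hu, v, hv, huv, hdu, hdv⟩ := hno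
        have h3 := h.two_le_degree hc hv
        have h4 := hd v S
        exact hG.of_degree_two_three hd h hu hv huv hdu (by omega)
    · have hcub : ∀ v ∈ S, ecount G {v} S = 3 := by
        intro v hv
        have h3 := h.two_le_degree hc hv
        have h4 := hd v S
        have h5 : ecount G {v} S ≠ 2 := fun e => h2 ⟨v, hv, e⟩
        omega
      by_cases hK : IsK4 G S
      · exact Or.inr (Or.inl hK)
      left
      by_contra hlt
      obtain ⟨v, hv⟩ := h.1
      obtain ⟨-, h3, h4⟩ := hG.erase_nonneg hd h hcub hK hv
      exact hlt (hG.of_cubic_triangle_free hd h hcub fun T hT =>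
        not_isTri_of_cubic hG hd h hcub hK (by omega) hT)
  · obtain ⟨v, rfl⟩ := Finset.card_eq_one.1 (show S.card = 1 by omega)
    exact Or.inl (excess_singleton G σ v).ge

theorem EConn.good (hd : Subcubic G) {S : Finset V} (h : EConn G 2 S) : Good G σ S := by
  induction hk : S.card using Nat.strong_induction_on generalizing S with
  | _ k ih =>
    exact good_of_goodBelow (fun T hT hT2 => ih _ (hk ▸ hT) hT2 rfl) hd h

theorem goodBelow (hd : Subcubic G) (n : ℕ) : GoodBelow G σ n := fun _ _ h => h.good hd

/-- If all maximal 2-edge-connected subsets have negative excess, then so has the whole set. -/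
theorem EConn.excess_neg {S : Finset V} (h : EConn G 1 S)
    (hB : ∀ B ⊆ S, EConn G 2 B → (∀ Z ⊆ S, EConn G 2 Z → B ⊆ Z → Z ⊆ B) → excess G σ B < 0) :
    excess G σ S < 0 := by
  induction hk : S.card using Nat.strong_induction_on generalizing S with
  | _ k ih =>
  by_cases h2 : EConn G 2 S
  · exact hB S subset_rfl h2 fun Z hZ _ _ => hZ
  obtain ⟨X, Y, hXY, rfl, hX, hY, he, hXc, hYc⟩ := h.split h2
  have hlift : ∀ X' Y' : Finset V, Disjoint X' Y' → X' ∪ Y' = X ∪ Y → ecount G X' Y' ≤ 1 →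
      ∀ B ⊆ X', EConn G 2 B → (∀ Z ⊆ X', EConn G 2 Z → B ⊆ Z → Z ⊆ B) → excess G σ B < 0 := by
    intro X' Y' hd' hU he' B hBX hB2 hmax
    refine hB B (hBX.trans (hU ▸ Finset.subset_union_left)) hB2 fun Z hZ hZ2 hBZ => ?_
    obtain ⟨v, hv⟩ := hB2.1
    exact hmax Z (hZ2.subset_of_inter hd' hU he' hZ (hBZ hv) (hBX hv)) hZ2 hBZ
  have h3 := ih _ (hk ▸ hXc) hX (hlift X Y hXY rfl he.le) rfl
  have h4 := ih _ (hk ▸ hYc) hY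
    (hlift Y X hXY.symm (Finset.union_comm _ _) (by rw [ecount_comm]; exact he.le)) rfl
  rw [excess_union G σ hXY he.le]
  omega

theorem ecount_eq_card (X Y : Finset V) :
    ecount G X Y = ((X ×ˢ Y).filter fun p => G.Adj p.1 p.2).card := by
  rw [ecount, wsum, Finset.card_filter, Finset.sum_product]
  rfl

theorem two_le_ecount_iff {X Y : Finset V} : 2 ≤ ecount G X Y ↔
    ∃ x ∈ X, ∃ y ∈ Y, ∃ x' ∈ X, ∃ y' ∈ Y, G.Adj x y ∧ G.Adj x' y' ∧ (x, y) ≠ (x', y') := by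
  rw [ecount_eq_card, ← Nat.lt_iff_add_one_le, Finset.one_lt_card]
  constructor
  · rintro ⟨⟨x, y⟩, h, ⟨x', y'⟩, h', hne⟩
    simp only [Finset.mem_filter, Finset.mem_product] at h h'
    exact ⟨x, h.1.1, y, h.1.2, x', h'.1.1, y', h'.1.2, h.2, h'.2, hne⟩
  · rintro ⟨x, hx, y, hy, x', hx', y', hy', h, h', hne⟩
    exact ⟨(x, y), by simp [*], (x', y'), by simp [*], hne⟩

theorem EConn.not_isBridge {B : Finset V} (h : EConn G 2 B) {x y : V} (hx : x ∈ B) (hy : y ∈ B) :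
    ¬ G.IsBridge s(x, y) := by
  intro hb
  rw [SimpleGraph.isBridge_iff] at hb
  obtain ⟨a, ha, b, hb', a', ha', b', hb'', hab, hab', hne⟩ := two_le_ecount_iff.1
    (h.2 (B.filter fun z => (G.deleteEdges {s(x, y)}).Reachable x z)
      (B.filter fun z => ¬ (G.deleteEdges {s(x, y)}).Reachable x z)
      ⟨x, by simp [hx]⟩ ⟨y, by simp [hy, hb]⟩ (Finset.disjoint_filter_filter_not _ _ _)
      (Finset.filter_union_filter_not_eq _ _))
  have key : ∀ a b, (G.deleteEdges {s(x, y)}).Reachable x a →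
      ¬ (G.deleteEdges {s(x, y)}).Reachable x b → G.Adj a b → a = x ∧ b = y := by
    intro a b ha hb' hab
    by_contra hcon
    by_cases hs : s(a, b) = s(x, y)
    · rw [Sym2.eq_iff] at hs
      rcases hs with hs | ⟨rfl, rfl⟩
      · exact hcon hs
      · exact hb' (SimpleGraph.Reachable.refl _)
    · exact hb' (ha.trans (SimpleGraph.Adj.reachable
        (by rw [SimpleGraph.deleteEdges_adj]; exact ⟨hab, hs⟩)))
  rw [Finset.mem_filter] at ha hb' ha' hb''
  obtain ⟨rfl, rfl⟩ := key a b ha.2 hb'.2 hab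
  obtain ⟨rfl, rfl⟩ := key a' b' ha'.2 hb''.2 hab'
  exact hne rfl

/-- The graph without its bridges. -/
abbrev bridgeless (G : SimpleGraph V) : SimpleGraph V := G.deleteEdges {e | G.IsBridge e}

theorem bridgeless_adj {x y : V} : (bridgeless G).Adj x y ↔ G.Adj x y ∧ ¬ G.IsBridge s(x, y) := by
  rw [SimpleGraph.deleteEdges_adj, Set.mem_ofPred_eq]

theorem EConn.reachable {B : Finset V} (h : EConn G 2 B) {v w : V} (hv : v ∈ B) (hw : w ∈ B) :
    (bridgeless G).Reachable v w := by
  by_contra hcon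
  obtain ⟨x, hx, y, hy, hxy⟩ := (ecount_pos_iff G).1 ((h.mono one_le_two).2
    (B.filter fun z => (bridgeless G).Reachable v z)
    (B.filter fun z => ¬ (bridgeless G).Reachable v z)
    ⟨v, by simp [hv]⟩ ⟨w, by simp [hw, hcon]⟩ (Finset.disjoint_filter_filter_not _ _ _)
    (Finset.filter_union_filter_not_eq _ _))
  rw [Finset.mem_filter] at hx hy
  exact hy.2 (hx.2.trans (bridgeless_adj.2 ⟨hxy, h.not_isBridge hx.1 hy.1⟩).reachable)

/-- A non-bridge is not a bridge of the graph without bridges. -/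
theorem not_isBridge_bridgeless {x y : V} (h : (bridgeless G).Adj x y) :
    ¬ (bridgeless G).IsBridge s(x, y) := by
  rw [bridgeless_adj, SimpleGraph.isBridge_iff, not_not,
    SimpleGraph.adj_and_reachable_delete_edges_iff_exists_cycle] at h
  obtain ⟨u, p, hp, he⟩ := h
  have hE : ∀ e ∈ p.edges, e ∈ (bridgeless G).edgeSet := by
    intro e hep
    rw [SimpleGraph.edgeSet_deleteEdges]
    exact ⟨p.edges_subset_edgeSet hep, fun hb => hb.notMem_edges_of_isCycle hp hep⟩
  have h2 := SimpleGraph.adj_and_reachable_delete_edges_iff_exists_cycle.2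
    ⟨u, p.transfer _ hE, hp.transfer hE, by rwa [SimpleGraph.Walk.edges_transfer]⟩
  rw [SimpleGraph.isBridge_iff, not_not]
  exact h2.2

section Finite

variable [Fintype V]

/-- The block of a vertex. -/
noncomputable def block (G : SimpleGraph V) (v : V) : Finset V :=
  Finset.univ.filter fun w => (bridgeless G).Reachable v w

theorem mem_block {v w : V} : w ∈ block G v ↔ (bridgeless G).Reachable v w := by
  simp [block]

theorem self_mem_block (v : V) : v ∈ block G v := mem_block.2 (SimpleGraph.Reachable.refl _)

theorem econn_block (v : V) : EConn G 2 (block G v) := by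
  refine ⟨⟨v, self_mem_block v⟩, fun X Y hX hY hXY hXYB => ?_⟩
  have mem : ∀ a ∈ block G v, ∀ b, (bridgeless G).Adj a b → a ∈ X → b ∉ X → b ∈ Y := by
    intro a ha b hab _ hbX
    have : b ∈ block G v := mem_block.2 ((mem_block.1 ha).trans hab.reachable)
    rw [← hXYB, Finset.mem_union] at this
    exact this.resolve_left hbX
  obtain ⟨a, ha⟩ := hX
  obtain ⟨b, hb⟩ := hY
  have sub : ∀ c ∈ X, c ∈ block G v := fun c hc => hXYB ▸ Finset.mem_union_left _ hc
  have hbB : b ∈ block G v := hXYB ▸ Finset.mem_union_right _ hb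
  obtain ⟨p⟩ := (mem_block.1 (sub a ha)).symm.trans (mem_block.1 hbB)
  obtain ⟨⟨⟨x, y⟩, hxy⟩, -, hx, hy⟩ := p.exists_boundary_dart (X : Set V) ha
    (Finset.disjoint_right.1 hXY hb)
  have hyY := mem x (sub x hx) y hxy hx hy
  have hnb := not_isBridge_bridgeless hxy
  rw [SimpleGraph.isBridge_iff, not_not] at hnb
  obtain ⟨q⟩ := hnb
  obtain ⟨⟨⟨x', y'⟩, hxy'⟩, -, hx', hy'⟩ := q.exists_boundary_dart (X : Set V) hx hy
  rw [SimpleGraph.deleteEdges_adj] at hxy'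
  refine two_le_ecount_iff.2 ⟨x, hx, y, hyY, x', hx', y', mem x' (sub x' hx') y' hxy'.1 hx' hy',
    (bridgeless_adj.1 hxy).1, (bridgeless_adj.1 hxy'.1).1, ?_⟩
  rintro ⟨⟩
  exact hxy'.2 rfl

theorem EConn.subset_block {Z : Finset V} (h : EConn G 2 Z) {v : V} (hv : v ∈ Z) :
    Z ⊆ block G v := fun _ hw => mem_block.2 (h.reachable hv hw)

theorem isBlock_iff {B : Set V} : IsBlock G B ↔ ∃ v, B = block G v := by
  simp [IsBlock, block]

theorem isBridge_of_block {v x y : V} (hx : x ∈ block G v) (hy : y ∉ block G v) (h : G.Adj x y) :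
    G.IsBridge s(x, y) := by
  by_contra hb
  exact hy (mem_block.2 ((mem_block.1 hx).trans (bridgeless_adj.2 ⟨h, hb⟩).reachable))

theorem ncard_bridges_block (hconn : G.Connected) (v : V) :
    {e : Sym2 V | G.IsBridge e ∧ ∃ x ∈ (block G v : Set V), x ∈ e}.ncard =
      ecount G (block G v) (Finset.univ \ block G v) := by
  rw [ecount_eq_card]
  have himg : {e : Sym2 V | G.IsBridge e ∧ ∃ x ∈ (block G v : Set V), x ∈ e} =
      ((block G v ×ˢ (Finset.univ \ block G v)).filter fun p => G.Adj p.1 p.2).image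
        (fun p => s(p.1, p.2)) := by
    ext e
    simp only [Set.mem_ofPred_eq, Finset.coe_image, Set.mem_image, Finset.mem_coe,
      Finset.mem_filter, Finset.mem_product, Finset.mem_sdiff, Finset.mem_univ, true_and,
      Prod.exists]
    constructor
    · rintro ⟨hb, x, hx, y, rfl⟩
      refine ⟨x, y, ⟨⟨hx, fun hy => (econn_block v).not_isBridge hx hy hb⟩, ?_⟩, rfl⟩
      exact hb.reachable_iff_adj.1 (hconn.preconnected x y)
    · rintro ⟨x, y, ⟨⟨hx, hy⟩, hxy⟩, rfl⟩
      exact ⟨isBridge_of_block hx hy hxy, x, hx, Sym2.mem_mk_left x y⟩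
  rw [himg, Set.ncard_coe_finset, Finset.card_image_of_injOn]
  rintro ⟨x, y⟩ hxy ⟨x', y'⟩ hxy' he
  simp only [Finset.coe_filter, Finset.mem_product, Finset.mem_sdiff, Set.mem_ofPred_eq] at hxy hxy'
  rcases Sym2.eq_iff.1 he with ⟨rfl, rfl⟩ | ⟨rfl, rfl⟩
  · rfl
  · exact absurd hxy.1.1 hxy'.1.2.2

theorem isLeafBlock_iff (hconn : G.Connected) (v : V) :
    IsLeafBlock G (block G v : Set V) ↔ ecount G (block G v) (Finset.univ \ block G v) = 1 := by
  rw [IsLeafBlock, ncard_bridges_block hconn, and_iff_right (isBlock_iff.2 ⟨v, rfl⟩)]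

theorem econn_univ (hconn : G.Connected) : EConn G 1 (Finset.univ : Finset V) := by
  have := hconn.nonempty
  refine ⟨Finset.univ_nonempty, fun X Y hX hY hXY hXYU => ?_⟩
  obtain ⟨a, ha⟩ := hX
  obtain ⟨b, hb⟩ := hY
  obtain ⟨p⟩ := hconn.preconnected a b
  obtain ⟨⟨⟨x, y⟩, hxy⟩, -, hx, hy⟩ := p.exists_boundary_dart (X : Set V) ha
    (Finset.disjoint_right.1 hXY hb)
  refine (ecount_pos_iff G).2 ⟨x, hx, y, ?_, hxy⟩
  have := Finset.mem_univ y
  rw [← hXYU, Finset.mem_union] at this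
  exact this.resolve_left hy

/-- In a connected graph of excess `-1`, each block is a triangle or a subdivided `K₄`. -/
theorem block_of_excess_eq (hd : Subcubic G) (hconn : G.Connected)
    (hK : ¬ IsK4 G (Finset.univ : Finset V)) (ht : excess G σ Finset.univ = -1) (v : V) :
    excess G σ (block G v) = -1 ∧ (IsTri G (block G v) ∨ IsSubK4 G (block G v)) := by
  obtain ⟨B, -, hvB, hB, hBt, hBT, hmax⟩ := (goodBelow hd _).exists_block hd (Nat.lt_succ_self _)
    (econn_univ hconn) hK ht (Finset.mem_univ v)
  have : B = block G v := (hB.subset_block hvB).antisymm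
    (hmax _ (Finset.subset_univ _) (econn_block v) (self_mem_block v))
  exact this ▸ ⟨hBt, hBT⟩

theorem excess_univ_neg (hconn : G.Connected) (h : ∀ v, excess G σ (block G v) < 0) :
    excess G σ Finset.univ < 0 := by
  refine (econn_univ hconn).excess_neg fun B _ hB hmax => ?_
  obtain ⟨v, hv⟩ := hB.1
  have h1 := hB.subset_block hv
  rw [h1.antisymm (hmax _ (Finset.subset_univ _) (econn_block v) h1)]
  exact h v

theorem excess_univ_ge (hd : Subcubic G) (hconn : G.Connected)
    (hK : ¬ IsK4 G (Finset.univ : Finset V)) : -1 ≤ excess G σ Finset.univ :=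
  (goodBelow hd _).neg_one_le hd (Nat.lt_succ_self _) (econn_univ hconn) hK

end Finite

theorem ncard_edgeSet [Fintype V] (H : SimpleGraph V) :
    H.edgeSet.ncard = hsum (adjW H) Finset.univ := by
  have h1 := H.sum_degrees_eq_twice_card_edges
  have h2 := (isEdgeWeight_adjW H).wsum_self Finset.univ
  have h3 : wsum (adjW H) Finset.univ Finset.univ = ∑ v, H.degree v := by
    refine Finset.sum_congr rfl fun v _ => ?_
    rw [← SimpleGraph.card_neighborFinset_eq_degree, SimpleGraph.neighborFinset_eq_filter,
      Finset.card_filter]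
    rfl
  have h4 : H.edgeSet.ncard = H.edgeFinset.card := by
    rw [← Set.ncard_coe_finset, SimpleGraph.coe_edgeFinset]
  omega

theorem ncard_eq_hsum [Fintype V] (w : V → V → ℕ) (P : Sym2 V → Prop) (S : Finset V)
    (hw : ∀ x y, w x y = if G.Adj x y ∧ P s(x, y) then 1 else 0) :
    {e | e ∈ G.edgeSet ∧ P e ∧ ∀ v ∈ e, v ∈ S}.ncard = hsum w S := by
  obtain ⟨H, hH⟩ : ∃ H : SimpleGraph V, H = SimpleGraph.fromEdgeSet
    {e | e ∈ G.edgeSet ∧ P e ∧ ∀ v ∈ e, v ∈ S} := ⟨_, rfl⟩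
  have hadj : ∀ x y, H.Adj x y ↔ (G.Adj x y ∧ P s(x, y)) ∧ x ∈ S ∧ y ∈ S := by
    intro x y
    rw [hH, SimpleGraph.fromEdgeSet_adj]
    simp only [Set.mem_ofPred_eq, SimpleGraph.mem_edgeSet, Sym2.mem_iff, forall_eq_or_imp,
      forall_eq]
    exact ⟨fun h => ⟨⟨h.1.1, h.1.2.1⟩, h.1.2.2⟩, fun h => ⟨⟨h.1.1, h.1.2, h.2⟩, h.1.1.ne⟩⟩
  have hE : {e | e ∈ G.edgeSet ∧ P e ∧ ∀ v ∈ e, v ∈ S} = H.edgeSet := by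
    ext e
    induction e with
    | _ x y =>
      rw [SimpleGraph.mem_edgeSet, hadj]
      simp [and_assoc]
      tauto
  rw [hE, ncard_edgeSet, hsum, hsum, wsum, wsum]
  congr 1
  rw [← Finset.sum_subset (Finset.subset_univ S)]
  · refine Finset.sum_congr rfl fun x hx => ?_
    rw [← Finset.sum_subset (Finset.subset_univ S)]
    · refine Finset.sum_congr rfl fun y hy => ?_
      simp [hw, adjW, hadj, hx, hy]
    · intro y _ hy
      simp [adjW, hadj, hy]
  · intro x _ hx
    simp [adjW, hadj, hx]

theorem sgnSwitch_mk (X : Set V) (x y : V) : sgnSwitch σ X s(x, y) =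
    xor (σ s(x, y)) (xor (decide (x ∈ X)) (decide (y ∈ X))) := rfl

theorem negNum_sgnSwitch [Fintype V] (X : Set V) :
    negNum G (sgnSwitch σ X) = hsum (negW G σ fun v => decide (v ∈ X)) Finset.univ := by
  rw [negNum, ← ncard_eq_hsum (G := G) _ (fun e => sgnSwitch σ X e = true)]
  · simp
  · intro x y
    simp only [negW, sgnSwitch_mk]
    congr

theorem frust_eq_minNeg [Fintype V] : frust G σ = minNeg G σ Finset.univ := by
  apply le_antisymm
  · obtain ⟨c, hc⟩ := exists_minNeg G σ Finset.univ
    rw [← hc]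
    refine (ciInf_le (OrderBot.bddBelow _) {v | c v = true}).trans (le_of_eq ?_)
    rw [negNum_sgnSwitch]
    simp
  · refine le_ciInf fun X => ?_
    rw [negNum_sgnSwitch]
    exact minNeg_le G σ _ _

theorem ecount_univ_eq_ncard [Fintype V] (v : V) :
    ecount G {v} Finset.univ = (G.neighborSet v).ncard := by
  rw [ecount_singleton, ← Set.ncard_coe_finset]
  congr 1
  ext w
  simp

theorem subcubic_of_ncard [Fintype V] (h : ∀ v, (G.neighborSet v).ncard ≤ 3) : Subcubic G :=
  fun v S => (ecount_mono G subset_rfl (Finset.subset_univ S)).trans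
    ((ecount_univ_eq_ncard v).trans_le (h v))

theorem two_mul_esize_univ [Fintype V] :
    2 * esize G Finset.univ = ∑ v : V, (G.neighborSet v).ncard := by
  rw [← ecount_self, ecount_sum]
  exact Finset.sum_congr rfl fun v _ => ecount_univ_eq_ncard v

theorem sIso_of_bijective {n : ℕ} {H : SimpleGraph (Fin n)} {τ : Sym2 (Fin n) → Bool} {g : Fin n → V}
    (hg : Function.Bijective g) (k : Fin n → Bool)
    (hadj : ∀ i j, i < j → (H.Adj i j ↔ G.Adj (g i) (g j)))
    (hk : ∀ i j, i < j → H.Adj i j → xor (σ s(g i, g j)) (xor (k i) (k j)) = τ s(i, j)) :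
    SIso G σ H τ := by
  obtain ⟨f, rfl⟩ : ∃ f : Fin n ≃ V, ⇑f = g := ⟨Equiv.ofBijective g hg, rfl⟩
  have hadj' : ∀ i j, H.Adj i j ↔ G.Adj (f i) (f j) := by
    intro i j
    rcases lt_trichotomy i j with h | rfl | h
    · exact hadj i j h
    · simp
    · rw [H.adj_comm, G.adj_comm, hadj j i h]
  have hk' : ∀ i j, H.Adj i j → xor (σ s(f i, f j)) (xor (k i) (k j)) = τ s(i, j) := by
    intro i j hij
    rcases lt_trichotomy i j with h | rfl | h
    · exact hk i j h hij
    · exact absurd hij (H.irrefl)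
    · rw [Sym2.eq_swap, Bool.xor_comm (k i), hk j i h hij.symm, Sym2.eq_swap]
  refine ⟨⟨f.symm, fun {x y} => by simp [hadj']⟩, {v | k (f.symm v) = true}, fun e he => ?_⟩
  induction e with
  | _ x y =>
    have h1 := hk' (f.symm x) (f.symm y) (by simpa [hadj'] using he)
    simp only [Equiv.apply_symm_apply] at h1
    rw [sgnSwitch_mk]
    simpa using h1

theorem gamma1_cases (p q r s t u : Bool) : (∃ a b c d : Bool,
    (xor p (xor a b)).toNat + (xor q (xor a c)).toNat + (xor r (xor a d)).toNat +
      (xor s (xor b c)).toNat + (xor t (xor b d)).toNat + (xor u (xor c d)).toNat ≤ 1) ∨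
    ∃ a b c d : Bool, xor p (xor a b) = true ∧ xor q (xor a c) = false ∧ xor r (xor a d) = false ∧
      xor s (xor b c) = false ∧ xor t (xor b d) = false ∧ xor u (xor c d) = true := by
  revert p q r s t u
  decide

set_option synthInstance.maxSize 1000 in
set_option synthInstance.maxHeartbeats 200000 in
theorem gamma2_cases (p q r s t u v : Bool) : (∃ a b c d e : Bool,
    (xor p (xor a b)).toNat + (xor q (xor a c)).toNat + (xor r (xor a d)).toNat +
      (xor s (xor b d)).toNat + (xor t (xor c d)).toNat + (xor u (xor b e)).toNat +
      (xor v (xor c e)).toNat ≤ 1) ∨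
    ∃ a b c d e : Bool, xor p (xor a b) = false ∧ xor q (xor a c) = false ∧
      xor r (xor a d) = true ∧ xor s (xor b d) = false ∧ xor t (xor c d) = false ∧
      xor u (xor b e) = true ∧ xor v (xor c e) = false := by
  revert p q r s t u v
  decide

theorem two_le_gamma2 (a b c d e : Bool) :
    2 ≤ (xor false (xor a b)).toNat + (xor false (xor a c)).toNat + (xor true (xor a d)).toNat +
      (xor false (xor b d)).toNat + (xor false (xor c d)).toNat + (xor true (xor b e)).toNat +
      (xor false (xor c e)).toNat := by
  revert a b c d e
  decide

theorem IsEdgeWeight.hsum_insert {w : V → V → ℕ} (hw : IsEdgeWeight w) {v : V} {S : Finset V}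
    (hv : v ∉ S) : hsum w (insert v S) = hsum w S + ∑ y ∈ S, w v y := by
  rw [Finset.insert_eq, hw.hsum_union (by simpa using hv), hw.hsum_singleton, zero_add, wsum,
    Finset.sum_singleton]

theorem negW_of_adj {c : V → Bool} {x y : V} (h : G.Adj x y) :
    negW G σ c x y = (xor (σ s(x, y)) (xor (c x) (c y))).toNat := by
  cases hx : xor (σ s(x, y)) (xor (c x) (c y)) <;> simp [negW, h, hx]

theorem negW_of_not_adj {c : V → Bool} {x y : V} (h : ¬ G.Adj x y) : negW G σ c x y = 0 := by
  simp [negW, h]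

theorem IsEdgeWeight.hsum_three {w : V → V → ℕ} (hw : IsEdgeWeight w) {a b c : V} (hab : a ≠ b)
    (hac : a ≠ c) (hbc : b ≠ c) : hsum w {a, b, c} = w a b + w a c + w b c := by
  rw [hw.hsum_insert (by simp [*]), hw.hsum_insert (by simp [*]), hw.hsum_singleton,
    Finset.sum_singleton, Finset.sum_insert (by simp [*]), Finset.sum_singleton]
  ring

theorem IsEdgeWeight.hsum_four {w : V → V → ℕ} (hw : IsEdgeWeight w) {a b c d : V} (hab : a ≠ b)
    (hac : a ≠ c) (had : a ≠ d) (hbc : b ≠ c) (hbd : b ≠ d) (hcd : c ≠ d) :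
    hsum w {a, b, c, d} = w a b + w a c + w a d + w b c + w b d + w c d := by
  rw [hw.hsum_insert (by simp [*]), hw.hsum_three hbc hbd hcd, Finset.sum_insert (by simp [*]),
    Finset.sum_insert (by simp [*]), Finset.sum_singleton]
  ring

theorem IsEdgeWeight.hsum_five {w : V → V → ℕ} (hw : IsEdgeWeight w) {a b c d e : V} (hab : a ≠ b)
    (hac : a ≠ c) (had : a ≠ d) (hae : a ≠ e) (hbc : b ≠ c) (hbd : b ≠ d) (hbe : b ≠ e)
    (hcd : c ≠ d) (hce : c ≠ e) (hde : d ≠ e) : hsum w {a, b, c, d, e} =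
      w a b + w a c + w a d + w a e + w b c + w b d + w b e + w c d + w c e + w d e := by
  rw [hw.hsum_insert (by simp [*]), hw.hsum_four hbc hbd hbe hcd hce hde,
    Finset.sum_insert (by simp [*]), Finset.sum_insert (by simp [*]),
    Finset.sum_insert (by simp [*]), Finset.sum_singleton]
  ring

theorem IsK4.excess_nonneg [Fintype V] (hK : IsK4 G (Finset.univ : Finset V))
    (h1 : ¬ SIso G σ gamma1G gamma1S) : 0 ≤ excess G σ Finset.univ := by
  have h6 := hK.esize
  obtain ⟨a, b, c, d, hab, hac, had, hbc, hbd, hcd, hU⟩ := hK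
  obtain ⟨ka, kb, kc, kd, h⟩ | ⟨ka, kb, kc, kd, p, q, r, s, t, u⟩ := gamma1_cases
    (σ s(a, b)) (σ s(a, c)) (σ s(a, d)) (σ s(b, c)) (σ s(b, d)) (σ s(c, d))
  · have hle := minNeg_le G σ
      (fun v => if v = a then ka else if v = b then kb else if v = c then kc else kd) Finset.univ
    rw [hU] at hle h6 ⊢
    rw [(isEdgeWeight_negW G σ _).hsum_four hab.ne hac.ne had.ne hbc.ne hbd.ne hcd.ne,
      negW_of_adj hab, negW_of_adj hac, negW_of_adj had, negW_of_adj hbc, negW_of_adj hbd,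
      negW_of_adj hcd] at hle
    simp only [if_true, hab.ne', hac.ne', had.ne', hbc.ne', hbd.ne', hcd.ne', if_false] at hle
    unfold excess
    omega
  · refine absurd (sIso_of_bijective (g := ![a, b, c, d]) ⟨?_, ?_⟩ ![ka, kb, kc, kd] ?_ ?_) h1
    · intro i j
      fin_cases i <;> fin_cases j <;> simp [hab.ne, hac.ne, had.ne, hbc.ne, hbd.ne, hcd.ne,
        hab.ne', hac.ne', had.ne', hbc.ne', hbd.ne', hcd.ne']
    · intro v
      have : v ∈ ({a, b, c, d} : Finset V) := hU ▸ Finset.mem_univ v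
      simp only [Finset.mem_insert, Finset.mem_singleton] at this
      rcases this with rfl | rfl | rfl | rfl
      exacts [⟨0, rfl⟩, ⟨1, rfl⟩, ⟨2, rfl⟩, ⟨3, rfl⟩]
    · intro i j
      fin_cases i <;> fin_cases j <;> simp [gamma1G, *]
    · intro i j
      fin_cases i <;> fin_cases j <;> simp [gamma1G, gamma1S, *]

theorem IsSubK4.hsum_negW (hd : Subcubic G) {a b c d e : V} (hab : G.Adj a b) (hac : G.Adj a c)
    (had : G.Adj a d) (hbd : G.Adj b d) (hcd : G.Adj c d) (hbe : G.Adj b e) (hce : G.Adj c e)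
    (hbc : b ≠ c) (hae : a ≠ e) (hde : d ≠ e) (k : V → Bool) :
    hsum (negW G σ k) {a, b, c, d, e} = (xor (σ s(a, b)) (xor (k a) (k b))).toNat +
      (xor (σ s(a, c)) (xor (k a) (k c))).toNat + (xor (σ s(a, d)) (xor (k a) (k d))).toNat +
      (xor (σ s(b, d)) (xor (k b) (k d))).toNat + (xor (σ s(c, d)) (xor (k c) (k d))).toNat +
      (xor (σ s(b, e)) (xor (k b) (k e))).toNat + (xor (σ s(c, e)) (xor (k c) (k e))).toNat := by
  obtain ⟨nbc, nae, nde⟩ := nonadj_of_subK4 hd hab hac had hbd hcd hbe hce hbc hae hde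
  rw [(isEdgeWeight_negW G σ k).hsum_five hab.ne hac.ne had.ne hae hbc hbd.ne hbe.ne hcd.ne hce.ne
    hde, negW_of_adj hab, negW_of_adj hac, negW_of_adj had, negW_of_adj hbd, negW_of_adj hcd,
    negW_of_adj hbe, negW_of_adj hce, negW_of_not_adj nbc, negW_of_not_adj nae, negW_of_not_adj nde]
  ring

theorem IsSubK4.sIso (hd : Subcubic G) {S : Finset V} (h : IsSubK4 G S) (h2 : 2 ≤ minNeg G σ S) :
    SIso (G.induce (S : Set V)) (fun e => σ (Sym2.map (Subtype.val : ↥(S : Set V) → V) e))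
      gamma2G gamma2S := by
  obtain ⟨a, b, c, d, e, hab, hac, had, hbd, hcd, hbe, hce, hbc, hae, hde, hS⟩ := h
  obtain ⟨ka, kb, kc, kd, ke, h⟩ | ⟨ka, kb, kc, kd, ke, p, q, r, s, t, u, v⟩ := gamma2_cases
    (σ s(a, b)) (σ s(a, c)) (σ s(a, d)) (σ s(b, d)) (σ s(c, d)) (σ s(b, e)) (σ s(c, e))
  · have hle := minNeg_le G σ (fun v => if v = a then ka else if v = b then kb else
      if v = c then kc else if v = d then kd else ke) S
    rw [hS, IsSubK4.hsum_negW hd hab hac had hbd hcd hbe hce hbc hae hde] at hle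
    simp only [if_true, hab.ne', hac.ne', had.ne', hbc.symm, hbd.ne', hcd.ne', hbe.ne', hce.ne',
      hae.symm, hde.symm, if_false] at hle
    rw [hS] at h2
    omega
  · obtain ⟨nbc, nae, nde⟩ := nonadj_of_subK4 hd hab hac had hbd hcd hbe hce hbc hae hde
    have hm : a ∈ (S : Set V) ∧ b ∈ (S : Set V) ∧ c ∈ (S : Set V) ∧ d ∈ (S : Set V) ∧
      e ∈ (S : Set V) := by simp [hS]
    refine sIso_of_bijective (g := ![⟨a, hm.1⟩, ⟨b, hm.2.1⟩, ⟨c, hm.2.2.1⟩, ⟨d, hm.2.2.2.1⟩,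
      ⟨e, hm.2.2.2.2⟩]) ⟨?_, ?_⟩ ![ka, kb, kc, kd, ke] ?_ ?_
    · intro i j
      fin_cases i <;> fin_cases j <;> simp [hab.ne, hac.ne, had.ne, hbc, hbd.ne, hcd.ne,
        hbe.ne, hce.ne, hae, hde, hab.ne', hac.ne', had.ne', hbc.symm, hbd.ne', hcd.ne', hbe.ne',
        hce.ne', hae.symm, hde.symm]
    · rintro ⟨v, hv⟩
      have : v ∈ ({a, b, c, d, e} : Finset V) := hS ▸ hv
      simp only [Finset.mem_insert, Finset.mem_singleton] at this
      rcases this with rfl | rfl | rfl | rfl | rfl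
      exacts [⟨0, rfl⟩, ⟨1, rfl⟩, ⟨2, rfl⟩, ⟨3, rfl⟩, ⟨4, rfl⟩]
    · intro i j
      fin_cases i <;> fin_cases j <;> simp [gamma2G, *]
    · intro i j
      fin_cases i <;> fin_cases j <;> simp [gamma2G, gamma2S, *]

theorem isSubK4_of_sIso (hd : Subcubic G) {S : Finset V}
    (h : SIso (G.induce (S : Set V)) (fun e => σ (Sym2.map (Subtype.val : ↥(S : Set V) → V) e))
      gamma2G gamma2S) : IsSubK4 G S ∧ 2 ≤ minNeg G σ S := by
  obtain ⟨φ, X, h⟩ := h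
  obtain ⟨f, hf⟩ : ∃ f : Fin 5 → V, f = fun i => (φ.symm i : V) := ⟨_, rfl⟩
  have hinj : Function.Injective f := by
    rw [hf]
    exact Subtype.val_injective.comp φ.symm.injective
  have hadj : ∀ i j, gamma2G.Adj i j → G.Adj (f i) (f j) := by
    intro i j hij
    rw [hf]
    exact φ.symm.map_rel_iff.2 hij
  have hS : S = {f 0, f 1, f 2, f 3, f 4} := by
    ext v
    constructor
    · intro hv
      obtain ⟨i, hi⟩ : ∃ i, f i = v := ⟨φ ⟨v, hv⟩, by simp [hf]⟩
      rw [← hi]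
      fin_cases i <;> simp
    · intro hv
      simp only [Finset.mem_insert, Finset.mem_singleton] at hv
      rcases hv with rfl | rfl | rfl | rfl | rfl <;> rw [hf] <;> exact (φ.symm _).2
  obtain ⟨k, hk⟩ : ∃ k : Fin 5 → Bool, ∀ i j, gamma2G.Adj i j →
      σ s(f i, f j) = xor (gamma2S s(i, j)) (xor (k i) (k j)) := by
    refine ⟨fun i => decide (φ.symm i ∈ X), fun i j hij => ?_⟩
    have := h s(φ.symm i, φ.symm j) (φ.symm.map_rel_iff.2 hij)
    rw [sgnSwitch_mk] at this
    simp only [Sym2.map_mk, RelIso.apply_symm_apply] at this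
    rw [← this, hf]
    simp
  have h01 : gamma2G.Adj 0 1 := by simp [gamma2G]
  have h02 : gamma2G.Adj 0 2 := by simp [gamma2G]
  have h03 : gamma2G.Adj 0 3 := by simp [gamma2G]
  have h13 : gamma2G.Adj 1 3 := by simp [gamma2G]
  have h23 : gamma2G.Adj 2 3 := by simp [gamma2G]
  have h14 : gamma2G.Adj 1 4 := by simp [gamma2G]
  have h24 : gamma2G.Adj 2 4 := by simp [gamma2G]
  have n12 : f 1 ≠ f 2 := hinj.ne (by decide)
  have n04 : f 0 ≠ f 4 := hinj.ne (by decide)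
  have n34 : f 3 ≠ f 4 := hinj.ne (by decide)
  refine ⟨⟨f 0, f 1, f 2, f 3, f 4, hadj _ _ h01, hadj _ _ h02, hadj _ _ h03, hadj _ _ h13,
    hadj _ _ h23, hadj _ _ h14, hadj _ _ h24, n12, n04, n34, hS⟩, ?_⟩
  obtain ⟨c, hc⟩ := exists_minNeg G σ S
  rw [← hc, hS, IsSubK4.hsum_negW hd (hadj _ _ h01) (hadj _ _ h02) (hadj _ _ h03) (hadj _ _ h13)
    (hadj _ _ h23) (hadj _ _ h14) (hadj _ _ h24) n12 n04 n34, hk _ _ h01, hk _ _ h02, hk _ _ h03,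
    hk _ _ h13, hk _ _ h23, hk _ _ h14, hk _ _ h24]
  have hxor : ∀ p a b c d : Bool,
      xor (xor p (xor a b)) (xor c d) = xor p (xor (xor a c) (xor b d)) := by decide
  simp only [hxor]
  convert two_le_gamma2 (xor (k 0) (c (f 0))) (xor (k 1) (c (f 1))) (xor (k 2) (c (f 2)))
    (xor (k 3) (c (f 3))) (xor (k 4) (c (f 4))) <;> simp [gamma2S]

theorem IsTri.hsum_negW {a b c : V} (hab : G.Adj a b) (hac : G.Adj a c) (hbc : G.Adj b c)
    (k : V → Bool) : hsum (negW G σ k) {a, b, c} = (xor (σ s(a, b)) (xor (k a) (k b))).toNat +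
      (xor (σ s(a, c)) (xor (k a) (k c))).toNat + (xor (σ s(b, c)) (xor (k b) (k c))).toNat := by
  rw [(isEdgeWeight_negW G σ k).hsum_three hab.ne hac.ne hbc.ne, negW_of_adj hab, negW_of_adj hac,
    negW_of_adj hbc]

theorem triangle_parity (p q r : Bool) (h : Odd (p.toNat + q.toNat + r.toNat)) (a b c : Bool) :
    1 ≤ (xor p (xor a b)).toNat + (xor q (xor a c)).toNat + (xor r (xor b c)).toNat := by
  revert p q r a b c
  decide

theorem triangle_balanced (p q r : Bool) (h : ¬ Odd (p.toNat + q.toNat + r.toNat)) :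
    ∃ a b c, (xor p (xor a b)).toNat + (xor q (xor a c)).toNat + (xor r (xor b c)).toNat = 0 := by
  revert p q r
  decide

theorem ncard_negative [Fintype V] (S : Finset V) :
    {e : Sym2 V | e ∈ G.edgeSet ∧ σ e = true ∧ ∀ v ∈ e, v ∈ (S : Set V)}.ncard =
      hsum (negW G σ fun _ => false) S :=
  ncard_eq_hsum _ (fun e => σ e = true) S fun x y => by simp [negW]

theorem isNegTriangleBlock_iff [Fintype V] {S : Finset V} :
    IsNegTriangleBlock G σ (S : Set V) ↔ IsTri G S ∧ 1 ≤ minNeg G σ S := by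
  rw [IsNegTriangleBlock, ncard_negative, Set.ncard_coe_finset]
  constructor
  · rintro ⟨h3, hadj, hodd⟩
    obtain ⟨a, b, c, hab, hac, hbc, rfl⟩ := Finset.card_eq_three.1 h3
    have ab := hadj a (by simp) b (by simp) hab
    have ac := hadj a (by simp) c (by simp) hac
    have bc := hadj b (by simp) c (by simp) hbc
    refine ⟨⟨a, b, c, ab, ac, bc, rfl⟩, ?_⟩
    obtain ⟨k, hk⟩ := exists_minNeg G σ {a, b, c}
    rw [← hk, IsTri.hsum_negW ab ac bc]
    rw [IsTri.hsum_negW ab ac bc] at hodd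
    exact triangle_parity _ _ _ (by simpa using hodd) _ _ _
  · rintro ⟨hT, hm⟩
    refine ⟨hT.card, ?_⟩
    obtain ⟨a, b, c, hab, hac, hbc, rfl⟩ := hT
    refine ⟨fun x hx y hy hxy => ?_, ?_⟩
    · simp only [Finset.coe_insert, Finset.coe_singleton, Set.mem_insert_iff,
        Set.mem_singleton_iff] at hx hy
      rcases hx with rfl | rfl | rfl <;> rcases hy with rfl | rfl | rfl <;>
        simp_all [G.adj_comm]
    · by_contra hodd
      rw [IsTri.hsum_negW hab hac hbc] at hodd
      obtain ⟨ka, kb, kc, h⟩ := triangle_balanced (σ s(a, b)) (σ s(a, c)) (σ s(b, c))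
        (by simpa using hodd)
      have hle := minNeg_le G σ (fun v => if v = a then ka else if v = b then kb else kc) {a, b, c}
      rw [IsTri.hsum_negW hab hac hbc] at hle
      simp only [if_true, hab.ne', hac.ne', hbc.ne', if_false] at hle
      omega

theorem out_eq_of_regular [Fintype V] (h : ∀ v, (G.neighborSet v).ncard = 3) (S : Finset V) :
    ecount G S (Finset.univ \ S) + 2 * esize G S = 3 * S.card := by
  rw [← ecount_self, add_comm, ← ecount_union_right G Finset.disjoint_sdiff,
    Finset.union_sdiff_of_subset (Finset.subset_univ S), ecount_sum,
    Finset.sum_const_nat fun v _ => (ecount_univ_eq_ncard v).trans (h v), mul_comm]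

theorem two_mul_esize_of_regular [Fintype V] (h : ∀ v, (G.neighborSet v).ncard = 3) :
    2 * esize G Finset.univ = 3 * Fintype.card V := by
  rw [two_mul_esize_univ, Finset.sum_const_nat fun v _ => h v, Finset.card_univ, mul_comm]

theorem regular_of_extremal [Fintype V] (hsub : ∀ v, (G.neighborSet v).ncard ≤ 3)
    (h : 3 * Fintype.card V ≤ 2 * esize G Finset.univ) (v : V) : (G.neighborSet v).ncard = 3 := by
  rw [two_mul_esize_univ] at h
  have h1 : ∑ v : V, (G.neighborSet v).ncard = ∑ _v : V, 3 :=
    (Finset.sum_le_sum fun v _ => hsub v).antisymm (by simpa [mul_comm] using h)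
  exact (Finset.sum_eq_sum_iff_of_le fun v _ => hsub v).1 h1 v (Finset.mem_univ v)

end SignedSubcubic

open SignedSubcubic in
/-- For a signed connected simple subcubic graph `(G, σ)` not isomorphic
to `Γ̂₁`, `F(G, σ) = (3·v(G)+2)/8` holds iff `G` is cubic, has a cut-edge, every
leaf-block is (switching-)isomorphic to `Γ̂₂`, and every non-leaf-block is a negative
triangle. -/
theorem frust_eq_extremal_iff {V : Type*} [Fintype V]
    (G : SimpleGraph V) (σ : Sym2 V → Bool)
    (hconn : G.Connected)
    (hsub : ∀ v : V, (G.neighborSet v).ncard ≤ 3)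
    (h1 : ¬ SIso G σ gamma1G gamma1S) :
    8 * frust G σ = 3 * Fintype.card V + 2 ↔
      ((∀ v : V, (G.neighborSet v).ncard = 3) ∧
       (∃ e : Sym2 V, G.IsBridge e) ∧
       (∀ B : Set V, IsLeafBlock G B →
         SIso (G.induce B) (fun e => σ (Sym2.map (Subtype.val : B → V) e)) gamma2G gamma2S) ∧
       (∀ B : Set V, IsBlock G B → ¬ IsLeafBlock G B → IsNegTriangleBlock G σ B)) := by
  have hd := subcubic_of_ncard hsub
  rw [frust_eq_minNeg]
  have hK : excess G σ Finset.univ < 0 → ¬ IsK4 G (Finset.univ : Finset V) :=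
    fun h hK => (hK.excess_nonneg h1).not_gt h
  have hge : -1 ≤ excess G σ Finset.univ := by
    by_contra h
    exact h (excess_univ_ge hd hconn (hK (by omega)))
  constructor
  · intro h
    have hm : 2 * esize G Finset.univ ≤ 3 * Fintype.card V := by
      rw [two_mul_esize_univ]
      simpa [mul_comm] using Finset.sum_le_sum fun v (_ : v ∈ Finset.univ) => hsub v
    have hex : excess G σ Finset.univ = -1 := by
      unfold excess at hge ⊢
      omega
    have hcub := regular_of_extremal hsub (by unfold excess at hex; omega)
    have hb := block_of_excess_eq hd hconn (hK (by omega)) hex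
    have htri : ∀ v, IsTri G (block G v) →
        ecount G (block G v) (Finset.univ \ block G v) = 3 := by
      intro v hT
      have := out_eq_of_regular hcub (block G v)
      rw [hT.card, hT.esize] at this
      omega
    have hsub4 : ∀ v, IsSubK4 G (block G v) →
        ecount G (block G v) (Finset.univ \ block G v) = 1 := by
      intro v hT
      have := out_eq_of_regular hcub (block G v)
      rw [hT.card, hT.esize hd] at this
      omega
    refine ⟨hcub, ?_, ?_, ?_⟩
    · obtain ⟨v⟩ := hconn.nonempty
      have : 1 ≤ ecount G (block G v) (Finset.univ \ block G v) := by
        rcases (hb v).2 with hT | hT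
        · rw [htri v hT]; norm_num
        · rw [hsub4 v hT]
      obtain ⟨x, hx, y, hy, hxy⟩ := (ecount_pos_iff G).1 this
      exact ⟨_, isBridge_of_block hx (Finset.mem_sdiff.1 hy).2 hxy⟩
    · intro B hB
      obtain ⟨v, rfl⟩ := isBlock_iff.1 hB.1
      rw [isLeafBlock_iff hconn] at hB
      obtain ⟨he, hT | hT⟩ := hb v
      · have := htri v hT
        omega
      · refine hT.sIso hd ?_
        rw [excess, hT.esize hd] at he
        omega
    · intro B hB hl
      obtain ⟨v, rfl⟩ := isBlock_iff.1 hB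
      rw [isLeafBlock_iff hconn] at hl
      obtain ⟨he, hT | hT⟩ := hb v
      · refine isNegTriangleBlock_iff.2 ⟨hT, ?_⟩
        rw [excess, hT.esize] at he
        omega
      · exact absurd (hsub4 v hT) hl
  · rintro ⟨hcub, -, hleaf, hnon⟩
    have hneg := excess_univ_neg (σ := σ) hconn fun v => by
      by_cases hl : IsLeafBlock G (block G v : Set V)
      · obtain ⟨hT, h2⟩ := isSubK4_of_sIso hd (hleaf _ hl)
        rw [excess, hT.esize hd]
        omega
      · obtain ⟨hT, h2⟩ := isNegTriangleBlock_iff.1 (hnon _ (isBlock_iff.2 ⟨v, rfl⟩) hl)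
        rw [excess, hT.esize]
        omega
    have h2 := two_mul_esize_of_regular hcub
    unfold excess at hge hneg
    omega
end
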